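/- Let M be a II₁ factor with faithful tracial state τ, and let M₁, M₂ ⊆ M be von Neumann subalgebras which are infinite-dimensional factors such that: xy = yx for all x ∈ M₁, y ∈ M₂; τ(xy) = τ(x)τ(y) for all x ∈ M₁, y ∈ M₂; and M = vN(M₁ ∪ M₂) (these conditions realize M as the tensor product II₁ factor M₁ ⊗̄ M₂). For i = 1, 2 let A_i be a singular MASA in M_i, and let A := vN(A₁ ∪ A₂). Then A is a singular MASA in M. -/

import Mathlib

open scoped ComplexOrder

noncomputable section

variable {H : Type*} [NormedAddCommGroup H] [InnerProductSpace ℂ H] [CompleteSpace H]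

/-- The von Neumann algebra generated by a set of bounded operators `S`:
the double commutant of `S ∪ S*`. -/
def vNgen (S : Set (H →L[ℂ] H)) : Set (H →L[ℂ] H) :=
  Set.centralizer (Set.centralizer (S ∪ star '' S))

/-- `M` is a von Neumann algebra acting on `H`: a unital *-subalgebra of `B(H)`
equal to its double commutant. -/
structure IsVonNeumannAlgebra (M : Set (H →L[ℂ] H)) : Prop where
  one_mem : (1 : H →L[ℂ] H) ∈ M
  add_mem : ∀ x ∈ M, ∀ y ∈ M, x + y ∈ M
  mul_mem : ∀ x ∈ M, ∀ y ∈ M, x * y ∈ M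
  smul_mem : ∀ (c : ℂ), ∀ x ∈ M, c • x ∈ M
  star_mem : ∀ x ∈ M, star x ∈ M
  double_commutant : Set.centralizer (Set.centralizer M) = M

/-- `τ` is a faithful tracial state on `M`. -/
structure IsFaithfulTracialState (M : Set (H →L[ℂ] H)) (τ : (H →L[ℂ] H) → ℂ) : Prop where
  map_add : ∀ x ∈ M, ∀ y ∈ M, τ (x + y) = τ x + τ y
  map_smul : ∀ (c : ℂ), ∀ x ∈ M, τ (c • x) = c * τ x
  map_one : τ 1 = 1
  nonneg : ∀ x ∈ M, 0 ≤ τ (star x * x)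
  tracial : ∀ x ∈ M, ∀ y ∈ M, τ (x * y) = τ (y * x)
  faithful : ∀ x ∈ M, τ (star x * x) = 0 → x = 0

/-- `M` is infinite dimensional: it is not contained in the span of finitely many operators. -/
def IsInfiniteDimensionalSet (M : Set (H →L[ℂ] H)) : Prop :=
  ∀ s : Finset (H →L[ℂ] H),
    ¬ (M ⊆ (Submodule.span ℂ (s : Set (H →L[ℂ] H)) : Set (H →L[ℂ] H)))

/-- `M` is a factor: its center consists of scalar multiples of the identity. -/
def IsFactor (M : Set (H →L[ℂ] H)) : Prop :=
  ∀ x ∈ M, (∀ y ∈ M, x * y = y * x) → ∃ c : ℂ, x = c • (1 : H →L[ℂ] H)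

/-- `M` is a II₁ factor with faithful tracial state `τ`. -/
structure IsII1Factor (M : Set (H →L[ℂ] H)) (τ : (H →L[ℂ] H) → ℂ) : Prop where
  vna : IsVonNeumannAlgebra M
  factor : IsFactor M
  infdim : IsInfiniteDimensionalSet M
  trace : IsFaithfulTracialState M τ

/-- The 2-norm `‖x‖₂ = τ(x*x)^{1/2}` associated to the trace `τ`. -/
def norm2 (τ : (H →L[ℂ] H) → ℂ) (x : H →L[ℂ] H) : ℝ :=
  Real.sqrt (τ (star x * x)).re

/-- `E` is the `τ`-preserving conditional expectation of `M` onto `B`. -/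
def IsCondExp (M B : Set (H →L[ℂ] H)) (τ : (H →L[ℂ] H) → ℂ)
    (E : (H →L[ℂ] H) → (H →L[ℂ] H)) : Prop :=
  (∀ x ∈ M, E x ∈ B) ∧ (∀ x ∈ M, ∀ b ∈ B, τ ((x - E x) * b) = 0)

/-- `A` is a maximal abelian *-subalgebra (MASA) of `M`. -/
def IsMasa (M A : Set (H →L[ℂ] H)) : Prop :=
  A ⊆ M ∧ (∀ a ∈ A, star a ∈ A) ∧ {x ∈ M | ∀ a ∈ A, x * a = a * x} = A

/-- `u` is a unitary operator. -/
def IsUnitary (u : H →L[ℂ] H) : Prop :=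
  star u * u = 1 ∧ u * star u = 1

/-- The set of normalizing unitaries of `A` in `M`: unitaries `u ∈ M` with `uAu* = A`. -/
def normalizerSet (M A : Set (H →L[ℂ] H)) : Set (H →L[ℂ] H) :=
  {u | u ∈ M ∧ IsUnitary u ∧ (fun a => u * a * star u) '' A = A}

/-- The normalizing algebra `N_M(A)''` of `A` in `M`. -/
def normAlg (M A : Set (H →L[ℂ] H)) : Set (H →L[ℂ] H) :=
  vNgen (normalizerSet M A)

/-- The triple `B ⊆ N ⊆ M` satisfies the relative weak asymptotic homomorphism property
relative to the trace `τ` and the conditional expectations `EB` and `EN`. -/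
def RelWAHP (M N B : Set (H →L[ℂ] H)) (τ : (H →L[ℂ] H) → ℂ)
    (EB EN : (H →L[ℂ] H) → (H →L[ℂ] H)) : Prop :=
  ∀ (n : ℕ) (x : Fin n → (H →L[ℂ] H)), (∀ i, x i ∈ M) →
    ∀ ε : ℝ, 0 < ε → ∃ u ∈ B, IsUnitary u ∧
      ∀ i j, norm2 τ (EB (x i * u * x j) - EB (EN (x i) * u * EN (x j))) < ε

namespace TensorMasa

open Filter Topology ContinuousLinearMap
open scoped InnerProductSpace

set_option linter.unusedSectionVars false

section WeakLimits

variable {H : Type*} [NormedAddCommGroup H] [InnerProductSpace ℂ H] [CompleteSpace H]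
variable {ι : Type*} {l : Filter ι}

/-- Convergence of a family of operators in the weak operator topology. -/
def WLim (l : Filter ι) (f : ι → H →L[ℂ] H) (T : H →L[ℂ] H) : Prop :=
  ∀ ξ ζ : H, Tendsto (fun i => ⟪ξ, f i ζ⟫_ℂ) l (𝓝 ⟪ξ, T ζ⟫_ℂ)

namespace WLim

variable {f g : ι → H →L[ℂ] H} {S T : H →L[ℂ] H}

theorem unique [l.NeBot] (h₁ : WLim l f S) (h₂ : WLim l f T) : S = T := by
  ext ζ
  exact ext_inner_left ℂ fun ξ => tendsto_nhds_unique (h₁ ξ ζ) (h₂ ξ ζ)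

theorem const (T : H →L[ℂ] H) : WLim l (fun _ => T) T := fun _ _ => tendsto_const_nhds

theorem add (h₁ : WLim l f S) (h₂ : WLim l g T) : WLim l (fun i => f i + g i) (S + T) := by
  intro ξ ζ
  simpa [inner_add_right] using (h₁ ξ ζ).add (h₂ ξ ζ)

theorem smul (c : ℂ) (h₁ : WLim l f S) : WLim l (fun i => c • f i) (c • S) := by
  intro ξ ζ
  simpa [inner_smul_right] using (h₁ ξ ζ).const_mul c

theorem sub (h₁ : WLim l f S) (h₂ : WLim l g T) : WLim l (fun i => f i - g i) (S - T) := by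
  intro ξ ζ
  simpa [inner_sub_right] using (h₁ ξ ζ).sub (h₂ ξ ζ)

theorem mul_left (a : H →L[ℂ] H) (h : WLim l f S) : WLim l (fun i => a * f i) (a * S) := by
  intro ξ ζ
  simpa [← adjoint_inner_left] using h (adjoint a ξ) ζ

theorem mul_right (a : H →L[ℂ] H) (h : WLim l f S) : WLim l (fun i => f i * a) (S * a) := by
  intro ξ ζ
  simpa using h ξ (a ζ)

theorem star (h : WLim l f S) : WLim l (fun i => star (f i)) (star S) := by
  intro ξ ζ
  have := (Complex.continuous_conj.tendsto _).comp (h ζ ξ)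
  simpa [Function.comp_def, star_eq_adjoint, adjoint_inner_right] using this

theorem congr' (h : WLim l f S) (hfg : f =ᶠ[l] g) : WLim l g S := by
  intro ξ ζ
  refine (h ξ ζ).congr' ?_
  filter_upwards [hfg] with i hi
  rw [hi]

theorem norm_le [l.NeBot] (h : WLim l f S) {C : ℝ} (hC : 0 ≤ C) (hf : ∀ᶠ i in l, ‖f i‖ ≤ C) :
    ‖S‖ ≤ C := by
  refine S.opNorm_le_bound hC fun ζ => ?_
  have h1 : ‖⟪S ζ, S ζ⟫_ℂ‖ ≤ ‖S ζ‖ * (C * ‖ζ‖) := by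
    refine le_of_tendsto (h (S ζ) ζ).norm ?_
    filter_upwards [hf] with i hi
    refine (norm_inner_le_norm _ _).trans ?_
    gcongr
    exact (f i).le_of_opNorm_le hi ζ
  rw [inner_self_eq_norm_sq_to_K] at h1
  simp only [norm_pow, RCLike.norm_ofReal, abs_norm] at h1
  rcases eq_or_lt_of_le (norm_nonneg (S ζ)) with h0 | h0
  · rw [← h0]; positivity
  · nlinarith

theorem nonneg [l.NeBot] (h : WLim l f S) (hf : ∀ᶠ i in l, 0 ≤ f i) : 0 ≤ S := by
  have hs : ∀ ζ, 0 ≤ ⟪ζ, S ζ⟫_ℂ := by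
    intro ζ
    refine ge_of_tendsto (h ζ ζ) ?_
    filter_upwards [hf] with i hi
    exact ((nonneg_iff_isPositive _).1 hi).inner_nonneg_right ζ
  rw [nonneg_iff_isPositive, isPositive_iff_complex]
  intro ζ
  have h1 := hs ζ
  have h2 : ⟪S ζ, ζ⟫_ℂ = ⟪ζ, S ζ⟫_ℂ := by
    rw [← inner_conj_symm, RCLike.conj_eq_iff_im]
    exact (Complex.le_def.1 h1).2.symm
  rw [h2]
  have h3 := Complex.le_def.1 h1
  refine ⟨?_, h3.1⟩
  apply Complex.ext
  · simp
  · simpa using h3.2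

theorem exists_of_bounded {𝒰 : Ultrafilter ι} {C : ℝ} (hf : ∀ i, ‖f i‖ ≤ C) :
    ∃ T, WLim (𝒰 : Filter ι) f T := by
  have hC : 0 ≤ C := by
    obtain ⟨i, -⟩ := (𝒰.neBot).nonempty_of_mem (univ_mem (f := (𝒰 : Filter ι)))
    exact (norm_nonneg _).trans (hf i)
  have hb : ∀ i ξ ζ, ‖⟪ξ, f i ζ⟫_ℂ‖ ≤ C * ‖ξ‖ * ‖ζ‖ := by
    intro i ξ ζ
    refine (norm_inner_le_norm _ _).trans ?_
    have := (f i).le_of_opNorm_le (hf i) ζ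
    calc ‖ξ‖ * ‖f i ζ‖ ≤ ‖ξ‖ * (C * ‖ζ‖) := by gcongr
      _ = _ := by ring
  have hex : ∀ ξ ζ : H, ∃ z : ℂ, Tendsto (fun i => ⟪ξ, f i ζ⟫_ℂ) 𝒰 (𝓝 z) := by
    intro ξ ζ
    have hK := isCompact_closedBall (0 : ℂ) (C * ‖ξ‖ * ‖ζ‖)
    obtain ⟨z, -, hz⟩ := hK.ultrafilter_le_nhds (𝒰.map (fun i => ⟪ξ, f i ζ⟫_ℂ)) (by
      rw [le_principal_iff]
      refine mem_map.2 (univ_mem' fun i => ?_)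
      simpa using hb i ξ ζ)
    exact ⟨z, hz⟩
  choose b hb' using hex
  let B0 : H →ₗ⋆[ℂ] H →ₗ[ℂ] ℂ := LinearMap.mk₂'ₛₗ (starRingEnd ℂ) (RingHom.id ℂ) b
    (fun ξ ξ' ζ => tendsto_nhds_unique (hb' _ _)
      (by simpa [inner_add_left] using (hb' ξ ζ).add (hb' ξ' ζ)))
    (fun c ξ ζ => tendsto_nhds_unique (hb' _ _)
      (by simpa [inner_smul_left, mul_comm] using (hb' ξ ζ).const_mul (starRingEnd ℂ c)))
    (fun ξ ζ ζ' => tendsto_nhds_unique (hb' _ _)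
      (by simpa [inner_add_right] using (hb' ξ ζ).add (hb' ξ ζ')))
    (fun c ξ ζ => tendsto_nhds_unique (hb' _ _)
      (by simpa [inner_smul_right] using (hb' ξ ζ).const_mul c))
  let B : H →L⋆[ℂ] H →L[ℂ] ℂ := B0.mkContinuous₂ C (fun ξ ζ =>
    le_of_tendsto (hb' ξ ζ).norm (Eventually.of_forall fun i => hb i ξ ζ))
  refine ⟨adjoint (InnerProductSpace.continuousLinearMapOfBilin B), fun ξ ζ => ?_⟩
  rw [adjoint_inner_right, InnerProductSpace.continuousLinearMapOfBilin_apply]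
  exact hb' ξ ζ

end WLim

end WeakLimits

section Basic

variable {H : Type*} [NormedAddCommGroup H] [InnerProductSpace ℂ H] [CompleteSpace H]
variable {N : VonNeumannAlgebra H}

theorem mem_of_commute {x : H →L[ℂ] H} (h : ∀ y ∈ N.commutant, x * y = y * x) : x ∈ N := by
  rw [← N.commutant_commutant]
  exact VonNeumannAlgebra.mem_commutant_iff.2 fun y hy => (h y hy).symm

theorem commute_of_mem {x y : H →L[ℂ] H} (hx : x ∈ N) (hy : y ∈ N.commutant) : x * y = y * x :=
  VonNeumannAlgebra.mem_commutant_iff.1 hy x hx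

theorem smul_mem' (c : ℂ) {x : H →L[ℂ] H} (hx : x ∈ N) : c • x ∈ N :=
  mem_of_commute fun y hy => by simp [commute_of_mem hx hy]

theorem rsmul_mem (c : ℝ) {x : H →L[ℂ] H} (hx : x ∈ N) : c • x ∈ N :=
  mem_of_commute fun y hy => by simp [commute_of_mem hx hy]

theorem WLim.mem {ι : Type*} {l : Filter ι} [l.NeBot] {f : ι → H →L[ℂ] H} {T : H →L[ℂ] H}
    (h : WLim l f T) (hf : ∀ᶠ i in l, f i ∈ N) : T ∈ N := by
  refine mem_of_commute fun y hy => ?_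
  refine (h.mul_right y).unique ((h.mul_left y).congr' ?_)
  filter_upwards [hf] with i hi
  exact (commute_of_mem hi hy).symm

theorem mem_of_tendsto {ι : Type*} {l : Filter ι} [l.NeBot] {f : ι → H →L[ℂ] H} {T : H →L[ℂ] H}
    (h : Tendsto f l (𝓝 T)) (hf : ∀ᶠ i in l, f i ∈ N) : T ∈ N := by
  refine mem_of_commute fun y hy => ?_
  refine tendsto_nhds_unique (h.mul_const y) ((h.const_mul y).congr' ?_)
  filter_upwards [hf] with i hi
  exact (commute_of_mem hi hy).symm

theorem isClosed_coe : IsClosed (N : Set (H →L[ℂ] H)) := by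
  refine isClosed_of_closure_subset fun x hx => ?_
  obtain ⟨u, hu, hx⟩ := mem_closure_iff_seq_limit.1 hx
  exact mem_of_tendsto hx (Eventually.of_forall hu)

theorem cfc_mem {x : H →L[ℂ] H} (hx : x ∈ N) (hsa : IsSelfAdjoint x) (f : ℝ → ℝ) :
    cfc f x ∈ N := by
  refine mem_of_commute fun y hy => ?_
  have : Commute x y := commute_of_mem hx hy
  exact (hsa.commute_cfc this f).eq

theorem posPart_mem {x : H →L[ℂ] H} (hx : x ∈ N) (hsa : IsSelfAdjoint x) : x⁺ ∈ N := by
  rw [CFC.posPart_def, cfcₙ_eq_cfc]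
  exact cfc_mem hx hsa _

theorem negPart_mem {x : H →L[ℂ] H} (hx : x ∈ N) (hsa : IsSelfAdjoint x) : x⁻ ∈ N := by
  rw [CFC.negPart_def, cfcₙ_eq_cfc]
  exact cfc_mem hx hsa _

/-- The projection onto the closure of the range. -/
def supp (x : H →L[ℂ] H) : H →L[ℂ] H :=
  (LinearMap.range (x : H →ₗ[ℂ] H)).topologicalClosure.starProjection

theorem supp_isStarProjection (x : H →L[ℂ] H) : IsStarProjection (supp x) :=
  isStarProjection_starProjection

theorem supp_mul (x : H →L[ℂ] H) : supp x * x = x := by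
  ext ξ
  exact Submodule.starProjection_eq_self_iff.2
    (Submodule.le_topologicalClosure _ (LinearMap.mem_range_self (x : H →ₗ[ℂ] H) ξ))

theorem mul_supp_eq_zero {x y : H →L[ℂ] H} (h : y * x = 0) : y * supp x = 0 := by
  ext ξ
  have h1 : supp x ξ ∈ (LinearMap.range (x : H →ₗ[ℂ] H)).topologicalClosure :=
    Submodule.starProjection_apply_mem _ _
  have h2 : (LinearMap.range (x : H →ₗ[ℂ] H)).topologicalClosure ≤
      LinearMap.ker (y : H →ₗ[ℂ] H) := by
    refine Submodule.topologicalClosure_minimal _ ?_ y.isClosed_ker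
    rintro _ ⟨ζ, rfl⟩
    exact congrArg (fun T : H →L[ℂ] H => T ζ) h
  exact h2 h1

theorem supp_eq_zero_iff {x : H →L[ℂ] H} : supp x = 0 ↔ x = 0 := by
  constructor
  · intro h
    rw [← supp_mul x, h, zero_mul]
  · rintro rfl
    simpa using mul_supp_eq_zero (x := (0 : H →L[ℂ] H)) (y := 1) (by simp)

theorem supp_mem {x : H →L[ℂ] H} (hx : x ∈ N) : supp x ∈ N := by
  have key : ∀ y ∈ N.commutant, supp x * y * supp x = y * supp x := by
    intro y hy
    have h : (supp x * y - y) * x = 0 := by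
      rw [sub_mul, mul_assoc, ← commute_of_mem hx hy, ← mul_assoc, supp_mul, sub_self]
    have := mul_supp_eq_zero h
    rwa [sub_mul, sub_eq_zero] at this
  refine mem_of_commute fun y hy => ?_
  have h1 := key y hy
  have h2 := congrArg star (key (star y) (star_mem hy))
  simp only [star_mul, star_star, (supp_isStarProjection x).isSelfAdjoint.star_eq] at h2
  rw [← h1, mul_assoc, h2]

theorem IsStarProjection.nonneg' {p : H →L[ℂ] H} (hp : IsStarProjection p) : 0 ≤ p := by
  have := star_mul_self_nonneg p
  rwa [hp.isSelfAdjoint.star_eq, hp.isIdempotentElem.eq] at this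

theorem mul_eq_zero_comm {p q : H →L[ℂ] H} (hp : IsSelfAdjoint p) (hq : IsSelfAdjoint q)
    (h : p * q = 0) : q * p = 0 := by
  simpa [hp.star_eq, hq.star_eq] using congrArg star h

/-- Spectral projection of a self-adjoint element of a von Neumann algebra. -/
theorem exists_spectral_projection {b : H →L[ℂ] H} (hb : b ∈ N) (hsa : IsSelfAdjoint b) :
    ∃ s ∈ N, IsStarProjection s ∧ s * b⁺ = b⁺ ∧ s * b⁻ = 0 ∧ (s = 0 → b⁺ = 0) ∧
      (∀ y, y * b⁺ = 0 → y * s = 0) ∧ b⁺ * s = b⁺ ∧ b⁻ * s = 0 := by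
  have hs := (supp_isStarProjection b⁺)
  have hp : IsSelfAdjoint b⁺ := (CFC.posPart_nonneg b).isSelfAdjoint
  have hn : IsSelfAdjoint b⁻ := (CFC.negPart_nonneg b).isSelfAdjoint
  have h2 : b⁻ * supp b⁺ = 0 := mul_supp_eq_zero (CFC.negPart_mul_posPart b)
  refine ⟨supp b⁺, supp_mem (posPart_mem hb hsa), hs, supp_mul _,
    mul_eq_zero_comm hn hs.isSelfAdjoint h2, fun h => supp_eq_zero_iff.1 h,
    fun y hy => mul_supp_eq_zero hy, ?_, h2⟩
  simpa [hp.star_eq, hs.isSelfAdjoint.star_eq] using congrArg star (supp_mul b⁺)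

/-- One step of the dyadic expansion of a positive contraction. -/
theorem exists_dyadic {a : H →L[ℂ] H} (ha : a ∈ N) (h0 : 0 ≤ a) (h1 : a ≤ 1) :
    ∃ s ∈ N, ∃ a' ∈ N, IsStarProjection s ∧ 0 ≤ a' ∧ a' ≤ 1 ∧
      a = (2⁻¹ : ℝ) • s + (2⁻¹ : ℝ) • a' := by
  set b : H →L[ℂ] H := a - (2⁻¹ : ℝ) • 1 with hb
  have hbN : b ∈ N := sub_mem ha (rsmul_mem _ (one_mem N))
  have hsa : IsSelfAdjoint b := by
    refine h0.isSelfAdjoint.sub ?_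
    rw [isSelfAdjoint_iff]; simp
  obtain ⟨s, hsN, hs, e1, e2, -, -, e3, e4⟩ := exists_spectral_projection hbN hsa
  have hbb : b = b⁺ - b⁻ := (CFC.posPart_sub_negPart b hsa).symm
  have ha' : a = b⁺ - b⁻ + (2⁻¹ : ℝ) • 1 := by rw [← hbb, hb]; simp
  have hss := hs.isIdempotentElem.eq
  have hst := hs.isSelfAdjoint.star_eq
  have p1 : 0 ≤ star (1 - s) * ((2 : ℝ) • a) * (1 - s) :=
    star_left_conjugate_nonneg (smul_nonneg (by norm_num) h0) _
  have p2 : 0 ≤ star s * ((2 : ℝ) • (1 - a)) * s :=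
    star_left_conjugate_nonneg (smul_nonneg (by norm_num) (sub_nonneg.2 h1)) _
  have q1 : (2 : ℝ) • a - s = (2 : ℝ) • b⁺ + star (1 - s) * ((2 : ℝ) • a) * (1 - s) := by
    rw [ha']
    simp only [star_sub, star_one, hst, mul_sub, sub_mul, one_mul, mul_one, mul_add, add_mul,
      mul_smul_comm, smul_mul_assoc, e1, e2, e3, e4, hss, smul_add, smul_sub, smul_smul, zero_mul]
    norm_num
    abel
  have q2 : 1 - ((2 : ℝ) • a - s) = (2 : ℝ) • b⁻ + star s * ((2 : ℝ) • (1 - a)) * s := by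
    rw [ha']
    simp only [hst, mul_sub, sub_mul, mul_one, mul_add, add_mul,
      mul_smul_comm, smul_mul_assoc, e1, e2, e3, hss, smul_add, smul_sub, smul_smul, zero_mul]
    norm_num
    module
  refine ⟨s, hsN, (2 : ℝ) • a - s, sub_mem (rsmul_mem _ ha) hsN, hs, ?_, ?_, ?_⟩
  · rw [q1]
    exact add_nonneg (smul_nonneg (by norm_num) (CFC.posPart_nonneg b)) p1
  · rw [← sub_nonneg, q2]
    exact add_nonneg (smul_nonneg (by norm_num) (CFC.negPart_nonneg b)) p2
  · module

end Basic

section Commutative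

variable {H : Type*} [NormedAddCommGroup H] [InnerProductSpace ℂ H] [CompleteSpace H]
variable {N A : VonNeumannAlgebra H}

theorem le_zero_of_dyadic (g : (H →L[ℂ] H) → ℝ) (K : ℝ)
    (hK : ∀ a ∈ N, 0 ≤ a → a ≤ 1 → g a ≤ K)
    (hg : ∀ s ∈ N, IsStarProjection s → ∀ a ∈ N, 0 ≤ a → a ≤ 1 →
      g ((2⁻¹ : ℝ) • s + (2⁻¹ : ℝ) • a) ≤ 2⁻¹ * g a)
    {a : H →L[ℂ] H} (ha : a ∈ N) (h0 : 0 ≤ a) (h1 : a ≤ 1) : g a ≤ 0 := by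
  have key : ∀ n : ℕ, ∀ a ∈ N, 0 ≤ a → a ≤ 1 → g a ≤ (2⁻¹ : ℝ) ^ n * K := by
    intro n
    induction n with
    | zero => intro a ha h0 h1; simpa using hK a ha h0 h1
    | succ n ih =>
      intro a ha h0 h1
      obtain ⟨s, hs, a', ha', hsp, h0', h1', rfl⟩ := exists_dyadic ha h0 h1
      refine (hg s hs hsp a' ha' h0' h1').trans ?_
      have := ih a' ha' h0' h1'
      rw [pow_succ]
      nlinarith
  have hlim : Tendsto (fun n : ℕ => (2⁻¹ : ℝ) ^ n * K) atTop (𝓝 (0 * K)) :=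
    (tendsto_pow_atTop_nhds_zero_of_lt_one (by norm_num) (by norm_num)).mul_const K
  rw [zero_mul] at hlim
  exact ge_of_tendsto' hlim fun n => key n a ha h0 h1

theorem norm_le_one_of_nonneg {a : H →L[ℂ] H} (h0 : 0 ≤ a) (h1 : a ≤ 1) : ‖a‖ ≤ 1 :=
  (CStarAlgebra.norm_le_one_iff_of_nonneg a h0).2 h1

/-- Elements of a von Neumann algebra are linear combinations of positive contractions. -/
theorem induction_contraction {P : (H →L[ℂ] H) → Prop}
    (hadd : ∀ x ∈ N, ∀ y ∈ N, P x → P y → P (x + y))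
    (hsmul : ∀ (c : ℂ), ∀ x ∈ N, P x → P (c • x))
    (hpos : ∀ x ∈ N, 0 ≤ x → x ≤ 1 → P x) {x : H →L[ℂ] H} (hx : x ∈ N) : P x := by
  have h1 : ∀ x ∈ N, 0 ≤ x → P x := by
    intro x hx h0
    by_cases hx0 : x = 0
    · subst hx0
      exact hpos 0 (zero_mem N) le_rfl zero_le_one
    have hn : ‖x‖ ≠ 0 := norm_ne_zero_iff.2 hx0
    have h2 : P ((((‖x‖⁻¹ : ℝ)) : ℂ) • x) := by
      refine hpos _ (smul_mem' _ hx) ?_ ?_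
      · rw [Complex.coe_smul]
        exact smul_nonneg (by positivity) h0
      · rw [← CStarAlgebra.norm_le_one_iff_of_nonneg _
          (by rw [Complex.coe_smul]; exact smul_nonneg (by positivity) h0), norm_smul]
        simp [hn]
    have h3 := hsmul (‖x‖ : ℂ) _ (smul_mem' _ hx) h2
    rwa [smul_smul, Complex.ofReal_inv, mul_inv_cancel₀ (by exact_mod_cast hn), one_smul] at h3
  have h2 : ∀ x ∈ N, IsSelfAdjoint x → P x := by
    intro x hx hsa
    rw [← CFC.posPart_sub_negPart x hsa, sub_eq_add_neg, ← neg_one_smul ℂ]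
    exact hadd _ (posPart_mem hx hsa) _ (smul_mem' _ (negPart_mem hx hsa))
      (h1 _ (posPart_mem hx hsa) (CFC.posPart_nonneg x))
      (hsmul _ _ (negPart_mem hx hsa) (h1 _ (negPart_mem hx hsa) (CFC.negPart_nonneg x)))
  have hr : ((realPart x : selfAdjoint (H →L[ℂ] H)) : H →L[ℂ] H) ∈ N := by
    rw [realPart_apply_coe]
    exact rsmul_mem _ (add_mem hx (star_mem hx))
  have hi : ((imaginaryPart x : selfAdjoint (H →L[ℂ] H)) : H →L[ℂ] H) ∈ N := by
    rw [imaginaryPart_apply_coe]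
    exact smul_mem' _ (rsmul_mem _ (sub_mem hx (star_mem hx)))
  rw [← realPart_add_I_smul_imaginaryPart x]
  exact hadd _ hr _ (smul_mem' _ hi) (h2 _ hr (realPart x).2) (hsmul _ _ hi (h2 _ hi
    (imaginaryPart x).2))

theorem commute_of_commute_projections {x : H →L[ℂ] H}
    (h : ∀ p ∈ N, IsStarProjection p → x * p = p * x) {a : H →L[ℂ] H} (ha : a ∈ N) :
    x * a = a * x := by
  refine induction_contraction (N := N) (P := fun a => x * a = a * x) ?_ ?_ ?_ ha
  · intro a _ b _ h1 h2; rw [mul_add, add_mul, h1, h2]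
  · intro c a _ h1; rw [mul_smul_comm, smul_mul_assoc, h1]
  · intro a ha h0 h1
    have := le_zero_of_dyadic (N := N) (fun a => ‖x * a - a * x‖) (2 * ‖x‖) ?_ ?_ ha h0 h1
    · exact sub_eq_zero.1 (norm_le_zero_iff.1 this)
    · intro a _ h0 h1
      have := norm_le_one_of_nonneg h0 h1
      have h2 := norm_mul_le x a
      have h3 := norm_mul_le a x
      have := norm_nonneg x
      refine (norm_sub_le _ _).trans ?_
      nlinarith
    · intro s hs hsp a _ _ _
      have : x * ((2⁻¹ : ℝ) • s + (2⁻¹ : ℝ) • a) - ((2⁻¹ : ℝ) • s + (2⁻¹ : ℝ) • a) * x =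
          (2⁻¹ : ℝ) • (x * a - a * x) := by
        simp only [mul_add, add_mul, mul_smul_comm, smul_mul_assoc, h s hs hsp, smul_sub]
        abel
      simp only [this, norm_smul]
      norm_num

/-- A character of `A`, as a function on all operators. -/
structure IsChar (A : VonNeumannAlgebra H) (χ : (H →L[ℂ] H) → ℂ) : Prop where
  add : ∀ x ∈ A, ∀ y ∈ A, χ (x + y) = χ x + χ y
  mul : ∀ x ∈ A, ∀ y ∈ A, χ (x * y) = χ x * χ y
  smul : ∀ (c : ℂ), ∀ x ∈ A, χ (c • x) = c * χ x
  star : ∀ x ∈ A, χ (star x) = starRingEnd ℂ (χ x)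
  one : χ 1 = 1

theorem eq_zero_of_forall_starAlgHom {B : Type*} [CommCStarAlgebra B] {b : B}
    (h : ∀ φ : B →⋆ₐ[ℂ] ℂ, φ b = 0) : b = 0 := by
  have h1 : gelfandStarTransform B b = 0 := by
    ext φ
    exact h ⟨WeakDual.CharacterSpace.equivAlgHom φ, fun x => map_star φ x⟩
  exact (gelfandStarTransform B).injective (h1.trans (map_zero _).symm)

theorem eq_zero_of_char (hA : ∀ x ∈ A, ∀ y ∈ A, x * y = y * x) {a : H →L[ℂ] H} (ha : a ∈ A)
    (h : ∀ χ, IsChar A χ → χ a = 0) : a = 0 := by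
  classical
  have : CompleteSpace A.toStarSubalgebra :=
    (isClosed_coe (N := A)).completeSpace_coe
  let I : CommCStarAlgebra A.toStarSubalgebra :=
    { mul_comm := fun x y => Subtype.ext (hA x.1 x.2 y.1 y.2) }
  refine congrArg Subtype.val (eq_zero_of_forall_starAlgHom (B := A.toStarSubalgebra)
    (b := ⟨a, ha⟩) fun φ => ?_)
  have := h (fun x => if hx : x ∈ A then φ ⟨x, hx⟩ else 0) ?_
  · simpa only [ha, dif_pos] using this
  · constructor
    · intro x hx y hy
      simp only [hx, hy, add_mem hx hy, dif_pos]
      exact map_add φ ⟨x, hx⟩ ⟨y, hy⟩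
    · intro x hx y hy
      simp only [hx, hy, mul_mem hx hy, dif_pos]
      exact map_mul φ ⟨x, hx⟩ ⟨y, hy⟩
    · intro c x hx
      simp only [hx, smul_mem' c hx, dif_pos]
      exact map_smul φ c ⟨x, hx⟩
    · intro x hx
      simp only [hx, star_mem hx, dif_pos]
      have h1 : (⟨star x, star_mem hx⟩ : A.toStarSubalgebra) =
        star (⟨x, hx⟩ : A.toStarSubalgebra) := rfl
      have h2 : φ (star (⟨x, hx⟩ : A.toStarSubalgebra)) = star (φ ⟨x, hx⟩) := φ.map_star' _
      exact (congrArg φ h1).trans h2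
    · simp only [one_mem A, dif_pos]
      exact map_one φ

namespace IsChar

variable {χ : (H →L[ℂ] H) → ℂ} (hχ : IsChar A χ) {a b : H →L[ℂ] H}
include hχ

theorem zero : χ 0 = 0 := by
  simpa using hχ.smul 0 0 (zero_mem A)

theorem neg (ha : a ∈ A) : χ (-a) = -χ a := by
  simpa using hχ.smul (-1) a ha

theorem sub (ha : a ∈ A) (hb : b ∈ A) : χ (a - b) = χ a - χ b := by
  rw [sub_eq_add_neg, hχ.add _ ha _ (neg_mem hb), hχ.neg hb, sub_eq_add_neg]

theorem sum {ι : Type*} (s : Finset ι) (f : ι → H →L[ℂ] H) (hf : ∀ i, f i ∈ A) :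
    χ (∑ i ∈ s, f i) = ∑ i ∈ s, χ (f i) := by
  classical
  induction s using Finset.induction_on with
  | empty => simpa using hχ.zero
  | insert i s hi ih =>
    rw [Finset.sum_insert hi, Finset.sum_insert hi, hχ.add _ (hf i) _ (sum_mem fun j _ => hf j), ih]

theorem rsmul (c : ℝ) (ha : a ∈ A) : χ (c • a) = c * χ a := by
  rw [← Complex.coe_smul, hχ.smul _ _ ha]

theorem im_eq_zero (ha : a ∈ A) (hsa : IsSelfAdjoint a) : (χ a).im = 0 := by
  have := hχ.star a ha
  rw [hsa.star_eq] at this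
  exact Complex.conj_eq_iff_im.1 this.symm

theorem ofReal_re (ha : a ∈ A) (hsa : IsSelfAdjoint a) : ((χ a).re : ℂ) = χ a :=
  Complex.ext rfl (hχ.im_eq_zero ha hsa).symm

theorem re_nonneg (ha : a ∈ A) (h0 : 0 ≤ a) : 0 ≤ (χ a).re := by
  have h1 : CFC.sqrt a ∈ A := by
    rw [CFC.sqrt_eq_real_sqrt a, cfcₙ_eq_cfc]
    exact cfc_mem ha h0.isSelfAdjoint _
  have h2 : IsSelfAdjoint (CFC.sqrt a) := (CFC.sqrt_nonneg a).isSelfAdjoint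
  have h3 := hχ.im_eq_zero h1 h2
  rw [← CFC.sqrt_mul_sqrt_self a, hχ.mul _ h1 _ h1, Complex.mul_re, h3]
  nlinarith [mul_self_nonneg (χ (CFC.sqrt a)).re]

theorem re_mul (ha : a ∈ A) (hb : b ∈ A) (hsa : IsSelfAdjoint a) :
    (χ (a * b)).re = (χ a).re * (χ b).re := by
  rw [hχ.mul _ ha _ hb, Complex.mul_re, hχ.im_eq_zero ha hsa]
  simp

theorem projection (ha : a ∈ A) (hp : IsStarProjection a) : χ a = 0 ∨ χ a = 1 := by
  have := hχ.mul a ha a ha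
  rw [hp.isIdempotentElem.eq] at this
  rcases eq_or_ne (χ a) 0 with h | h
  · exact Or.inl h
  · exact Or.inr (mul_left_cancel₀ h (by rw [mul_one]; exact this.symm))

end IsChar

theorem eq_of_char (hA : ∀ x ∈ A, ∀ y ∈ A, x * y = y * x) {a b : H →L[ℂ] H} (ha : a ∈ A)
    (hb : b ∈ A) (h : ∀ χ, IsChar A χ → χ a = χ b) : a = b := by
  refine sub_eq_zero.1 (eq_zero_of_char hA (sub_mem ha hb) fun χ hχ => ?_)
  rw [hχ.sub ha hb, h χ hχ, sub_self]

theorem nonneg_of_char (hA : ∀ x ∈ A, ∀ y ∈ A, x * y = y * x) {a : H →L[ℂ] H} (ha : a ∈ A)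
    (hsa : IsSelfAdjoint a) (h : ∀ χ, IsChar A χ → 0 ≤ (χ a).re) : 0 ≤ a := by
  rw [← CFC.negPart_eq_zero_iff a hsa]
  have hn := negPart_mem ha hsa
  have hp := posPart_mem ha hsa
  refine eq_zero_of_char hA hn fun χ hχ => ?_
  have h1 := hχ.re_nonneg hn (CFC.negPart_nonneg a)
  have h2 := hχ.re_nonneg hp (CFC.posPart_nonneg a)
  have h3 := hχ.re_mul hp hn (CFC.posPart_nonneg a).isSelfAdjoint
  rw [CFC.posPart_mul_negPart, hχ.zero, Complex.zero_re] at h3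
  have h4 := h χ hχ
  rw [← CFC.posPart_sub_negPart a hsa, hχ.sub hp hn, Complex.sub_re] at h4
  have h5 : (χ a⁻).re = 0 := by nlinarith
  rw [← hχ.ofReal_re hn (CFC.negPart_nonneg a).isSelfAdjoint, h5, Complex.ofReal_zero]

/-- Local invertibility of a nonzero positive element of an abelian von Neumann algebra. -/
theorem exists_local_inverse_sqrt (hA : ∀ x ∈ A, ∀ y ∈ A, x * y = y * x) {a : H →L[ℂ] H}
    (ha : a ∈ A) (h0 : 0 ≤ a) (hne : a ≠ 0) :
    ∃ q ∈ A, ∃ k ∈ A, IsStarProjection q ∧ IsSelfAdjoint k ∧ q ≠ 0 ∧ k * q = k ∧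
      k * a * k = q := by
  have hsa := h0.isSelfAdjoint
  set t : ℝ := ‖a‖ / 2 with ht
  have hn : 0 < ‖a‖ := norm_pos_iff.2 hne
  have htp : 0 < t := by positivity
  set b := cfc (fun x : ℝ => max (x - t) 0) a with hb
  set g := cfc (fun x : ℝ => (Real.sqrt (max x t))⁻¹) a with hg
  have hbA : b ∈ A := cfc_mem ha hsa _
  have hgA : g ∈ A := cfc_mem ha hsa _
  have hq := supp_isStarProjection b
  have hqA : supp b ∈ A := supp_mem hbA
  have hcont : ContinuousOn (fun x : ℝ => (Real.sqrt (max x t))⁻¹) (spectrum ℝ a) := by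
    refine (Continuous.inv₀ (by fun_prop) fun x => ?_).continuousOn
    exact (Real.sqrt_pos.2 (lt_max_of_lt_right htp)).ne'
  have hgsa : IsSelfAdjoint g := cfc_predicate _ a
  have hbne : b ≠ 0 := by
    intro hb0
    have h1 : a = cfc (fun x : ℝ => min x t) a := by
      have : cfc (fun x : ℝ => min x t + max (x - t) 0) a = a := by
        conv_rhs => rw [← cfc_id ℝ a hsa]
        refine cfc_congr fun x _ => ?_
        rcases le_total x t with h | h <;> simp [h]
      rw [cfc_add _ _ _ (by fun_prop) (by fun_prop), ← hb, hb0, add_zero] at this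
      exact this.symm
    have h2 : ‖cfc (fun x : ℝ => min x t) a‖ ≤ t := by
      refine norm_cfc_le htp.le fun x hx => ?_
      have := spectrum_nonneg_of_nonneg h0 hx
      rw [Real.norm_eq_abs, abs_of_nonneg (le_min this htp.le)]
      exact min_le_right _ _
    rw [← h1] at h2
    linarith
  have hga : (g * a * g - 1) * b = 0 := by
    have e0 : g * a * g * b = cfc (fun x : ℝ => (Real.sqrt (max x t))⁻¹ * x *
        (Real.sqrt (max x t))⁻¹ * max (x - t) 0) a := by
      rw [cfc_mul (fun x : ℝ => (Real.sqrt (max x t))⁻¹ * x * (Real.sqrt (max x t))⁻¹)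
        (fun x => max (x - t) 0) a ((hcont.mul (by fun_prop)).mul hcont) (by fun_prop),
        cfc_mul (fun x : ℝ => (Real.sqrt (max x t))⁻¹ * x) (fun x => (Real.sqrt (max x t))⁻¹) a
        (hcont.mul (by fun_prop)) hcont,
        cfc_mul (fun x : ℝ => (Real.sqrt (max x t))⁻¹) (fun x => x) a hcont (by fun_prop),
        cfc_id' ℝ a hsa]
    have e1 : g * a * g * b = b := by
      rw [e0, hb]
      refine cfc_congr fun x _ => ?_
      rcases le_total x t with h | h
      · simp [h]
      · have hx : 0 < x := htp.trans_le h
        have : (Real.sqrt x)⁻¹ * x * (Real.sqrt x)⁻¹ = 1 := by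
          have h2 := Real.mul_self_sqrt hx.le
          have h3 := (Real.sqrt_pos.2 hx).ne'
          field_simp
          nlinarith
        simp only [max_eq_left h, this, one_mul]
    rw [sub_mul, one_mul, e1, sub_self]
  have hgs : g * a * g * supp b = supp b := by
    have := mul_supp_eq_zero hga
    rwa [sub_mul, one_mul, sub_eq_zero] at this
  have hqq := hq.isIdempotentElem.eq
  refine ⟨supp b, hqA, supp b * g, mul_mem hqA hgA, hq, ?_, ?_, ?_, ?_⟩
  · rw [isSelfAdjoint_iff, star_mul, hgsa.star_eq, hq.isSelfAdjoint.star_eq, hA _ hgA _ hqA]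
  · exact fun h => hbne (supp_eq_zero_iff.1 h)
  · rw [mul_assoc, hA _ hgA _ hqA, ← mul_assoc, hqq]
  · have : supp b * g * a * (supp b * g) = supp b * (g * a * g * supp b) := by
      rw [hA _ hqA _ hgA, mul_assoc g, hA _ hqA _ ha]
      rw [mul_assoc g, mul_assoc a, ← mul_assoc (supp b) g, hA _ hqA _ hgA, mul_assoc g, hqq]
      rw [← mul_assoc (supp b), hA _ hqA _ (mul_mem (mul_mem hgA ha) hgA)]
      simp only [mul_assoc, hqq]
    rw [this, hgs, hqq]

end Commutative

section Trace

variable {H : Type*} [NormedAddCommGroup H] [InnerProductSpace ℂ H] [CompleteSpace H]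
variable {N A : VonNeumannAlgebra H} {n : ℕ} (η : Fin n → H)

/-- The positive functional given by finitely many vectors. -/
def tr : (H →L[ℂ] H) →ₗ[ℂ] ℂ where
  toFun x := ∑ i, ⟪η i, x (η i)⟫_ℂ
  map_add' x y := by simp [Finset.sum_add_distrib]
  map_smul' c x := by simp [Finset.mul_sum]

/-- The vector representing an operator in the GNS space of `tr η`. -/
def vec : (H →L[ℂ] H) →ₗ[ℂ] PiLp 2 (fun _ : Fin n => H) where
  toFun x := WithLp.toLp 2 fun i => x (η i)
  map_add' x y := by ext; simp
  map_smul' c x := by ext; simp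

/-- The 2-norm. -/
def nrm (x : H →L[ℂ] H) : ℝ := ‖vec η x‖

theorem tr_apply (x : H →L[ℂ] H) : tr η x = ∑ i, ⟪η i, x (η i)⟫_ℂ := rfl

theorem inner_vec (x y : H →L[ℂ] H) : ⟪vec η x, vec η y⟫_ℂ = tr η (star x * y) := by
  simp [vec, tr_apply, PiLp.inner_apply, star_eq_adjoint, adjoint_inner_right]

theorem tr_star_mul_self (x : H →L[ℂ] H) : tr η (star x * x) = ((nrm η x ^ 2 : ℝ) : ℂ) := by
  rw [← inner_vec, inner_self_eq_norm_sq_to_K]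
  simp [nrm]

theorem tr_star_mul_self_re (x : H →L[ℂ] H) : (tr η (star x * x)).re = nrm η x ^ 2 := by
  rw [tr_star_mul_self, Complex.ofReal_re]

theorem norm_tr_le (x y : H →L[ℂ] H) : ‖tr η (star x * y)‖ ≤ nrm η x * nrm η y := by
  rw [← inner_vec]
  exact norm_inner_le_norm _ _

theorem nrm_nonneg (x : H →L[ℂ] H) : 0 ≤ nrm η x := norm_nonneg _

theorem nrm_add_le (x y : H →L[ℂ] H) : nrm η (x + y) ≤ nrm η x + nrm η y := by
  simpa [nrm] using norm_add_le (vec η x) (vec η y)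

theorem nrm_sub_le (x y : H →L[ℂ] H) : nrm η (x - y) ≤ nrm η x + nrm η y := by
  simpa [nrm] using norm_sub_le (vec η x) (vec η y)

theorem nrm_smul (c : ℂ) (x : H →L[ℂ] H) : nrm η (c • x) = ‖c‖ * nrm η x := by
  simpa [nrm] using norm_smul c (vec η x)

theorem nrm_zero : nrm η 0 = 0 := by simp [nrm]

theorem tr_nonneg {x : H →L[ℂ] H} (hx : 0 ≤ x) : 0 ≤ (tr η x).re := by
  rw [tr_apply, Complex.re_sum]
  refine Finset.sum_nonneg fun i _ => ?_
  exact (Complex.le_def.1 (((nonneg_iff_isPositive _).1 hx).inner_nonneg_right (η i))).1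

theorem tr_mono {x y : H →L[ℂ] H} (hxy : x ≤ y) : (tr η x).re ≤ (tr η y).re := by
  have := tr_nonneg η (sub_nonneg.2 hxy)
  rw [map_sub, Complex.sub_re] at this
  linarith

theorem nrm_mul_le (a x : H →L[ℂ] H) : nrm η (a * x) ≤ ‖a‖ * nrm η x := by
  have h1 : star (a * x) * (a * x) ≤ (‖a‖ ^ 2 : ℝ) • (star x * x) := by
    have h2 : star a * a ≤ (‖a‖ ^ 2 : ℝ) • 1 := by
      have := CStarAlgebra.star_mul_le_algebraMap_norm_sq (a := a)
      rwa [Algebra.algebraMap_eq_smul_one] at this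
    have := star_left_conjugate_le_conjugate h2 x
    simpa [mul_assoc] using this
  have h3 := tr_mono η h1
  rw [tr_star_mul_self_re, ← Complex.coe_smul, map_smul, smul_eq_mul, Complex.re_ofReal_mul,
    tr_star_mul_self_re, ← mul_pow] at h3
  exact le_of_sq_le_sq h3 (mul_nonneg (norm_nonneg _) (nrm_nonneg _ _))

theorem WLim.tendsto_tr {ι : Type*} {l : Filter ι} {f : ι → H →L[ℂ] H} {S : H →L[ℂ] H}
    (h : WLim l f S) : Tendsto (fun i => tr η (f i)) l (𝓝 (tr η S)) := by
  simp only [tr_apply]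
  exact tendsto_finsetSum _ fun i _ => h _ _

/-- `tr η` is a faithful tracial state on `N`. -/
structure IsTrace (N : VonNeumannAlgebra H) (η : Fin n → H) : Prop where
  tracial : ∀ x ∈ N, ∀ y ∈ N, tr η (x * y) = tr η (y * x)
  faithful : ∀ x ∈ N, nrm η x = 0 → x = 0
  one : tr η 1 = 1

namespace IsTrace

variable {η} (hT : IsTrace N η) {x y a : H →L[ℂ] H}
include hT

theorem nrm_star (hx : x ∈ N) : nrm η (star x) = nrm η x := by
  have h1 := tr_star_mul_self_re η x
  have h2 := tr_star_mul_self_re η (star x)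
  rw [star_star, hT.tracial _ hx _ (star_mem hx), h1] at h2
  exact ((sq_eq_sq₀ (nrm_nonneg _ _) (nrm_nonneg _ _)).1 h2).symm

theorem eq_zero_of_tr (hx : x ∈ N) (h0 : 0 ≤ x) (h : (tr η x).re ≤ 0) : x = 0 := by
  have h1 : CFC.sqrt x ∈ N := by
    rw [CFC.sqrt_eq_real_sqrt x, cfcₙ_eq_cfc]
    exact cfc_mem hx h0.isSelfAdjoint _
  have h2 : IsSelfAdjoint (CFC.sqrt x) := (CFC.sqrt_nonneg x).isSelfAdjoint
  have h3 := tr_star_mul_self_re η (CFC.sqrt x)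
  rw [h2.star_eq, CFC.sqrt_mul_sqrt_self x] at h3
  have h4 : nrm η (CFC.sqrt x) = 0 := by
    have := nrm_nonneg η (CFC.sqrt x)
    nlinarith
  rw [← CFC.sqrt_mul_sqrt_self x, hT.faithful _ h1 h4, zero_mul]

theorem mono (hAN : A ≤ N) : IsTrace A η :=
  ⟨fun x hx y hy => hT.tracial x (hAN hx) y (hAN hy), fun x hx => hT.faithful x (hAN hx), hT.one⟩

theorem nrm_one : nrm η 1 = 1 := by
  have h := tr_star_mul_self_re η 1
  rw [star_one, mul_one, hT.one, Complex.one_re] at h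
  have := nrm_nonneg η 1
  nlinarith

theorem nrm_le (x : H →L[ℂ] H) : nrm η x ≤ ‖x‖ := by
  simpa [hT.nrm_one] using nrm_mul_le η x 1

end IsTrace

end Trace

section Partitions

variable {H : Type*} [NormedAddCommGroup H] [InnerProductSpace ℂ H] [CompleteSpace H]
variable {N A : VonNeumannAlgebra H} {ι : Type*} [Fintype ι]

/-- A family of pairwise orthogonal projections. -/
structure OrthProj (p : ι → H →L[ℂ] H) : Prop where
  proj : ∀ i, IsStarProjection (p i)
  orth : ∀ i j, i ≠ j → p i * p j = 0

namespace OrthProj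

variable {p q : ι → H →L[ℂ] H}

theorem mul_sum (hp : OrthProj p) (i : ι) : p i * ∑ j, p j = p i := by
  classical
  rw [Finset.mul_sum, Finset.sum_eq_single i, (hp.proj i).isIdempotentElem.eq]
  · exact fun j _ hj => hp.orth _ _ hj.symm
  · simp

theorem sum (hp : OrthProj p) : IsStarProjection (∑ i, p i) := by
  refine ⟨?_, ?_⟩
  · rw [IsIdempotentElem, Finset.sum_mul]
    exact Finset.sum_congr rfl fun i _ => hp.mul_sum i
  · rw [isSelfAdjoint_iff, star_sum]
    exact Finset.sum_congr rfl fun i _ => (hp.proj i).isSelfAdjoint.star_eq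

theorem norm_sq_sum (hp : OrthProj p) (v : ι → H) :
    ‖∑ i, p i (v i)‖ ^ 2 = ∑ i, ‖p i (v i)‖ ^ 2 := by
  classical
  have h : ∀ i j, i ≠ j → ⟪p i (v i), p j (v j)⟫_ℂ = 0 := by
    intro i j hij
    rw [← adjoint_inner_right, ← star_eq_adjoint, (hp.proj i).isSelfAdjoint.star_eq]
    have := congrArg (fun T : H →L[ℂ] H => T (v j)) (hp.orth i j hij)
    change p i (p j (v j)) = 0 at this
    rw [this, inner_zero_right]
  have h2 : ((‖∑ i, p i (v i)‖ ^ 2 : ℝ) : ℂ) = ((∑ i, ‖p i (v i)‖ ^ 2 : ℝ) : ℂ) := by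
    push_cast
    have := inner_self_eq_norm_sq_to_K (𝕜 := ℂ) (∑ i, p i (v i))
    simp only [Complex.coe_algebraMap] at this
    rw [← this, sum_inner]
    refine Finset.sum_congr rfl fun i _ => ?_
    rw [inner_sum, Finset.sum_eq_single i]
    · exact inner_self_eq_norm_sq_to_K (𝕜 := ℂ) _
    · exact fun j _ hj => h _ _ hj.symm
    · simp
  exact_mod_cast h2

theorem norm_sum_le (hp : OrthProj p) (hq : OrthProj q) (x : H →L[ℂ] H) :
    ‖∑ i, p i * x * q i‖ ≤ ‖x‖ := by
  refine opNorm_le_bound _ (norm_nonneg _) fun ζ => ?_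
  refine le_of_sq_le_sq ?_ (by positivity)
  have h1 : (∑ i, p i * x * q i) ζ = ∑ i, p i (x (q i ζ)) := by simp
  have h2 : ‖(∑ i, q i) ζ‖ ^ 2 = ∑ i, ‖q i ζ‖ ^ 2 := by
    rw [← hq.norm_sq_sum fun _ => ζ]; simp
  have h3 : ‖(∑ i, q i) ζ‖ ≤ ‖ζ‖ := by
    simpa using (∑ i, q i).le_of_opNorm_le hq.sum.norm_le ζ
  rw [h1, hp.norm_sq_sum, mul_pow]
  calc ∑ i, ‖p i (x (q i ζ))‖ ^ 2 ≤ ∑ i, ‖x‖ ^ 2 * ‖q i ζ‖ ^ 2 := by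
        refine Finset.sum_le_sum fun i _ => ?_
        rw [← mul_pow]
        refine pow_le_pow_left₀ (norm_nonneg _) ?_ 2
        have := (p i).le_of_opNorm_le (hp.proj i).norm_le (x (q i ζ))
        rw [one_mul] at this
        exact this.trans (x.le_opNorm _)
    _ = ‖x‖ ^ 2 * ‖(∑ i, q i) ζ‖ ^ 2 := by rw [h2, Finset.mul_sum]
    _ ≤ _ := by gcongr

end OrthProj

/-- A finite partition of unity by projections of `A`. -/
structure Part (A : VonNeumannAlgebra H) where
  ι : Type
  fin : Fintype ι
  p : ι → H →L[ℂ] H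
  mem : ∀ i, p i ∈ A
  orth : OrthProj p
  sum : ∑ i, p i = 1

attribute [instance] Part.fin

namespace Part

instance : Preorder (Part A) where
  le F G := ∃ f : G.ι → F.ι, ∀ j, F.p (f j) * G.p j = G.p j
  le_refl F := ⟨id, fun j => (F.orth.proj j).isIdempotentElem.eq⟩
  le_trans F G K := by
    rintro ⟨f, hf⟩ ⟨g, hg⟩
    exact ⟨f ∘ g, fun j => by rw [← hg j, ← mul_assoc, Function.comp, hf]⟩

/-- The partition `{p, 1 - p}`. -/
def two (p : H →L[ℂ] H) (hp : p ∈ A) (h : IsStarProjection p) : Part A where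
  ι := Bool
  fin := inferInstance
  p b := if b then p else 1 - p
  mem b := by cases b <;> simp [hp, sub_mem (one_mem A) hp]
  orth := by
    constructor
    · intro b; cases b <;> simp [h, h.one_sub]
    · intro b c hbc
      cases b <;> cases c <;> simp_all [mul_sub, sub_mul, h.isIdempotentElem.eq]
  sum := by simp

/-- The common refinement. -/
def inf (hA : ∀ x ∈ A, ∀ y ∈ A, x * y = y * x) (F G : Part A) : Part A where
  ι := F.ι × G.ι
  fin := inferInstance
  p b := F.p b.1 * G.p b.2
  mem b := mul_mem (F.mem _) (G.mem _)
  orth := by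
    constructor
    · exact fun b => (F.orth.proj _).mul (G.orth.proj _) (hA _ (F.mem _) _ (G.mem _))
    · rintro ⟨i, j⟩ ⟨k, l⟩ h
      have e : F.p i * G.p j * (F.p k * G.p l) = F.p i * F.p k * (G.p j * G.p l) := by
        rw [mul_assoc, ← mul_assoc (G.p j), hA _ (G.mem j) _ (F.mem k)]
        simp only [mul_assoc]
      simp only [e]
      by_cases hik : i = k
      · rw [G.orth.orth j l (fun hjl => h (by rw [hik, hjl])), mul_zero]
      · rw [F.orth.orth i k hik, zero_mul]
  sum := by
    rw [Fintype.sum_prod_type]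
    simp only [← Finset.mul_sum, G.sum, mul_one, F.sum]

theorem le_inf_left (hA : ∀ x ∈ A, ∀ y ∈ A, x * y = y * x) (F G : Part A) : F ≤ F.inf hA G :=
  ⟨Prod.fst, fun j => by
    change F.p _ * (F.p _ * G.p _) = F.p _ * G.p _
    rw [← mul_assoc, (F.orth.proj _).isIdempotentElem.eq]⟩

theorem le_inf_right (hA : ∀ x ∈ A, ∀ y ∈ A, x * y = y * x) (F G : Part A) : G ≤ F.inf hA G :=
  ⟨Prod.snd, fun j => by
    change G.p _ * (F.p _ * G.p _) = F.p _ * G.p _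
    rw [hA _ (F.mem _) _ (G.mem _), ← mul_assoc, (G.orth.proj _).isIdempotentElem.eq]⟩

theorem exists_ultrafilter (hA : ∀ x ∈ A, ∀ y ∈ A, x * y = y * x) :
    ∃ 𝒰 : Ultrafilter (Part A), ∀ F, ∀ᶠ G in (𝒰 : Filter (Part A)), F ≤ G := by
  have : Nonempty (Part A) := ⟨two 1 (one_mem A) (IsStarProjection.one _)⟩
  have : IsDirectedOrder (Part A) := ⟨fun F G => ⟨F.inf hA G, le_inf_left hA F G,
    le_inf_right hA F G⟩⟩
  exact ⟨Ultrafilter.of atTop, fun F => (Ultrafilter.of_le atTop) (eventually_ge_atTop F)⟩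

theorem eq_or_of_two_le {p : H →L[ℂ] H} {hp : p ∈ A} {h : IsStarProjection p} {G : Part A}
    (hG : two p hp h ≤ G) (j : G.ι) : p * G.p j = G.p j ∨ p * G.p j = 0 := by
  obtain ⟨f, hf⟩ := hG
  have h1 := hf j
  cases hfj : f j with
  | true =>
    rw [hfj] at h1
    exact Or.inl (by simpa [two] using h1)
  | false =>
    rw [hfj] at h1
    right
    rw [← h1]
    simp [two, ← mul_assoc, mul_sub, h.isIdempotentElem.eq]

/-- The pinching by a partition. -/
def pinch (F : Part A) : (H →L[ℂ] H) →ₗ[ℂ] (H →L[ℂ] H) where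
  toFun x := ∑ i, F.p i * x * F.p i
  map_add' x y := by simp [mul_add, add_mul, Finset.sum_add_distrib]
  map_smul' c x := by simp [Finset.smul_sum]

theorem pinch_apply (F : Part A) (x : H →L[ℂ] H) : F.pinch x = ∑ i, F.p i * x * F.p i := rfl

end Part

/-- A norm-one projection of all operators onto the commutant of `A`,
obtained as a limit of pinchings. -/
structure IsPinching (A : VonNeumannAlgebra H)
    (E : (H →L[ℂ] H) →ₗ[ℂ] (H →L[ℂ] H)) : Prop where
  mem_commutant : ∀ x, E x ∈ A.commutant
  left : ∀ b ∈ A.commutant, ∀ x, E (b * x) = b * E x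
  right : ∀ b ∈ A.commutant, ∀ x, E (x * b) = E x * b
  one : E 1 = 1
  star : ∀ x, E (star x) = star (E x)
  nonneg : ∀ x, 0 ≤ x → 0 ≤ E x
  norm_le : ∀ x, ‖E x‖ ≤ ‖x‖
  mem : ∀ N : VonNeumannAlgebra H, A ≤ N → ∀ x ∈ N, E x ∈ N
  tr : ∀ (N : VonNeumannAlgebra H) (n : ℕ) (η : Fin n → H), A ≤ N → IsTrace N η →
    ∀ x ∈ N, tr η (E x) = tr η x

theorem exists_isPinching (hA : ∀ x ∈ A, ∀ y ∈ A, x * y = y * x) :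
    ∃ E : (H →L[ℂ] H) →ₗ[ℂ] (H →L[ℂ] H), IsPinching A E := by
  obtain ⟨𝒰, h𝒰⟩ := Part.exists_ultrafilter hA
  have hnorm : ∀ x (F : Part A), ‖F.pinch x‖ ≤ ‖x‖ := fun x F => F.orth.norm_sum_le F.orth x
  have hex : ∀ x, ∃ T, WLim (𝒰 : Filter (Part A)) (fun F => F.pinch x) T := fun x =>
    WLim.exists_of_bounded (C := ‖x‖) (hnorm x)
  choose E hE using hex
  have hst : ∀ (F : Part A) i, star (F.p i) = F.p i := fun F i =>
    (F.orth.proj i).isSelfAdjoint.star_eq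
  refine ⟨⟨⟨E, ?_⟩, ?_⟩, ⟨?_, ?_, ?_, ?_, ?_, ?_, ?_, ?_, ?_⟩⟩
  · intro x y
    exact (hE _).unique (by simpa using (hE x).add (hE y))
  · intro c x
    exact (hE _).unique (by simpa using (hE x).smul c)
  · intro x
    change E x ∈ _
    have : ∀ p ∈ A, IsStarProjection p → E x * p = p * E x := by
      intro p hp h
      refine ((hE x).mul_right p).unique (((hE x).mul_left p).congr' ?_)
      filter_upwards [h𝒰 (Part.two p hp h)] with G hG
      rw [Part.pinch_apply, Finset.mul_sum, Finset.sum_mul]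
      refine Finset.sum_congr rfl fun i _ => ?_
      have h1 := Part.eq_or_of_two_le hG i
      rw [mul_assoc _ _ p, hA _ (G.mem i) _ hp, ← mul_assoc, ← mul_assoc]
      rcases h1 with h1 | h1 <;> simp [h1, mul_assoc]
    exact VonNeumannAlgebra.mem_commutant_iff.2 fun a ha =>
      (commute_of_commute_projections this ha).symm
  · intro b hb x
    refine (hE _).unique (((hE x).mul_left b).congr' (Eventually.of_forall fun F => ?_))
    simp only [Part.pinch_apply, Finset.mul_sum]
    refine Finset.sum_congr rfl fun i _ => ?_
    rw [← mul_assoc, ← mul_assoc, ← commute_of_mem (F.mem i) hb, mul_assoc (F.p i)]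
  · intro b hb x
    refine (hE _).unique (((hE x).mul_right b).congr' (Eventually.of_forall fun F => ?_))
    simp only [Part.pinch_apply, Finset.sum_mul]
    refine Finset.sum_congr rfl fun i _ => ?_
    rw [mul_assoc, commute_of_mem (F.mem i) hb, ← mul_assoc, ← mul_assoc]
  · refine (hE _).unique ((WLim.const 1).congr' (Eventually.of_forall fun F => ?_))
    simp only [Part.pinch_apply, mul_one, (F.orth.proj _).isIdempotentElem.eq, F.sum]
  · intro x
    refine (hE _).unique ((hE x).star.congr' (Eventually.of_forall fun F => ?_))
    simp only [Part.pinch_apply, star_sum, star_mul, hst, mul_assoc]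
  · intro x hx
    refine (hE x).nonneg (Eventually.of_forall fun F => Finset.sum_nonneg fun i _ => ?_)
    have := star_left_conjugate_nonneg hx (F.p i)
    rwa [hst] at this
  · exact fun x => (hE x).norm_le (norm_nonneg _) (Eventually.of_forall (hnorm x))
  · intro N hAN x hx
    exact (hE x).mem (Eventually.of_forall fun F => sum_mem fun i _ =>
      mul_mem (mul_mem (hAN (F.mem i)) hx) (hAN (F.mem i)))
  · intro N n η hAN hT x hx
    refine tendsto_nhds_unique ((hE x).tendsto_tr η) (tendsto_const_nhds.congr fun F => ?_)
    rw [Part.pinch_apply, map_sum]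
    have : ∀ i, tr η (F.p i * x * F.p i) = tr η (F.p i * x) := by
      intro i
      rw [hT.tracial _ (mul_mem (hAN (F.mem i)) hx) _ (hAN (F.mem i)), ← mul_assoc,
        (F.orth.proj i).isIdempotentElem.eq]
    simp only [this]
    rw [← map_sum, ← Finset.sum_mul, F.sum, one_mul]

end Partitions

section Masa

variable {H : Type*} [NormedAddCommGroup H] [InnerProductSpace ℂ H] [CompleteSpace H]
variable {N A : VonNeumannAlgebra H} {n : ℕ} {η : Fin n → H}
variable {E : (H →L[ℂ] H) →ₗ[ℂ] (H →L[ℂ] H)} {x y a b p q : H →L[ℂ] H}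

/-- `A` is a maximal abelian subalgebra of `N`. -/
structure IsMasaIn (N A : VonNeumannAlgebra H) : Prop where
  le : A ≤ N
  comm : ∀ x ∈ A, ∀ y ∈ A, x * y = y * x
  max : ∀ x ∈ N, (∀ a ∈ A, x * a = a * x) → x ∈ A

theorem mem_commutant_of_comm (hA : ∀ x ∈ A, ∀ y ∈ A, x * y = y * x) (ha : a ∈ A) :
    a ∈ A.commutant :=
  VonNeumannAlgebra.mem_commutant_iff.2 fun g hg => hA g hg a ha

namespace IsMasaIn

variable (hM : IsMasaIn N A) (hE : IsPinching A E)
include hM hE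

theorem E_mem (hx : x ∈ N) : E x ∈ A :=
  hM.max _ (hE.mem N hM.le x hx) fun a ha =>
    ((VonNeumannAlgebra.mem_commutant_iff.1 (hE.mem_commutant x)) a ha).symm

theorem E_left (ha : a ∈ A) (x : H →L[ℂ] H) : E (a * x) = a * E x :=
  hE.left a (mem_commutant_of_comm hM.comm ha) x

theorem E_right (ha : a ∈ A) (x : H →L[ℂ] H) : E (x * a) = E x * a :=
  hE.right a (mem_commutant_of_comm hM.comm ha) x

theorem E_self (ha : a ∈ A) : E a = a := by
  simpa [hE.one] using E_left hM hE ha 1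

theorem nrm_E_le (hT : IsTrace N η) (hx : x ∈ N) : nrm η (E x) ≤ nrm η x := by
  have h1 : tr η (star (E x) * E x) = tr η (star (E x) * x) := by
    rw [← E_left hM hE (star_mem (E_mem hM hE hx)),
      hE.tr N n η hM.le hT _ (mul_mem (star_mem (hE.mem N hM.le x hx)) hx)]
  have h2 := norm_tr_le η (E x) x
  rw [← h1, tr_star_mul_self, Complex.norm_real, Real.norm_of_nonneg (by positivity)] at h2
  have h3 := nrm_nonneg η (E x)
  have h4 := nrm_nonneg η x
  by_contra h
  push Not at h
  nlinarith

theorem eq_zero_of_tr_mul (hT : IsTrace N η) (hx : x ∈ N) (h : ∀ a ∈ A, tr η (a * x) = 0) :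
    E x = 0 := by
  have h1 := E_mem hM hE hx
  refine hT.faithful _ (hM.le h1) ?_
  have h2 := tr_star_mul_self_re η (E x)
  rw [← E_left hM hE (star_mem h1), hE.tr N n η hM.le hT _ (mul_mem (star_mem (hM.le h1)) hx),
    h _ (star_mem h1), Complex.zero_re] at h2
  exact pow_eq_zero_iff two_ne_zero |>.1 h2.symm

end IsMasaIn

/-- The operator valued measure `p ↦ E (x* p x)`. -/
def mu (E : (H →L[ℂ] H) →ₗ[ℂ] (H →L[ℂ] H)) (x : H →L[ℂ] H) :
    (H →L[ℂ] H) →ₗ[ℂ] (H →L[ℂ] H) where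
  toFun p := E (star x * p * x)
  map_add' p q := by simp [mul_add, add_mul]
  map_smul' c p := by simp

theorem mu_apply (p : H →L[ℂ] H) : mu E x p = E (star x * p * x) := rfl

theorem proj_mul (hA : ∀ x ∈ A, ∀ y ∈ A, x * y = y * x) (hp : p ∈ A) (hq : q ∈ A)
    (h : IsStarProjection p) (h' : IsStarProjection q) : IsStarProjection (p * q) :=
  h.mul h' (hA _ hp _ hq)

section

variable (hM : IsMasaIn N A) (hE : IsPinching A E)
include hM hE

theorem mu_mem (hx : x ∈ N) (hp : p ∈ A) : mu E x p ∈ A := by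
  rw [mu_apply]
  exact hM.E_mem hE (mul_mem (mul_mem (star_mem hx) (hM.le hp)) hx)

omit hM in
theorem mu_nonneg (hp : IsStarProjection p) : 0 ≤ mu E x p :=
  hE.nonneg _ (star_left_conjugate_nonneg (IsStarProjection.nonneg' hp) x)

theorem char_mu_nonneg (hx : x ∈ N) {χ : (H →L[ℂ] H) → ℂ} (hχ : IsChar A χ) (hp : p ∈ A)
    (h : IsStarProjection p) : 0 ≤ (χ (mu E x p)).re :=
  hχ.re_nonneg (mu_mem hM hE hx hp) (mu_nonneg hE h)

theorem char_mu_add (hx : x ∈ N) {χ : (H →L[ℂ] H) → ℂ} (hχ : IsChar A χ) (hp : p ∈ A)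
    (hq : q ∈ A) : (χ (mu E x (p + q))).re = (χ (mu E x p)).re + (χ (mu E x q)).re := by
  rw [map_add, hχ.add _ (mu_mem hM hE hx hp) _ (mu_mem hM hE hx hq), Complex.add_re]

omit hM in
theorem mu_one_le (hx1 : ‖x‖ ≤ 1) : mu E x 1 ≤ 1 := by
  have h : ‖mu E x 1‖ ≤ 1 := by
    rw [mu_apply, mul_one]
    refine (hE.norm_le _).trans ((norm_mul_le _ _).trans ?_)
    rw [norm_star]
    nlinarith [norm_nonneg x]
  exact (CStarAlgebra.norm_le_one_iff_of_nonneg _ (mu_nonneg hE (IsStarProjection.one _))).1 h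

end

/-- `∑ₖ μ(pₖ)²`. -/
def sqSum (E : (H →L[ℂ] H) →ₗ[ℂ] (H →L[ℂ] H)) (x : H →L[ℂ] H) (F : Part A) : H →L[ℂ] H :=
  ∑ k, mu E x (F.p k) * mu E x (F.p k)

theorem tr_sqSum (hE : IsPinching A E) (F : Part A) :
    (tr η (sqSum E x F)).re = ∑ k, nrm η (mu E x (F.p k)) ^ 2 := by
  rw [sqSum, map_sum, Complex.re_sum]
  refine Finset.sum_congr rfl fun k _ => ?_
  rw [← tr_star_mul_self_re, (mu_nonneg hE (F.orth.proj k)).isSelfAdjoint.star_eq]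

section

variable (hM : IsMasaIn N A) (hE : IsPinching A E)
include hM hE

theorem sqSum_mem (hx : x ∈ N) (F : Part A) : sqSum E x F ∈ A :=
  sum_mem fun k _ => mul_mem (mu_mem hM hE hx (F.mem k)) (mu_mem hM hE hx (F.mem k))

omit hM in
theorem sqSum_isSelfAdjoint (F : Part A) : IsSelfAdjoint (sqSum E x F) := by
  rw [isSelfAdjoint_iff, sqSum, star_sum]
  refine Finset.sum_congr rfl fun k _ => ?_
  rw [star_mul, (mu_nonneg hE (F.orth.proj k)).isSelfAdjoint.star_eq]

theorem char_sqSum (hx : x ∈ N) {χ : (H →L[ℂ] H) → ℂ} (hχ : IsChar A χ) (F : Part A) :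
    (χ (sqSum E x F)).re = ∑ k, (χ (mu E x (F.p k))).re ^ 2 := by
  have hm := fun k => mu_mem hM hE hx (F.mem k)
  rw [sqSum, hχ.sum _ _ fun k => mul_mem (hm k) (hm k), Complex.re_sum]
  refine Finset.sum_congr rfl fun k _ => ?_
  rw [hχ.re_mul (hm k) (hm k) (mu_nonneg hE (F.orth.proj k)).isSelfAdjoint, sq]

theorem char_sum_mu (hx : x ∈ N) {χ : (H →L[ℂ] H) → ℂ} (hχ : IsChar A χ) {ι : Type*}
    (s : Finset ι) (p : ι → H →L[ℂ] H) (hp : ∀ i, p i ∈ A) :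
    (χ (mu E x (∑ i ∈ s, p i))).re = ∑ i ∈ s, (χ (mu E x (p i))).re := by
  rw [map_sum, hχ.sum _ _ fun k => mu_mem hM hE hx (hp k), Complex.re_sum]

theorem char_sqSum_anti (hx : x ∈ N) {χ : (H →L[ℂ] H) → ℂ} (hχ : IsChar A χ) {F G : Part A}
    (hFG : F ≤ G) : (χ (sqSum E x G)).re ≤ (χ (sqSum E x F)).re := by
  classical
  obtain ⟨f, hf⟩ := hFG
  rw [char_sqSum hM hE hx hχ, char_sqSum hM hE hx hχ]
  have h1 : ∀ i, F.p i = ∑ j with f j = i, G.p j := by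
    intro i
    have : F.p i = ∑ j, F.p i * G.p j := by rw [← Finset.mul_sum, G.sum, mul_one]
    rw [this, Finset.sum_filter]
    refine Finset.sum_congr rfl fun j _ => ?_
    split_ifs with h
    · rw [← h, hf]
    · rw [← hf j, ← mul_assoc, F.orth.orth _ _ (Ne.symm h), zero_mul]
  have h2 : ∀ i, (χ (mu E x (F.p i))).re = ∑ j with f j = i, (χ (mu E x (G.p j))).re := by
    intro i
    rw [h1 i, char_sum_mu hM hE hx hχ _ _ G.mem]
  rw [← Finset.sum_fiberwise Finset.univ f]
  refine Finset.sum_le_sum fun i _ => ?_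
  rw [h2]
  exact Finset.sum_sq_le_sq_sum_of_nonneg fun j _ =>
    char_mu_nonneg hM hE hx hχ (G.mem j) (G.orth.proj j)

theorem sqSum_anti (hx : x ∈ N) {F G : Part A} (hFG : F ≤ G) : sqSum E x G ≤ sqSum E x F := by
  rw [← sub_nonneg]
  refine nonneg_of_char hM.comm (sub_mem (sqSum_mem hM hE hx F) (sqSum_mem hM hE hx G))
    ((sqSum_isSelfAdjoint hE F).sub (sqSum_isSelfAdjoint hE G)) fun χ hχ => ?_
  rw [hχ.sub (sqSum_mem hM hE hx F) (sqSum_mem hM hE hx G), Complex.sub_re]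
  exact sub_nonneg.2 (char_sqSum_anti hM hE hx hχ hFG)

/-- Localizing to a piece of `A` on which the measure `μ` is almost concentrated at a point. -/
theorem exists_concentration (hT : IsTrace N η) (hx : x ∈ N) (hx1 : ‖x‖ ≤ 1) {c : ℝ} (hc : 0 < c)
    (h : ∀ F : Part A, c ≤ ∑ k, nrm η (mu E x (F.p k)) ^ 2) :
    ∃ p₀ ∈ A, ∃ z ∈ A, ∃ γ : ℝ, IsStarProjection p₀ ∧ IsStarProjection z ∧ z ≠ 0 ∧ 0 < γ ∧
      ∀ χ, IsChar A χ → χ z = 1 → γ ≤ (χ (mu E x p₀)).re ∧ ∀ p ∈ A, IsStarProjection p →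
        2 * (χ (mu E x (p₀ * p))).re * (χ (mu E x (p₀ * (1 - p)))).re ≤
          γ / 4 * (χ (mu E x p₀)).re := by
  classical
  obtain ⟨𝒰, h𝒰⟩ := Part.exists_ultrafilter hM.comm
  have hmono : ∀ F : Part A, 0 ≤ sqSum E x F := fun F => Finset.sum_nonneg fun k _ => by
    have := star_mul_self_nonneg (mu E x (F.p k))
    rwa [(mu_nonneg hE (F.orth.proj k)).isSelfAdjoint.star_eq] at this
  obtain ⟨a, ha⟩ : ∃ a, WLim (𝒰 : Filter (Part A)) (fun F => sqSum E x F) a := by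
    let F₀ : Part A := Part.two 1 (one_mem A) (IsStarProjection.one _)
    obtain ⟨T, hT'⟩ := WLim.exists_of_bounded (𝒰 := 𝒰) (C := ‖sqSum E x F₀‖)
      (f := fun F => if F₀ ≤ F then sqSum E x F else 0) (fun F => by
        split_ifs with hF
        · exact CStarAlgebra.norm_le_norm_of_nonneg_of_le (hmono F) (sqSum_anti hM hE hx hF)
        · simp)
    refine ⟨T, hT'.congr' ?_⟩
    filter_upwards [h𝒰 F₀] with F hF
    rw [if_pos hF]
  have haA : a ∈ A := ha.mem (Eventually.of_forall fun F => sqSum_mem hM hE hx F)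
  have hasa : IsSelfAdjoint a := (ha.nonneg (Eventually.of_forall hmono)).isSelfAdjoint
  have hle : ∀ F : Part A, a ≤ sqSum E x F := by
    intro F
    rw [← sub_nonneg]
    refine ((WLim.const (l := (𝒰 : Filter (Part A))) (sqSum E x F)).sub ha).nonneg ?_
    filter_upwards [h𝒰 F] with G hG
    exact sub_nonneg.2 (sqSum_anti hM hE hx hG)
  have htr : Tendsto (fun F : Part A => (tr η (sqSum E x F)).re) (𝒰 : Filter (Part A)) (𝓝 (tr η a).re) :=
    (Complex.continuous_re.tendsto _).comp (ha.tendsto_tr η)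
  set γ := c / 4 with hγ
  have hγ0 : 0 < γ := by positivity
  set C := 4 / γ with hC
  have hC0 : 0 < C := by positivity
  obtain ⟨F, hF⟩ := ((htr.eventually_lt_const (u := (tr η a).re + c / (4 * C))
    (by linarith [div_pos hc (mul_pos four_pos hC0)]))).exists
  set d := sqSum E x F - a with hd
  have hdA : d ∈ A := sub_mem (sqSum_mem hM hE hx F) haA
  have hd0 : 0 ≤ d := sub_nonneg.2 (hle F)
  have hdt : (tr η d).re < c / (4 * C) := by rw [hd, map_sub, Complex.sub_re]; linarith
  have hm := fun k => mu_mem hM hE hx (F.mem k)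
  have hm0 := fun k => mu_nonneg (x := x) hE (F.orth.proj k)
  let b : F.ι → H →L[ℂ] H := fun k => mu E x (F.p k) - γ • 1 - C • d
  have hbA : ∀ k, b k ∈ A := fun k => sub_mem (sub_mem (hm k) (rsmul_mem _ (one_mem A)))
    (rsmul_mem _ hdA)
  have hbsa : ∀ k, IsSelfAdjoint (b k) := fun k =>
    ((hm0 k).isSelfAdjoint.sub (by rw [isSelfAdjoint_iff]; simp)).sub (by
      rw [isSelfAdjoint_iff]; simp [hd0.isSelfAdjoint.star_eq])
  have hbχ : ∀ χ, IsChar A χ → ∀ k, (χ (b k)).re = (χ (mu E x (F.p k))).re - γ - C * (χ d).re := by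
    intro χ hχ k
    rw [hχ.sub (sub_mem (hm k) (rsmul_mem _ (one_mem A))) (rsmul_mem _ hdA),
      hχ.sub (hm k) (rsmul_mem _ (one_mem A)), hχ.rsmul _ (one_mem A), hχ.rsmul _ hdA, hχ.one]
    simp
  obtain ⟨k, hk⟩ : ∃ k, (b k)⁺ ≠ 0 := by
    by_contra hcon
    push Not at hcon
    have h1 : ∀ χ, IsChar A χ → ∀ k, (χ (b k)).re ≤ 0 := by
      intro χ hχ k
      have := hχ.re_nonneg (negPart_mem (hbA k) (hbsa k)) (CFC.negPart_nonneg (b k))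
      rw [← CFC.posPart_sub_negPart (b k) (hbsa k), hcon k, zero_sub,
        hχ.neg (negPart_mem (hbA k) (hbsa k)), Complex.neg_re]
      linarith
    have h2 : sqSum E x F ≤ γ • 1 + C • d := by
      rw [← sub_nonneg]
      refine nonneg_of_char hM.comm ?_ ?_ fun χ hχ => ?_
      · exact sub_mem (add_mem (rsmul_mem _ (one_mem A)) (rsmul_mem _ hdA)) (sqSum_mem hM hE hx F)
      · exact IsSelfAdjoint.sub (IsSelfAdjoint.add (by rw [isSelfAdjoint_iff]; simp)
          (by rw [isSelfAdjoint_iff]; simp [hd0.isSelfAdjoint.star_eq])) (sqSum_isSelfAdjoint hE F)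
      · rw [hχ.sub (add_mem (rsmul_mem _ (one_mem A)) (rsmul_mem _ hdA)) (sqSum_mem hM hE hx F),
          hχ.add _ (rsmul_mem _ (one_mem A)) _ (rsmul_mem _ hdA), hχ.rsmul _ (one_mem A),
          hχ.rsmul _ hdA, hχ.one, Complex.sub_re, char_sqSum hM hE hx hχ]
        have e1 : ∑ k, (χ (mu E x (F.p k))).re ≤ 1 := by
          rw [← char_sum_mu hM hE hx hχ _ _ F.mem, F.sum]
          have := hχ.re_nonneg (sub_mem (one_mem A) (mu_mem hM hE hx (one_mem A)))
            (sub_nonneg.2 (mu_one_le hE hx1))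
          rw [hχ.sub (one_mem A) (mu_mem hM hE hx (one_mem A)), hχ.one, Complex.sub_re,
            Complex.one_re] at this
          linarith
        have e2 := hχ.re_nonneg hdA hd0
        have e3 : ∑ k, (χ (mu E x (F.p k))).re ^ 2 ≤
            ∑ k, (χ (mu E x (F.p k))).re * (γ + C * (χ d).re) := by
          refine Finset.sum_le_sum fun k _ => ?_
          have h3 := hχ.re_nonneg (hm k) (hm0 k)
          have h4 := h1 χ hχ k
          rw [hbχ χ hχ] at h4
          nlinarith
        rw [← Finset.sum_mul] at e3
        have e4 : 0 ≤ γ + C * (χ d).re := by positivity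
        have : ((γ : ℂ) * 1 + C * χ d).re = γ + C * (χ d).re := by simp
        rw [this]
        nlinarith
    have h3 := tr_mono η h2
    rw [map_add, ← Complex.coe_smul, ← Complex.coe_smul, map_smul, map_smul, hT.one,
      Complex.add_re, smul_eq_mul, smul_eq_mul, Complex.re_ofReal_mul, Complex.re_ofReal_mul,
      tr_sqSum hE, Complex.one_re] at h3
    have h4 := h F
    have h5 : C * (tr η d).re ≤ C * (c / (4 * C)) := by gcongr
    have h6 : C * (c / (4 * C)) = c / 4 := by field_simp
    linarith
  obtain ⟨z, hzA, hz, e1, e2, e3, -⟩ := exists_spectral_projection (hbA k) (hbsa k)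
  refine ⟨F.p k, F.mem k, z, hzA, γ, F.orth.proj k, hz, fun h0 => hk (e3 h0), hγ0,
    fun χ hχ hχz => ?_⟩
  have h1 : 0 ≤ (χ (b k)).re := by
    have hn := hχ.mul _ hzA _ (negPart_mem (hbA k) (hbsa k))
    rw [e2, hχz, one_mul, hχ.zero] at hn
    rw [← CFC.posPart_sub_negPart (b k) (hbsa k), hχ.sub (posPart_mem (hbA k) (hbsa k))
      (negPart_mem (hbA k) (hbsa k)), ← hn, sub_zero]
    exact hχ.re_nonneg (posPart_mem (hbA k) (hbsa k)) (CFC.posPart_nonneg _)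
  rw [hbχ χ hχ] at h1
  have hd1 := hχ.re_nonneg hdA hd0
  refine ⟨by nlinarith, fun p hp hpp => ?_⟩
  have h2 : 2 * (χ (mu E x (F.p k * p))).re * (χ (mu E x (F.p k * (1 - p)))).re ≤ (χ d).re := by
    let G := F.inf hM.comm (Part.two p hp hpp)
    have h3 : (χ a).re ≤ (χ (sqSum E x G)).re := by
      have := hχ.re_nonneg (sub_mem (sqSum_mem hM hE hx G) haA) (sub_nonneg.2 (hle G))
      rw [hχ.sub (sqSum_mem hM hE hx G) haA, Complex.sub_re] at this
      linarith
    have hsplit : ∀ i, (χ (mu E x (F.p i))).re = (χ (mu E x (F.p i * p))).re +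
        (χ (mu E x (F.p i * (1 - p)))).re := by
      intro i
      rw [← char_mu_add hM hE hx hχ (mul_mem (F.mem i) hp)
        (mul_mem (F.mem i) (sub_mem (one_mem A) hp)), ← mul_add, add_sub_cancel, mul_one]
    have h4 : (χ (sqSum E x G)).re = ∑ i, ((χ (mu E x (F.p i * p))).re ^ 2 +
        (χ (mu E x (F.p i * (1 - p)))).re ^ 2) := by
      rw [char_sqSum hM hE hx hχ]
      change ∑ j : F.ι × Bool, (χ (mu E x (F.p j.1 * (if j.2 then p else 1 - p)))).re ^ 2 = _
      rw [Fintype.sum_prod_type]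
      simp
    have h5 : (χ d).re = ∑ i, (χ (mu E x (F.p i))).re ^ 2 - (χ a).re := by
      rw [hd, hχ.sub (sqSum_mem hM hE hx F) haA, Complex.sub_re, char_sqSum hM hE hx hχ]
    have h6 : ∀ i, 0 ≤ 2 * (χ (mu E x (F.p i * p))).re * (χ (mu E x (F.p i * (1 - p)))).re := by
      intro i
      have h7 := char_mu_nonneg hM hE hx hχ (mul_mem (F.mem i) hp)
        (proj_mul hM.comm (F.mem i) hp (F.orth.proj i) hpp)
      have h8 := char_mu_nonneg hM hE hx hχ (mul_mem (F.mem i) (sub_mem (one_mem A) hp))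
        (proj_mul hM.comm (F.mem i) (sub_mem (one_mem A) hp) (F.orth.proj i) hpp.one_sub)
      positivity
    have h7 : ∑ i, 2 * (χ (mu E x (F.p i * p))).re * (χ (mu E x (F.p i * (1 - p)))).re =
        ∑ i, (χ (mu E x (F.p i))).re ^ 2 - (χ (sqSum E x G)).re := by
      rw [h4, ← Finset.sum_sub_distrib]
      refine Finset.sum_congr rfl fun i _ => ?_
      rw [hsplit]
      ring
    have h8 := Finset.single_le_sum (fun i _ => h6 i) (Finset.mem_univ k)
    rw [h7] at h8
    linarith
  have h3 : γ / 4 * C = 1 := by rw [hC]; field_simp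
  have h4 : (χ d).re ≤ γ / 4 * (C * (χ d).re) := by rw [← mul_assoc, h3, one_mul]
  refine (h2.trans h4).trans ?_
  gcongr
  linarith

end

end Masa

section PointMap

variable {H : Type*} [NormedAddCommGroup H] [InnerProductSpace ℂ H] [CompleteSpace H]
variable {N A : VonNeumannAlgebra H} {n : ℕ} {η : Fin n → H}
variable {E : (H →L[ℂ] H) →ₗ[ℂ] (H →L[ℂ] H)} {x y a b p q : H →L[ℂ] H}

variable (hM : IsMasaIn N A) (hE : IsPinching A E)
include hM hE

/-- The projection on which the measure `μ(p₀ ·)`, concentrated at a point, is concentrated in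
`p`. -/
theorem exists_concentration_projection (hx : x ∈ N) {p₀ z : H →L[ℂ] H} {γ : ℝ} (hp₀ : p₀ ∈ A)
    (hz : z ∈ A) (hpp₀ : IsStarProjection p₀) (hpz : IsStarProjection z) (hγ : 0 < γ)
    (h : ∀ χ, IsChar A χ → χ z = 1 → γ ≤ (χ (mu E x p₀)).re ∧ ∀ p ∈ A, IsStarProjection p →
        2 * (χ (mu E x (p₀ * p))).re * (χ (mu E x (p₀ * (1 - p)))).re ≤
          γ / 4 * (χ (mu E x p₀)).re) (hp : p ∈ A) (hpp : IsStarProjection p) :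
    ∃ s ∈ A, IsStarProjection s ∧ z * s = s ∧ ∀ χ, IsChar A χ → χ z = 1 →
      (χ s = 1 → (χ (mu E x p₀)).re - γ / 4 ≤ (χ (mu E x (p₀ * p))).re) ∧
      (χ s = 0 → (χ (mu E x (p₀ * p))).re ≤ γ / 4) := by
  have hmp := mu_mem hM hE hx (mul_mem hp₀ hp)
  have hm := mu_mem hM hE hx hp₀
  have hsa1 : IsSelfAdjoint (mu E x (p₀ * p)) :=
    (mu_nonneg hE (proj_mul hM.comm hp₀ hp hpp₀ hpp)).isSelfAdjoint
  have hsa2 : IsSelfAdjoint (mu E x p₀) := (mu_nonneg hE hpp₀).isSelfAdjoint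
  set b := mu E x (p₀ * p) + mu E x (p₀ * p) - mu E x p₀ with hb
  have hbA : b ∈ A := sub_mem (add_mem hmp hmp) hm
  have hbsa : IsSelfAdjoint b := (hsa1.add hsa1).sub hsa2
  obtain ⟨s, hsA, hs, e1, e2, -, -, -⟩ := exists_spectral_projection hbA hbsa
  have hP := posPart_mem hbA hbsa
  have hN := negPart_mem hbA hbsa
  refine ⟨z * s, mul_mem hz hsA, proj_mul hM.comm hz hsA hpz hs, by
    rw [← mul_assoc, hpz.isIdempotentElem.eq], fun χ hχ hχz => ?_⟩
  obtain ⟨h1, h2⟩ := h χ hχ hχz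
  replace h2 := h2 p hp hpp
  have h3 : (χ (mu E x p₀)).re = (χ (mu E x (p₀ * p))).re + (χ (mu E x (p₀ * (1 - p)))).re := by
    rw [← char_mu_add hM hE hx hχ (mul_mem hp₀ hp) (mul_mem hp₀ (sub_mem (one_mem A) hp)),
      ← mul_add, add_sub_cancel, mul_one]
  have h4 : (χ b).re = 2 * (χ (mu E x (p₀ * p))).re - (χ (mu E x p₀)).re := by
    rw [hχ.sub (add_mem hmp hmp) hm, hχ.add _ hmp _ hmp, Complex.sub_re, Complex.add_re]
    ring
  have h5 : (χ b).re = (χ b⁺).re - (χ b⁻).re := by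
    conv_lhs => rw [← CFC.posPart_sub_negPart b hbsa, hχ.sub hP hN, Complex.sub_re]
  have h6 := hχ.re_nonneg hP (CFC.posPart_nonneg b)
  have h7 := hχ.re_nonneg hN (CFC.negPart_nonneg b)
  rw [hχ.mul _ hz _ hsA, hχz, one_mul]
  constructor
  · intro hχs
    have hn := hχ.mul _ hsA _ hN
    rw [e2, hχs, one_mul, hχ.zero] at hn
    rw [← hn, Complex.zero_re] at h5
    nlinarith
  · intro hχs
    have hn := hχ.mul _ hsA _ hP
    rw [e1, hχs, zero_mul] at hn
    rw [hn, Complex.zero_re] at h5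
    nlinarith

/-- A measure almost concentrated at a point defines a homomorphism on projections. -/
theorem exists_pointMap (hx : x ∈ N) {p₀ z : H →L[ℂ] H} {γ : ℝ} (hp₀ : p₀ ∈ A)
    (hz : z ∈ A) (hpp₀ : IsStarProjection p₀) (hpz : IsStarProjection z) (hγ : 0 < γ)
    (h : ∀ χ, IsChar A χ → χ z = 1 → γ ≤ (χ (mu E x p₀)).re ∧ ∀ p ∈ A, IsStarProjection p →
        2 * (χ (mu E x (p₀ * p))).re * (χ (mu E x (p₀ * (1 - p)))).re ≤
          γ / 4 * (χ (mu E x p₀)).re) :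
    ∃ σ : (H →L[ℂ] H) → (H →L[ℂ] H), (∀ p ∈ A, IsStarProjection p →
        σ p ∈ A ∧ IsStarProjection (σ p) ∧ z * σ p = σ p) ∧
      (∀ p ∈ A, ∀ q ∈ A, IsStarProjection p → IsStarProjection q → p * q = 0 → σ p * σ q = 0) ∧
      (∀ p ∈ A, ∀ q ∈ A, IsStarProjection p → IsStarProjection q → p * q = q →
        σ q * σ p = σ q) ∧
      ∀ F : Part A, (3 * γ / 4) • z ≤ ∑ j, mu E x (p₀ * F.p j) * σ (F.p j) := by
  classical
  have key : ∀ p : H →L[ℂ] H, ∃ s, p ∈ A → IsStarProjection p → 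
      s ∈ A ∧ IsStarProjection s ∧ z * s = s ∧ ∀ χ, IsChar A χ → χ z = 1 →
      (χ s = 1 → (χ (mu E x p₀)).re - γ / 4 ≤ (χ (mu E x (p₀ * p))).re) ∧
      (χ s = 0 → (χ (mu E x (p₀ * p))).re ≤ γ / 4) := by
    intro p
    by_cases hp : p ∈ A ∧ IsStarProjection p
    · obtain ⟨s, h1, h2⟩ :=
        exists_concentration_projection hM hE hx hp₀ hz hpp₀ hpz hγ h hp.1 hp.2
      exact ⟨s, fun _ _ => ⟨h1, h2⟩⟩
    · exact ⟨0, fun h1 h2 => absurd ⟨h1, h2⟩ hp⟩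
  choose σ hσ using key
  have hσA := fun p hp hpp => (hσ p hp hpp).1
  have hσp := fun p hp hpp => (hσ p hp hpp).2.1
  have hσz := fun p hp hpp => (hσ p hp hpp).2.2.1
  have hu0 : ∀ p ∈ A, IsStarProjection p → ∀ χ, IsChar A χ → 0 ≤ (χ (mu E x (p₀ * p))).re :=
    fun p hp hpp χ hχ => char_mu_nonneg hM hE hx hχ (mul_mem hp₀ hp)
      (proj_mul hM.comm hp₀ hp hpp₀ hpp)
  have hadd : ∀ p ∈ A, ∀ q ∈ A, ∀ χ, IsChar A χ → (χ (mu E x (p₀ * (p + q)))).re =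
      (χ (mu E x (p₀ * p))).re + (χ (mu E x (p₀ * q))).re := by
    intro p hp q hq χ hχ
    rw [mul_add, char_mu_add hM hE hx hχ (mul_mem hp₀ hp) (mul_mem hp₀ hq)]
  have hle : ∀ p ∈ A, IsStarProjection p → ∀ χ, IsChar A χ →
      (χ (mu E x (p₀ * p))).re ≤ (χ (mu E x p₀)).re := by
    intro p hp hpp χ hχ
    have h1 := hadd p hp (1 - p) (sub_mem (one_mem A) hp) χ hχ
    rw [add_sub_cancel, mul_one] at h1
    linarith [hu0 (1 - p) (sub_mem (one_mem A) hp) hpp.one_sub χ hχ]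
  have hχz0 : ∀ p ∈ A, IsStarProjection p → ∀ χ, IsChar A χ → χ z = 0 → χ (σ p) = 0 := by
    intro p hp hpp χ hχ hχz
    rw [← hσz p hp hpp, hχ.mul _ hz _ (hσA p hp hpp), hχz, zero_mul]
  have horth : ∀ p ∈ A, ∀ q ∈ A, IsStarProjection p → IsStarProjection q → p * q = 0 →
      IsStarProjection (p + q) := by
    intro p hp q hq hpp hqq hpq
    refine ⟨?_, hpp.isSelfAdjoint.add hqq.isSelfAdjoint⟩
    have : q * p = 0 := by rw [hM.comm _ hq _ hp, hpq]
    rw [IsIdempotentElem, mul_add, add_mul, add_mul, hpp.isIdempotentElem.eq,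
      hqq.isIdempotentElem.eq, hpq, this, add_zero, zero_add]
  have hdisj : ∀ p ∈ A, ∀ q ∈ A, IsStarProjection p → IsStarProjection q → p * q = 0 →
      ∀ χ, IsChar A χ → χ (σ p) * χ (σ q) = 0 := by
    intro p hp q hq hpp hqq hpq χ hχ
    rcases hχ.projection hz hpz with h0 | h1
    · rw [hχz0 p hp hpp χ hχ h0, zero_mul]
    rcases hχ.projection (hσA p hp hpp) (hσp p hp hpp) with hp0 | hp1
    · rw [hp0, zero_mul]
    rcases hχ.projection (hσA q hq hqq) (hσp q hq hqq) with hq0 | hq1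
    · rw [hq0, mul_zero]
    exfalso
    have h2 := ((hσ p hp hpp).2.2.2 χ hχ h1).1 hp1
    have h3 := ((hσ q hq hqq).2.2.2 χ hχ h1).1 hq1
    have h4 := hle _ (add_mem hp hq) (horth p hp q hq hpp hqq hpq) χ hχ
    rw [hadd p hp q hq χ hχ] at h4
    linarith [(h χ hχ h1).1]
  have hσ0 : ∀ χ, IsChar A χ → χ (σ 0) = 0 := by
    intro χ hχ
    have h0A := hσA 0 (zero_mem A) (IsStarProjection.zero _)
    have h0P := hσp 0 (zero_mem A) (IsStarProjection.zero _)
    have := hdisj 0 (zero_mem A) 0 (zero_mem A) (IsStarProjection.zero _)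
      (IsStarProjection.zero _) (zero_mul 0) χ hχ
    exact mul_self_eq_zero.1 this
  have hσadd : ∀ p ∈ A, ∀ q ∈ A, IsStarProjection p → IsStarProjection q → p * q = 0 →
      ∀ χ, IsChar A χ → χ (σ (p + q)) = χ (σ p) + χ (σ q) := by
    intro p hp q hq hpp hqq hpq χ hχ
    have hpqp := horth p hp q hq hpp hqq hpq
    have hpqA := add_mem hp hq
    rcases hχ.projection hz hpz with h0 | h1
    · rw [hχz0 p hp hpp χ hχ h0, hχz0 q hq hqq χ hχ h0, hχz0 _ hpqA hpqp χ hχ h0, add_zero]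
    have e1 := (hσ p hp hpp).2.2.2 χ hχ h1
    have e2 := (hσ q hq hqq).2.2.2 χ hχ h1
    have e3 := (hσ _ hpqA hpqp).2.2.2 χ hχ h1
    have e4 := (h χ hχ h1).1
    have e5 := hadd p hp q hq χ hχ
    have e6 := hu0 p hp hpp χ hχ
    have e7 := hu0 q hq hqq χ hχ
    rcases hχ.projection (hσA p hp hpp) (hσp p hp hpp) with hp0 | hp1 <;>
    rcases hχ.projection (hσA q hq hqq) (hσp q hq hqq) with hq0 | hq1 <;>
    rcases hχ.projection (hσA _ hpqA hpqp) (hσp _ hpqA hpqp) with hr0 | hr1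
    · simp [hp0, hq0, hr0]
    · exfalso
      linarith [e1.2 hp0, e2.2 hq0, e3.1 hr1]
    · exfalso
      linarith [e1.2 hp0, e2.1 hq1, e3.2 hr0]
    · simp [hp0, hq1, hr1]
    · exfalso
      linarith [e1.1 hp1, e2.2 hq0, e3.2 hr0]
    · simp [hp1, hq0, hr1]
    · exfalso
      linarith [e1.1 hp1, e2.1 hq1, e3.2 hr0]
    · exfalso
      have := hdisj p hp q hq hpp hqq hpq χ hχ
      rw [hp1, hq1] at this
      norm_num at this
  refine ⟨σ, fun p hp hpp => ⟨hσA p hp hpp, hσp p hp hpp, hσz p hp hpp⟩, ?_, ?_, ?_⟩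
  · intro p hp q hq hpp hqq hpq
    have h1 := hσA p hp hpp
    have h2 := hσA q hq hqq
    refine eq_zero_of_char hM.comm (mul_mem h1 h2) fun χ hχ => ?_
    rw [hχ.mul _ h1 _ h2]
    exact hdisj p hp q hq hpp hqq hpq χ hχ
  · intro p hp q hq hpp hqq hpq
    have h1 := hσA p hp hpp
    have h2 := hσA q hq hqq
    refine eq_of_char hM.comm (mul_mem h2 h1) h2 fun χ hχ => ?_
    rw [hχ.mul _ h2 _ h1]
    have hqp : q * p = q := by rw [hM.comm _ hq _ hp, hpq]
    have hr : IsStarProjection (p - q) := by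
      refine ⟨?_, hpp.isSelfAdjoint.sub hqq.isSelfAdjoint⟩
      rw [IsIdempotentElem, mul_sub, sub_mul, sub_mul, hpp.isIdempotentElem.eq,
        hqq.isIdempotentElem.eq, hpq, hqp, sub_self, sub_zero]
    have h3 := hσadd q hq (p - q) (sub_mem hp hq) hqq hr (by
      rw [mul_sub, hqp, hqq.isIdempotentElem.eq, sub_self]) χ hχ
    rw [add_sub_cancel] at h3
    have h4 := hdisj q hq (p - q) (sub_mem hp hq) hqq hr (by
      rw [mul_sub, hqp, hqq.isIdempotentElem.eq, sub_self]) χ hχ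
    rw [h3, mul_add, h4, add_zero]
    rcases hχ.projection h2 (hσp q hq hqq) with h | h <;> rw [h] <;> norm_num
  · intro F
    have hFA := fun j => hσA _ (F.mem j) (F.orth.proj j)
    have hFp := fun j => hσp _ (F.mem j) (F.orth.proj j)
    have hmA := fun j => mu_mem hM hE hx (mul_mem hp₀ (F.mem j))
    have hm0 := fun j => mu_nonneg (x := x) hE
      (proj_mul hM.comm hp₀ (F.mem j) hpp₀ (F.orth.proj j))
    have hsumA : ∑ j, mu E x (p₀ * F.p j) * σ (F.p j) ∈ A :=
      sum_mem fun j _ => mul_mem (hmA j) (hFA j)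
    rw [← sub_nonneg]
    refine nonneg_of_char hM.comm (sub_mem hsumA (rsmul_mem _ hz)) ?_ fun χ hχ => ?_
    · refine IsSelfAdjoint.sub ?_ ?_
      · rw [isSelfAdjoint_iff, star_sum]
        refine Finset.sum_congr rfl fun j _ => ?_
        rw [star_mul, (hm0 j).isSelfAdjoint.star_eq, (hFp j).isSelfAdjoint.star_eq,
          hM.comm _ (hFA j) _ (hmA j)]
      · rw [isSelfAdjoint_iff, star_smul, hpz.isSelfAdjoint.star_eq]; simp
    · rw [hχ.sub hsumA (rsmul_mem _ hz), hχ.rsmul _ hz,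
        hχ.sum _ _ fun j => mul_mem (hmA j) (hFA j), Complex.sub_re, Complex.re_sum,
        Complex.re_ofReal_mul]
      have hre : ∀ j, (χ (mu E x (p₀ * F.p j) * σ (F.p j))).re =
          (χ (mu E x (p₀ * F.p j))).re * (χ (σ (F.p j))).re := fun j =>
        hχ.re_mul (hmA j) (hFA j) (hm0 j).isSelfAdjoint
      simp only [hre]
      rcases hχ.projection hz hpz with h0 | h1
      · rw [h0, Complex.zero_re, mul_zero, sub_zero]
        refine Finset.sum_nonneg fun j _ => ?_
        rw [hχz0 _ (F.mem j) (F.orth.proj j) χ hχ h0]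
        simp
      have e4 := (h χ hχ h1).1
      have hfin : ∀ s : Finset F.ι, IsStarProjection (∑ j ∈ s, F.p j) ∧
          χ (σ (∑ j ∈ s, F.p j)) = ∑ j ∈ s, χ (σ (F.p j)) := by
        intro s
        induction s using Finset.induction_on with
        | empty => simp [hσ0 χ hχ, IsStarProjection.zero]
        | insert j s hj ih =>
          have ho : F.p j * ∑ i ∈ s, F.p i = 0 := by
            rw [Finset.mul_sum]
            exact Finset.sum_eq_zero fun i hi => F.orth.orth _ _ (by rintro rfl; exact hj hi)
          have hsA : ∑ i ∈ s, F.p i ∈ A := sum_mem fun i _ => F.mem i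
          rw [Finset.sum_insert hj, Finset.sum_insert hj]
          exact ⟨horth _ (F.mem j) _ hsA (F.orth.proj j) ih.1 ho, by
            rw [hσadd _ (F.mem j) _ hsA (F.orth.proj j) ih.1 ho χ hχ, ih.2]⟩
      have hone : χ (σ 1) = 1 := by
        rcases hχ.projection (hσA 1 (one_mem A) (IsStarProjection.one _))
          (hσp 1 (one_mem A) (IsStarProjection.one _)) with h | h
        · exfalso
          have := ((hσ 1 (one_mem A) (IsStarProjection.one _)).2.2.2 χ hχ h1).2 h
          rw [mul_one] at this
          linarith
        · exact h
      have hsum : ∑ j, (χ (σ (F.p j))).re = 1 := by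
        rw [← Complex.re_sum, ← (hfin Finset.univ).2, F.sum, hone, Complex.one_re]
      rw [h1, Complex.one_re, mul_one, sub_nonneg]
      calc 3 * γ / 4 = ∑ j, (3 * γ / 4) * (χ (σ (F.p j))).re := by
            rw [← Finset.mul_sum, hsum, mul_one]
        _ ≤ _ := Finset.sum_le_sum fun j _ => by
            rcases hχ.projection (hFA j) (hFp j) with h | h
            · rw [h]; simp
            · have := ((hσ _ (F.mem j) (F.orth.proj j)).2.2.2 χ hχ h1).1 h
              rw [h, Complex.one_re, mul_one, mul_one]
              linarith

/-- If the measures `μ` are not diffuse, then `x` can be cut down to a nonzero element that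
intertwines `A` with itself. -/
theorem exists_intertwiner_of_norm_le_one (hT : IsTrace N η) (hx : x ∈ N) (hx1 : ‖x‖ ≤ 1) {c : ℝ}
    (hc : 0 < c) (h : ∀ F : Part A, c ≤ ∑ k, nrm η (mu E x (F.p k)) ^ 2) :
    ∃ σ : (H →L[ℂ] H) → (H →L[ℂ] H), ∃ w ∈ N, w ≠ 0 ∧
      (∀ p ∈ A, IsStarProjection p → σ p ∈ A ∧ IsStarProjection (σ p) ∧ p * w = w * σ p) ∧
      (E x = 0 → E w = 0) ∧
      ∀ p ∈ A, ∀ t ∈ A, x * p = t * x → w * p = t * w := by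
  obtain ⟨p₀, hp₀, z, hz, γ, hpp₀, hpz, hz0, hγ, hcon⟩ :=
    exists_concentration hM hE hT hx hx1 hc h
  obtain ⟨σ, h1, h2, h3, h4⟩ := exists_pointMap hM hE hx hp₀ hz hpp₀ hpz hγ hcon
  obtain ⟨𝒰, h𝒰⟩ := Part.exists_ultrafilter hM.comm
  have hG := fun (G : Part A) j => h1 _ (G.mem j) (G.orth.proj j)
  have hxN := hM.le hp₀
  have hzN := hM.le hz
  set y := p₀ * x * z with hy
  have hyN : y ∈ N := mul_mem (mul_mem hxN hx) hzN
  let f : Part A → H →L[ℂ] H := fun G => ∑ j, G.p j * y * σ (G.p j)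
  have hfN : ∀ G, f G ∈ N := fun G => sum_mem fun j _ =>
    mul_mem (mul_mem (hM.le (G.mem j)) hyN) (hM.le (hG G j).1)
  obtain ⟨w, hw⟩ := WLim.exists_of_bounded (𝒰 := 𝒰) (f := f) (C := ‖y‖) fun G =>
    G.orth.norm_sum_le ⟨fun j => (hG G j).2.1, fun i j hij =>
      h2 _ (G.mem i) _ (G.mem j) (G.orth.proj i) (G.orth.proj j) (G.orth.orth i j hij)⟩ y
  have hwN : w ∈ N := hw.mem (Eventually.of_forall hfN)
  refine ⟨σ, w, hwN, ?_, ?_, ?_, ?_⟩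
  · rintro rfl
    have hl := (Complex.continuous_re.tendsto _).comp ((hw.mul_left (star y)).tendsto_tr η)
    rw [mul_zero, map_zero, Complex.zero_re] at hl
    have hz1 : 0 < (tr η z).re := by
      by_contra hcon
      exact hz0 (hT.eq_zero_of_tr hzN (IsStarProjection.nonneg' hpz) (not_lt.1 hcon))
    have hb : ∀ G, 3 * γ / 4 * (tr η z).re ≤ (tr η (star y * f G)).re := by
      intro G
      have e := tr_mono η (h4 G)
      rw [← Complex.coe_smul, map_smul, smul_eq_mul, Complex.re_ofReal_mul] at e
      refine e.trans_eq ?_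
      congr 1
      have hj : ∀ j, E (star y * (G.p j * y * σ (G.p j))) =
          mu E x (p₀ * G.p j) * σ (G.p j) := by
        intro j
        have e1 : star y * (G.p j * y * σ (G.p j)) =
            z * (star x * (p₀ * G.p j) * x) * σ (G.p j) := by
          rw [hy, star_mul, star_mul, hpp₀.isSelfAdjoint.star_eq, hpz.isSelfAdjoint.star_eq]
          calc z * (star x * p₀) * (G.p j * (p₀ * x * z) * σ (G.p j))
              = z * (star x * (p₀ * (G.p j * p₀)) * x) * (z * σ (G.p j)) := by
                simp only [mul_assoc]
            _ = _ := by
                rw [hM.comm _ (G.mem j) _ hp₀, ← mul_assoc p₀ p₀, hpp₀.isIdempotentElem.eq,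
                  (hG G j).2.2]
        have e2 := mu_mem hM hE hx (mul_mem hp₀ (G.mem j))
        rw [e1, hM.E_right hE (hG G j).1, hM.E_left hE hz, ← mu_apply, hM.comm _ hz _ e2,
          mul_assoc, (hG G j).2.2]
      rw [← hE.tr N n η hM.le hT _ (mul_mem (star_mem hyN) (hfN G))]
      simp only [f, Finset.mul_sum, map_sum, hj]
    have := le_of_tendsto_of_tendsto tendsto_const_nhds hl (Eventually.of_forall hb)
    have : 0 < 3 * γ / 4 * (tr η z).re := by positivity
    linarith
  · intro p hp hpp
    refine ⟨(h1 p hp hpp).1, (h1 p hp hpp).2.1, ?_⟩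
    refine ((hw.mul_left p).congr' ?_).unique (hw.mul_right (σ p))
    filter_upwards [h𝒰 (Part.two p hp hpp)] with G hG'
    simp only [f, Finset.mul_sum, Finset.sum_mul]
    refine Finset.sum_congr rfl fun j _ => ?_
    rcases Part.eq_or_of_two_le hG' j with e | e
    · rw [mul_assoc _ _ (σ p), h3 p hp _ (G.mem j) hpp (G.orth.proj j) e, ← mul_assoc, ← mul_assoc,
        e]
    · rw [mul_assoc _ _ (σ p), h2 _ (G.mem j) p hp (G.orth.proj j) hpp (by
        rw [hM.comm _ (G.mem j) _ hp, e]), ← mul_assoc, ← mul_assoc, e]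
      simp
  · intro hEx
    refine hM.eq_zero_of_tr_mul hE hT hwN fun a ha => ?_
    have hl := (hw.mul_left a).tendsto_tr η
    refine tendsto_nhds_unique hl (tendsto_const_nhds.congr fun G => ?_)
    rw [Finset.mul_sum, map_sum]
    refine (Finset.sum_eq_zero fun j _ => ?_).symm
    have e1 : a * (G.p j * y * σ (G.p j)) = (a * G.p j * p₀) * x * (z * σ (G.p j)) := by
      simp only [hy, mul_assoc]
    have e2 : a * G.p j * p₀ ∈ A := mul_mem (mul_mem ha (G.mem j)) hp₀
    have e3 : z * σ (G.p j) ∈ A := mul_mem hz (hG G j).1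
    rw [e1, ← hE.tr N n η hM.le hT _ (mul_mem (mul_mem (hM.le e2) hx) (hM.le e3)),
      hM.E_right hE e3, hM.E_left hE e2, hEx, mul_zero, zero_mul, map_zero]
  · intro p hp t ht hxp
    refine ((hw.mul_right p).congr' (Eventually.of_forall fun G => ?_)).unique (hw.mul_left t)
    simp only [f, Finset.mul_sum, Finset.sum_mul]
    refine Finset.sum_congr rfl fun j _ => ?_
    calc G.p j * y * σ (G.p j) * p = G.p j * p₀ * (x * p) * z * σ (G.p j) := by
          rw [mul_assoc, hM.comm _ (hG G j).1 _ hp, ← mul_assoc, mul_assoc (G.p j), hy,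
            mul_assoc _ z p, hM.comm _ hz _ hp]
          simp only [mul_assoc]
      _ = (G.p j * p₀) * t * x * z * σ (G.p j) := by rw [hxp]; simp only [mul_assoc]
      _ = t * (G.p j * p₀) * x * z * σ (G.p j) := by
          rw [hM.comm _ (mul_mem (G.mem j) hp₀) _ ht]
      _ = _ := by simp only [hy, mul_assoc]

theorem exists_intertwiner (hT : IsTrace N η) (hx : x ∈ N) {c : ℝ}
    (hc : 0 < c) (h : ∀ F : Part A, c ≤ ∑ k, nrm η (mu E x (F.p k)) ^ 2) :
    ∃ σ : (H →L[ℂ] H) → (H →L[ℂ] H), ∃ w ∈ N, w ≠ 0 ∧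
      (∀ p ∈ A, IsStarProjection p → σ p ∈ A ∧ IsStarProjection (σ p) ∧ p * w = w * σ p) ∧
      (E x = 0 → E w = 0) ∧
      ∀ p ∈ A, ∀ t ∈ A, x * p = t * x → w * p = t * w := by
  set r : ℝ := ‖x‖ + 1 with hr
  have hr0 : 0 < r := by positivity
  set y : H →L[ℂ] H := ((r⁻¹ : ℝ) : ℂ) • x with hy
  have hmu : ∀ p, mu E y p = ((r⁻¹ ^ 2 : ℝ) : ℂ) • mu E x p := by
    intro p
    rw [mu_apply, mu_apply, hy, star_smul, smul_mul_assoc, smul_mul_assoc, mul_smul_comm,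
      smul_smul, map_smul]
    congr 1
    simp [sq]
  obtain ⟨σ, w, hw, hw0, h1, h2, h3⟩ := exists_intertwiner_of_norm_le_one hM hE hT (x := y)
    (c := (r⁻¹ ^ 2) ^ 2 * c) (smul_mem' _ hx) (by
      rw [hy, norm_smul, Complex.norm_real, Real.norm_of_nonneg (by positivity), inv_mul_le_one₀ hr0]
      linarith) (by positivity) fun F => by
      simp only [hmu, nrm_smul, Complex.norm_real, Real.norm_of_nonneg (sq_nonneg (r⁻¹ : ℝ)), mul_pow,
        ← Finset.mul_sum]
      have := h F
      gcongr
  refine ⟨σ, w, hw, hw0, h1, fun hEx => h2 ?_, fun p hp t ht hxp => h3 p hp t ht ?_⟩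
  · rw [hy, map_smul, hEx, smul_zero]
  · rw [hy, smul_mul_assoc, mul_smul_comm, hxp]

end PointMap

section Singular

variable {H : Type*} [NormedAddCommGroup H] [InnerProductSpace ℂ H] [CompleteSpace H]
variable {N A : VonNeumannAlgebra H} {n : ℕ} {η : Fin n → H}
variable {E : (H →L[ℂ] H) →ₗ[ℂ] (H →L[ℂ] H)} {x y a b p q : H →L[ℂ] H}

/-- Every symmetry of `N` normalizing `A` belongs to `A`. -/
def IsSingularIn (N A : VonNeumannAlgebra H) : Prop :=
  ∀ u ∈ N, star u = u → u * u = 1 → (∀ a ∈ A, u * a * u ∈ A) → u ∈ A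

theorem IsMasaIn.mem_of_commute_projections (hM : IsMasaIn N A) (hx : x ∈ N)
    (h : ∀ p ∈ A, IsStarProjection p → x * p = p * x) : x ∈ A :=
  hM.max x hx fun _ ha => commute_of_commute_projections h ha

theorem IsSingularIn.eq_zero_of_disjoint (hM : IsMasaIn N A) (hS : IsSingularIn N A)
    {u e q : H →L[ℂ] H} (hu : u ∈ N) (heA : e ∈ A) (he : IsStarProjection e)
    (huu : star u * u = q) (hq : q * e = e) (h1 : ∀ a ∈ A, u * a * star u ∈ A)
    (h2 : ∀ a ∈ A, star u * a * u ∈ A) (hd : e * (u * e * star u) = 0) : e = 0 := by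
  set b := u * e with hb
  set f := u * e * star u with hf
  have hfA : f ∈ A := h1 e heA
  have hes := he.isSelfAdjoint.star_eq
  have hei := he.isIdempotentElem.eq
  have hbs : star b = e * star u := by rw [hb, star_mul, hes]
  have hbb : star b * b = e := by
    rw [hbs, hb, mul_assoc, ← mul_assoc (star u), huu, hq, hei]
  have hbb' : b * star b = f := by
    rw [hbs, hb, ← mul_assoc, mul_assoc u, hei]
  have hfs : star f = f := by rw [← hbb', star_mul, star_star]
  have hbe : b * e = b := by rw [hb, mul_assoc, hei]
  have hfb : f * b = b := by rw [← hbb', mul_assoc, hbb, hbe]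
  have hef : e * f = 0 := hd
  have hfe : f * e = 0 := by rw [hM.comm _ hfA _ heA, hef]
  have heb : e * b = 0 := by rw [← hfb, ← mul_assoc, hef, zero_mul]
  have hbf : b * f = 0 := by rw [← hbe, mul_assoc, hef, mul_zero]
  have hbsq : b * b = 0 := by
    have := congrArg (b * ·) heb
    rwa [← mul_assoc, hbe, mul_zero] at this
  have hebs : e * star b = star b := by simpa only [star_mul, hes] using congrArg star hbe
  have hbsf : star b * f = star b := by simpa only [star_mul, hfs] using congrArg star hfb
  have hbse : star b * e = 0 := by simpa only [star_mul, hes, star_zero] using congrArg star heb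
  have hfbs : f * star b = 0 := by simpa only [star_mul, hfs, star_zero] using congrArg star hbf
  have hbsbs : star b * star b = 0 := by simpa only [star_mul, star_zero] using congrArg star hbsq
  have hff : f * f = f := by
    calc f * f = f * b * star b := by rw [mul_assoc f b, hbb']
      _ = f := by rw [hfb, hbb']
  set g := 1 - e - f with hg
  have hgA : g ∈ A := sub_mem (sub_mem (one_mem A) heA) hfA
  have hgs : star g = g := by simp [hg, hes, hfs]
  have hbg : b * g = 0 := by simp [hg, mul_sub, hbe, hbf]
  have hbsg : star b * g = 0 := by simp [hg, mul_sub, hbse, hbsf]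
  have hgb : g * b = 0 := by simpa [hgs] using congrArg star hbsg
  have hgbs : g * star b = 0 := by simpa [hgs] using congrArg star hbg
  have hgg : g * g = g := by
    simp [hg, mul_sub, sub_mul, hei, hff, hef, hfe]
  have hbN : b ∈ N := mul_mem hu (hM.le heA)
  have hbab : ∀ a ∈ A, b * a * b = 0 := fun a ha => by
    have h3 : b * a * b = b * e * a * b := by rw [hbe]
    rw [h3, mul_assoc b e a, hM.comm _ heA _ ha, mul_assoc b (a * e) b,
      mul_assoc a e b, heb, mul_zero, mul_zero]
  have hbag : ∀ a ∈ A, b * a * g = 0 := fun a ha => by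
    rw [mul_assoc, hM.comm _ ha _ hgA, ← mul_assoc, hbg, zero_mul]
  have hbsag : ∀ a ∈ A, star b * a * g = 0 := fun a ha => by
    rw [mul_assoc, hM.comm _ ha _ hgA, ← mul_assoc, hbsg, zero_mul]
  have hmem := hS (b + star b + g) (add_mem (add_mem hbN (star_mem hbN)) (hM.le hgA))
    (by rw [star_add, star_add, star_star, hgs]; abel)
    (by
      simp only [add_mul, mul_add, hbsq, hbb, hbb', hbsbs, hbg, hbsg, hgb, hgbs, hgg]
      rw [hg]
      abel) fun a ha => by
      have e1 : (b + star b + g) * a * (b + star b + g) =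
          u * (e * a * e) * star u + e * (star u * a * u) * e + g * a * g := by
        have e2 : star b * a * star b = 0 := by
          simpa [mul_assoc] using congrArg star (hbab _ (star_mem ha))
        have e3 : g * a * b = 0 := by
          simpa [mul_assoc, hgs] using congrArg star (hbsag _ (star_mem ha))
        have e4 : g * a * star b = 0 := by
          simpa [mul_assoc, hgs] using congrArg star (hbag _ (star_mem ha))
        have e5 : b * a * star b = u * (e * a * e) * star u := by
          rw [hbs, hb]; simp only [mul_assoc]
        have e6 : star b * a * b = e * (star u * a * u) * e := by
          rw [hbs, hb]; simp only [mul_assoc]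
        simp only [add_mul, mul_add, hbab a ha, hbag a ha, hbsag a ha, e2, e3, e4, e5, e6]
        abel
      rw [e1]
      exact add_mem (add_mem (h1 _ (mul_mem (mul_mem heA ha) heA))
        (mul_mem (mul_mem heA (h2 a ha)) heA)) (mul_mem (mul_mem hgA ha) hgA)
  have hge : g * e = 0 := by simp [hg, sub_mul, hei, hfe]
  have heg : e * g = 0 := by rw [hM.comm _ heA _ hgA, hge]
  have hcomm := hM.comm _ hmem _ heA
  simp only [add_mul, mul_add, hbe, hbse, heb, hebs, hge, heg, add_zero, zero_add] at hcomm
  rw [← hbb, ← hcomm, hbsq]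

/-- A partial isometry implementing a partial automorphism of a singular MASA belongs to it. -/
theorem IsSingularIn.mem_of_partial (hM : IsMasaIn N A) (hS : IsSingularIn N A)
    {u q : H →L[ℂ] H} (hu : u ∈ N) (hqA : q ∈ A)
    (huu : star u * u = q) (huq : u * q = u) (h1 : ∀ a ∈ A, u * a * star u ∈ A)
    (h2 : ∀ a ∈ A, star u * a * u ∈ A) : u ∈ A := by
  have hr : u * star u ∈ A := by simpa using h1 1 (one_mem A)
  have key : ∀ p ∈ A, IsStarProjection p → (1 - p) * u * p = 0 := by
    intro p hp hpp
    have hp' : 1 - p ∈ A := sub_mem (one_mem A) hp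
    have hpp' := hpp.one_sub
    set g := star u * (1 - p) * u with hg
    have hgA : g ∈ A := h2 _ hp'
    have hgg : g * g = g := by
      have : g * g = star u * ((1 - p) * ((u * star u) * (1 - p))) * u := by
        simp only [hg, mul_assoc]
      rw [this, hM.comm _ hr _ hp', ← mul_assoc (1 - p), hpp'.isIdempotentElem.eq, hg]
      simp only [mul_assoc]
      rw [huu, huq]
    have hgq : g * q = g := by rw [hg, mul_assoc, huq]
    have hgs : IsStarProjection g := by
      refine ⟨hgg, ?_⟩
      rw [isSelfAdjoint_iff, hg]
      simp [mul_assoc, hpp.isSelfAdjoint.star_eq]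
    have he : g * p = 0 := by
      refine hS.eq_zero_of_disjoint hM hu (mul_mem hgA hp) (proj_mul hM.comm hgA hp hgs hpp) huu ?_
        h1 h2 ?_
      · rw [← mul_assoc, hM.comm _ hqA _ hgA, hgq]
      · have e1 : u * (g * p) * star u = (1 - p) * ((u * star u) * (u * p * star u)) := by
          rw [← mul_assoc (1 - p), hM.comm _ hp' _ hr]
          simp only [hg, mul_assoc]
        rw [e1, mul_assoc g p, ← mul_assoc p, mul_sub, hpp.isIdempotentElem.eq, mul_one, sub_self,
          zero_mul, mul_zero]
    have h3 : star ((1 - p) * u * p) * ((1 - p) * u * p) = 0 := by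
      have : star ((1 - p) * u * p) * ((1 - p) * u * p) =
          p * (star u * ((1 - p) * (1 - p)) * u * p) := by
        simp only [star_mul, hpp'.isSelfAdjoint.star_eq, hpp.isSelfAdjoint.star_eq, mul_assoc]
      rw [this, hpp'.isIdempotentElem.eq, ← hg, he, mul_zero]
    exact CStarRing.star_mul_self_eq_zero_iff _ |>.1 h3
  refine hM.mem_of_commute_projections hu fun p hp hpp => ?_
  have k1 := key p hp hpp
  have k2 := key (1 - p) (sub_mem (one_mem A) hp) hpp.one_sub
  rw [sub_sub_cancel, mul_sub, mul_one, sub_eq_zero] at k2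
  rw [sub_mul, sub_mul, one_mul, sub_eq_zero] at k1
  rw [k1, ← k2]

/-- In a singular MASA, the measures `p ↦ E (x* p x)` are diffuse when `E x = 0`. -/
theorem IsSingularIn.exists_sum_lt (hM : IsMasaIn N A) (hS : IsSingularIn N A)
    (hE : IsPinching A E) (hT : IsTrace N η) (hx : x ∈ N) (hEx : E x = 0) {ε : ℝ} (hε : 0 < ε) :
    ∃ F : Part A, ∑ k, nrm η (mu E x (F.p k)) ^ 2 < ε := by
  by_contra hcon
  push Not at hcon
  obtain ⟨θ, v, hv, hv0, hθ, hEv, -⟩ := exists_intertwiner hM hE hT hx hε hcon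
  replace hEv := hEv hEx
  have hθ' : ∀ p ∈ A, IsStarProjection p → star v * p = θ p * star v := fun p hp hpp => by
    simpa [hpp.isSelfAdjoint.star_eq, (hθ p hp hpp).2.1.isSelfAdjoint.star_eq] using
      congrArg star (hθ p hp hpp).2.2
  have hvav : ∀ a ∈ A, v * a * star v ∈ A := fun a ha =>
    hM.mem_of_commute_projections (mul_mem (mul_mem hv (hM.le ha)) (star_mem hv)) fun p hp hpp => by
      rw [mul_assoc, hθ' p hp hpp, ← mul_assoc, ← mul_assoc, ← mul_assoc, (hθ p hp hpp).2.2,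
        mul_assoc v (θ p), hM.comm _ (hθ p hp hpp).1 _ ha, ← mul_assoc]
  set h := star v * v with hh
  have hhN : h ∈ N := mul_mem (star_mem hv) hv
  set t := (tr η h).re with ht
  have ht0 : 0 < t := by
    by_contra h0
    exact hv0 (CStarRing.star_mul_self_eq_zero_iff _ |>.1
      (hT.eq_zero_of_tr hhN (star_mul_self_nonneg v) (not_lt.1 h0)))
  have hlow : ∀ F : Part A, t ^ 2 ≤ ∑ k, nrm η (mu E (star v) (F.p k)) ^ 2 := by
    intro F
    have hFN := fun k => hM.le (F.mem k)
    have hFs := fun k => (F.orth.proj k).isSelfAdjoint.star_eq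
    have hFi := fun k => (F.orth.proj k).isIdempotentElem.eq
    have e1 : ∀ k, nrm η (mu E (star v) (F.p k)) ^ 2 = nrm η (F.p k * h * F.p k) ^ 2 := by
      intro k
      rw [mu_apply, star_star, hM.E_self hE (hvav _ (F.mem k)), ← tr_star_mul_self_re,
        ← tr_star_mul_self_re]
      congr 1
      have e2 : star (v * F.p k * star v) * (v * F.p k * star v) =
          (v * F.p k * h * F.p k) * star v := by
        simp only [star_mul, star_star, hFs, hh, mul_assoc]
      have e3 : star (F.p k * h * F.p k) * (F.p k * h * F.p k) =
          (F.p k * h * F.p k * h) * F.p k := by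
        have : star h = h := by rw [hh, star_mul, star_star]
        simp only [star_mul, this, hFs, mul_assoc]
        rw [← mul_assoc (F.p k) (F.p k), hFi]
      rw [e2, e3, hT.tracial _ (mul_mem (mul_mem (mul_mem hv (hFN k)) hhN) (hFN k)) _ (star_mem hv),
        hT.tracial _ (mul_mem (mul_mem (mul_mem (hFN k) hhN) (hFN k)) hhN) _ (hFN k)]
      have e4 : star v * (v * F.p k * h * F.p k) = h * (F.p k * h * F.p k) := by
        simp only [hh, mul_assoc]
      have e5 : F.p k * (F.p k * h * F.p k * h) = (F.p k * h * F.p k) * h := by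
        simp only [mul_assoc]
        rw [← mul_assoc (F.p k) (F.p k), hFi]
      rw [e4, e5, hT.tracial _ hhN _ (mul_mem (mul_mem (hFN k) hhN) (hFN k))]
    simp only [e1]
    have e2 : t = ∑ k, (tr η (star (F.p k) * (F.p k * h * F.p k))).re := by
      rw [← Complex.re_sum, ← map_sum, ht]
      have : ∀ k, tr η (star (F.p k) * (F.p k * h * F.p k)) = tr η (F.p k * h) := fun k => by
        rw [hFs, mul_assoc, ← mul_assoc (F.p k) (F.p k), hFi, ← mul_assoc,
          hT.tracial _ (mul_mem (hFN k) hhN) _ (hFN k), ← mul_assoc, hFi]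
      rw [map_sum]
      simp only [this]
      rw [← map_sum, ← Finset.sum_mul, F.sum, one_mul]
    have e3 : t ≤ ∑ k, nrm η (F.p k) * nrm η (F.p k * h * F.p k) := by
      rw [e2]
      exact Finset.sum_le_sum fun k _ => (Complex.re_le_norm _).trans (norm_tr_le η _ _)
    have e4 : ∑ k, nrm η (F.p k) ^ 2 = 1 := by
      simp only [← tr_star_mul_self_re, hFs, hFi]
      rw [← Complex.re_sum, ← map_sum, F.sum, hT.one, Complex.one_re]
    calc t ^ 2 ≤ (∑ k, nrm η (F.p k) * nrm η (F.p k * h * F.p k)) ^ 2 := by gcongr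
      _ ≤ (∑ k, nrm η (F.p k) ^ 2) * ∑ k, nrm η (F.p k * h * F.p k) ^ 2 :=
        Finset.sum_mul_sq_le_sq_mul_sq _ _ _
      _ = _ := by rw [e4, one_mul]
  obtain ⟨σ, w, hw, hw0, hσ, hEw, hwθ⟩ :=
    exists_intertwiner hM hE hT (star_mem hv) (c := t ^ 2) (by positivity) hlow
  replace hEw := hEw (by rw [hE.star, hEv, star_zero])
  have hwp : ∀ p ∈ A, IsStarProjection p → w * p = θ p * w := fun p hp hpp =>
    hwθ p hp _ (hθ p hp hpp).1 (hθ' p hp hpp)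
  have hwp' : ∀ p ∈ A, IsStarProjection p → p * star w = star w * θ p := fun p hp hpp => by
    simpa [hpp.isSelfAdjoint.star_eq, (hθ p hp hpp).2.1.isSelfAdjoint.star_eq] using
      congrArg star (hwp p hp hpp)
  have hpw' : ∀ p ∈ A, IsStarProjection p → star w * p = σ p * star w := fun p hp hpp => by
    simpa [hpp.isSelfAdjoint.star_eq, (hσ p hp hpp).2.1.isSelfAdjoint.star_eq] using
      congrArg star (hσ p hp hpp).2.2
  have hwaw : ∀ a ∈ A, w * a * star w ∈ A := fun a ha =>
    hM.mem_of_commute_projections (mul_mem (mul_mem hw (hM.le ha)) (star_mem hw)) fun p hp hpp => by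
      rw [mul_assoc, hpw' p hp hpp, ← mul_assoc, ← mul_assoc, ← mul_assoc, (hσ p hp hpp).2.2,
        mul_assoc w (σ p), hM.comm _ (hσ p hp hpp).1 _ ha, ← mul_assoc]
  have hwaw' : ∀ a ∈ A, star w * a * w ∈ A := fun a ha =>
    hM.mem_of_commute_projections (mul_mem (mul_mem (star_mem hw) (hM.le ha)) hw)
      fun p hp hpp => by
      rw [mul_assoc, hwp p hp hpp, ← mul_assoc, ← mul_assoc, ← mul_assoc, hwp' p hp hpp,
        mul_assoc (star w) (θ p), hM.comm _ (hθ p hp hpp).1 _ ha, ← mul_assoc]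
  have hwwA : star w * w ∈ A := by simpa using hwaw' 1 (one_mem A)
  obtain ⟨q, hqA, k, hkA, hq, hk, hq0, hkq, hkk⟩ := exists_local_inverse_sqrt hM.comm hwwA
    (star_mul_self_nonneg w) (by rwa [Ne, CStarRing.star_mul_self_eq_zero_iff])
  have hu : w * k ∈ A := by
    refine hS.mem_of_partial hM (mul_mem hw (hM.le hkA)) hqA ?_ ?_ ?_ ?_
    · rw [star_mul, hk.star_eq, ← hkk]; simp only [mul_assoc]
    · rw [mul_assoc, hkq]
    · intro a ha
      have : w * k * a * star (w * k) = w * (k * a * k) * star w := by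
        rw [star_mul, hk.star_eq]; simp only [mul_assoc]
      rw [this]
      exact hwaw _ (mul_mem (mul_mem hkA ha) hkA)
    · intro a ha
      have : star (w * k) * a * (w * k) = k * (star w * a * w) * k := by
        rw [star_mul, hk.star_eq]; simp only [mul_assoc]
      rw [this]
      exact mul_mem (mul_mem hkA (hwaw' a ha)) hkA
  have h0 : w * k = 0 := by
    rw [← hM.E_self hE hu, hM.E_right hE hkA, hEw, zero_mul]
  apply hq0
  rw [← hkk, mul_assoc, mul_assoc, h0, mul_zero, mul_zero]

end Singular

section Generated

variable {H : Type*} [NormedAddCommGroup H] [InnerProductSpace ℂ H] [CompleteSpace H]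

theorem star_centralizer_union (S : Set (H →L[ℂ] H)) :
    star (Set.centralizer (S ∪ star '' S)) = Set.centralizer (S ∪ star '' S) := by
  have h0 : star (S ∪ star '' S) = S ∪ star '' S := by
    rw [Set.image_star, Set.union_star, star_star, Set.union_comm]
  rw [Set.star_centralizer, h0]

theorem coe_centralizer_centralizer_union (S : Set (H →L[ℂ] H)) :
    ((StarSubalgebra.centralizer ℂ (Set.centralizer (S ∪ star '' S)) :
      StarSubalgebra ℂ (H →L[ℂ] H)) : Set (H →L[ℂ] H)) =
      Set.centralizer (Set.centralizer (S ∪ star '' S)) := by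
  rw [StarSubalgebra.coe_centralizer, star_centralizer_union, Set.union_self]

/-- The generated von Neumann algebra `vNgen S`, bundled. -/
def gen (S : Set (H →L[ℂ] H)) : VonNeumannAlgebra H where
  toStarSubalgebra := StarSubalgebra.centralizer ℂ (Set.centralizer (S ∪ star '' S))
  centralizer_centralizer' := by
    have h1 : (StarSubalgebra.centralizer ℂ (Set.centralizer (S ∪ star '' S))).carrier =
        Set.centralizer (Set.centralizer (S ∪ star '' S)) :=
      coe_centralizer_centralizer_union S
    rw [h1, Set.centralizer_centralizer_centralizer]

theorem coe_gen (S : Set (H →L[ℂ] H)) : (gen S : Set (H →L[ℂ] H)) = vNgen S :=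
  coe_centralizer_centralizer_union S

theorem mem_gen_iff {S : Set (H →L[ℂ] H)} {x : H →L[ℂ] H} :
    x ∈ gen S ↔ ∀ y, (∀ s ∈ S, s * y = y * s ∧ star s * y = y * star s) → y * x = x * y := by
  rw [← SetLike.mem_coe, coe_gen, vNgen, Set.mem_centralizer_iff]
  constructor
  · intro h y hy
    refine h y (Set.mem_centralizer_iff.2 ?_)
    rintro z (hz | ⟨s, hs, rfl⟩)
    exacts [(hy z hz).1, (hy s hs).2]
  · intro h y hy
    rw [Set.mem_centralizer_iff] at hy
    exact h y fun s hs => ⟨hy s (Or.inl hs), hy _ (Or.inr ⟨s, hs, rfl⟩)⟩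

theorem subset_gen {S : Set (H →L[ℂ] H)} {x : H →L[ℂ] H} (hx : x ∈ S) : x ∈ gen S :=
  mem_gen_iff.2 fun _ hy => (hy x hx).1.symm

theorem gen_le {S : Set (H →L[ℂ] H)} {N : VonNeumannAlgebra H} (h : ∀ x ∈ S, x ∈ N) :
    gen S ≤ N := fun x hx => mem_of_commute fun y hy =>
  (mem_gen_iff.1 hx y fun s hs =>
    ⟨commute_of_mem (h s hs) hy, commute_of_mem (star_mem (h s hs)) hy⟩).symm

theorem gen_comm {S : Set (H →L[ℂ] H)}
    (h : ∀ x ∈ S, ∀ y ∈ S, x * y = y * x ∧ star x * y = y * star x) :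
    ∀ x ∈ gen S, ∀ y ∈ gen S, x * y = y * x := by
  have h1 : ∀ x ∈ S, ∀ y ∈ gen S, x * y = y * x := by
    intro x hx y hy
    refine mem_gen_iff.1 hy x fun s hs => ⟨(h s hs x hx).1, (h s hs x hx).2⟩
  intro x hx y hy
  refine (mem_gen_iff.1 hx y fun s hs => ⟨h1 s hs y hy, ?_⟩).symm
  simpa using congrArg star (h1 s hs (star y) (star_mem hy)).symm

end Generated

section Factor

variable {H : Type*} [NormedAddCommGroup H] [InnerProductSpace ℂ H] [CompleteSpace H]
variable {N : VonNeumannAlgebra H}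

theorem starProjection_mem {K : Submodule ℂ H} [K.HasOrthogonalProjection]
    (h : ∀ y ∈ N.commutant, ∀ ξ ∈ K, y ξ ∈ K) : K.starProjection ∈ N := by
  have hs : IsStarProjection K.starProjection := isStarProjection_starProjection
  have key : ∀ y ∈ N.commutant, K.starProjection * y * K.starProjection = y * K.starProjection := by
    intro y hy
    ext ξ
    exact Submodule.starProjection_eq_self_iff.2 (h y hy _ (Submodule.starProjection_apply_mem _ _))
  refine mem_of_commute fun y hy => ?_
  have h1 := key y hy
  have h2 := congrArg star (key (star y) (star_mem hy))
  simp only [star_mul, star_star, hs.isSelfAdjoint.star_eq] at h2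
  rw [← h1, mul_assoc, h2]

theorem exists_mul_mul_ne_zero
    (hN : ∀ x ∈ N, (∀ y ∈ N, x * y = y * x) → ∃ c : ℂ, x = c • (1 : H →L[ℂ] H))
    {p q : H →L[ℂ] H} (hq : q ∈ N) (hp0 : p ≠ 0) (hq0 : q ≠ 0) :
    ∃ x ∈ N, p * x * q ≠ 0 := by
  by_contra! hcon
  set K0 : Submodule ℂ H := Submodule.span ℂ {v | ∃ x ∈ N, ∃ ζ, v = (x * q) ζ} with hK0
  set K := K0.topologicalClosure with hK
  have hinv : ∀ y : H →L[ℂ] H, (∀ x ∈ N, ∀ ζ, (y * (x * q)) ζ ∈ K0) → ∀ ξ ∈ K, y ξ ∈ K := by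
    intro y hy ξ hξ
    have h1 : K0 ≤ K.comap (y : H →ₗ[ℂ] H) := by
      rw [hK0, Submodule.span_le]
      rintro _ ⟨x, hx, ζ, rfl⟩
      exact K0.le_topologicalClosure (hy x hx ζ)
    have h2 : IsClosed ((K.comap (y : H →ₗ[ℂ] H) : Submodule ℂ H) : Set H) :=
      K0.isClosed_topologicalClosure.preimage y.continuous
    exact Submodule.topologicalClosure_minimal _ h1 h2 hξ
  have m1 : K.starProjection ∈ N := by
    refine starProjection_mem fun y hy => hinv y fun x hx ζ => ?_
    rw [← commute_of_mem (mul_mem hx hq) hy]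
    exact Submodule.subset_span ⟨x, hx, y ζ, rfl⟩
  have m2 : K.starProjection ∈ N.commutant := by
    refine starProjection_mem fun y hy => hinv y fun x hx ζ => ?_
    rw [VonNeumannAlgebra.commutant_commutant] at hy
    rw [← mul_assoc]
    exact Submodule.subset_span ⟨y * x, mul_mem hy hx, ζ, rfl⟩
  obtain ⟨c, hc⟩ := hN _ m1 fun y hy => (commute_of_mem hy m2).symm
  have e1 : K.starProjection * q = q := by
    ext ζ
    refine Submodule.starProjection_eq_self_iff.2 (K0.le_topologicalClosure ?_)
    exact Submodule.subset_span ⟨1, one_mem N, ζ, by simp⟩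
  have e2 : p * K.starProjection = 0 := by
    ext ξ
    have h2 : K ≤ LinearMap.ker (p : H →ₗ[ℂ] H) := by
      refine Submodule.topologicalClosure_minimal _ ?_ p.isClosed_ker
      rw [hK0, Submodule.span_le]
      rintro _ ⟨x, hx, ζ, rfl⟩
      exact congrArg (fun T : H →L[ℂ] H => T ζ) (hcon x hx)
    exact h2 (Submodule.starProjection_apply_mem _ _)
  rw [hc] at e1 e2
  simp only [smul_mul_assoc, one_mul, mul_smul_comm, mul_one, smul_eq_zero, hp0, or_false] at e1 e2
  rw [e2, zero_smul] at e1
  exact hq0 e1.symm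

/-- A nonzero element dominates a nonzero partial isometry. -/
theorem exists_partialIsometry {y : H →L[ℂ] H} (hy : y ∈ N) (h0 : y ≠ 0) :
    ∃ w ∈ N, w ≠ 0 ∧ w * star w * w = w ∧ (∀ f, f * y = y → f * w = w) ∧
      ∀ e, IsSelfAdjoint e → y * e = y → w * e = w := by
  set a := star y * y with ha
  have haN : a ∈ N := mul_mem (star_mem hy) hy
  have hapos : 0 ≤ a := star_mul_self_nonneg y
  have hne : a ≠ 0 := by
    intro h
    exact h0 (CStarRing.star_mul_self_eq_zero_iff y |>.1 h)
  have hsa : star a = a := hapos.isSelfAdjoint.star_eq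
  have hcomm : ∀ x ∈ gen {a}, ∀ z ∈ gen {a}, x * z = z * x := by
    refine gen_comm ?_
    rintro x rfl z rfl
    simp [hsa]
  obtain ⟨q, hq, k, hk, hqp, hksa, hq0, hkq, hkak⟩ :=
    exists_local_inverse_sqrt hcomm (subset_gen (Set.mem_singleton a)) hapos hne
  have hle : gen {a} ≤ N := gen_le (by rintro _ rfl; exact haN)
  have hww : star (y * k) * (y * k) = q := by
    rw [star_mul, hksa.star_eq, ← hkak, ha]
    noncomm_ring
  refine ⟨y * k, mul_mem hy (hle hk), ?_, ?_, ?_, ?_⟩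
  · intro h
    rw [h, mul_zero] at hww
    exact hq0 hww.symm
  · rw [mul_assoc, hww, mul_assoc, hkq]
  · intro f hf
    rw [← mul_assoc, hf]
  · intro e he hye
    have h1 : a * e = a := by rw [ha, mul_assoc, hye]
    have h2 : e * a = a := by simpa [hsa, he.star_eq] using congrArg star h1
    have h3 : e * k = k * e := by
      refine mem_gen_iff.1 hk e ?_
      rintro s rfl
      simp [hsa, h1, h2]
    rw [mul_assoc, ← h3, ← mul_assoc, hye]

/-- A set of partial isometries from `r` into `p` with orthogonal initial and final spaces. -/
structure IsIsoFamily (N : VonNeumannAlgebra H) (p r : H →L[ℂ] H) (S : Set (H →L[ℂ] H)) :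
    Prop where
  mem : ∀ v ∈ S, v ∈ N
  iso : ∀ v ∈ S, v * star v * v = v
  left : ∀ v ∈ S, p * v = v
  right : ∀ v ∈ S, v * r = v
  orth : ∀ v ∈ S, ∀ v' ∈ S, v ≠ v' → v * star v' = 0 ∧ star v * v' = 0

theorem isStarProjection_star_mul {v : H →L[ℂ] H} (h : v * star v * v = v) :
    IsStarProjection (star v * v) :=
  ⟨by rw [IsIdempotentElem, mul_assoc, ← mul_assoc v, h], IsSelfAdjoint.star_mul_self v⟩

theorem norm_le_one_of_partialIsometry {v : H →L[ℂ] H} (h : v * star v * v = v) : ‖v‖ ≤ 1 := by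
  have h1 : ‖star v * v‖ ≤ 1 := (isStarProjection_star_mul h).norm_le
  rw [CStarRing.norm_star_mul_self] at h1
  nlinarith [norm_nonneg v]

/-- Comparison of projections in a factor. -/
theorem exists_comparison
    (hN : ∀ x ∈ N, (∀ y ∈ N, x * y = y * x) → ∃ c : ℂ, x = c • (1 : H →L[ℂ] H))
    {p r : H →L[ℂ] H} (hp : p ∈ N) (hr : r ∈ N) (hpp : IsStarProjection p)
    (hrp : IsStarProjection r) :
    ∃ v ∈ N, v * star v * v = v ∧ p * v = v ∧ v * r = v ∧ (v * star v = p ∨ star v * v = r) := by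
  obtain ⟨S, hS⟩ : ∃ S, Maximal (IsIsoFamily N p r) S := by
    refine zorn_subset {S | IsIsoFamily N p r S} fun c hc hchain => ?_
    refine ⟨⋃₀ c, ⟨?_, ?_, ?_, ?_, ?_⟩, fun s hs => Set.subset_sUnion_of_mem hs⟩
    · rintro v ⟨s, hs, hv⟩
      exact (hc hs).mem v hv
    · rintro v ⟨s, hs, hv⟩
      exact (hc hs).iso v hv
    · rintro v ⟨s, hs, hv⟩
      exact (hc hs).left v hv
    · rintro v ⟨s, hs, hv⟩
      exact (hc hs).right v hv
    · rintro v ⟨s, hs, hv⟩ v' ⟨s', hs', hv'⟩ hne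
      rcases hchain.total hs hs' with h | h
      · exact (hc hs').orth v (h hv) v' hv' hne
      · exact (hc hs).orth v hv v' (h hv') hne
  have hF := hS.prop
  set f : Finset S → H →L[ℂ] H := fun F => ∑ v ∈ F, (v : H →L[ℂ] H) with hf
  have hl : ∀ (v : S) (F : Finset S), v ∈ F → star (v : H →L[ℂ] H) * f F = star (v : H →L[ℂ] H) * v := by
    intro v F hv
    rw [hf, Finset.mul_sum, Finset.sum_eq_single v]
    · intro b _ hb
      exact (hF.orth v v.2 b b.2 fun h => hb (Subtype.ext h.symm)).2
    · exact fun h => absurd hv h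
  have hr' : ∀ (v : S) (F : Finset S), v ∈ F → f F * star (v : H →L[ℂ] H) = v * star (v : H →L[ℂ] H) := by
    intro v F hv
    rw [hf, Finset.sum_mul, Finset.sum_eq_single v]
    · intro b _ hb
      exact (hF.orth b b.2 v v.2 fun h => hb (Subtype.ext h)).1
    · exact fun h => absurd hv h
  have hfiso : ∀ F, f F * star (f F) * f F = f F := by
    intro F
    have h1 : star (f F) * f F = ∑ v ∈ F, star (v : H →L[ℂ] H) * v := by
      conv_lhs => rw [hf]
      simp only [star_sum, Finset.sum_mul]
      exact Finset.sum_congr rfl fun v hv => hl v F hv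
    rw [mul_assoc, h1, Finset.mul_sum]
    refine Finset.sum_congr rfl fun v hv => ?_
    rw [← mul_assoc, hr' v F hv, hF.iso v v.2]
  obtain ⟨V, hV⟩ := WLim.exists_of_bounded (𝒰 := Ultrafilter.of (atTop : Filter (Finset S)))
    (f := f) fun F => norm_le_one_of_partialIsometry (hfiso F)
  have hle : (Ultrafilter.of (atTop : Filter (Finset S)) : Filter (Finset S)) ≤ atTop :=
    Ultrafilter.of_le _
  have hev : ∀ v : S, ∀ᶠ F in (Ultrafilter.of (atTop : Filter (Finset S)) : Filter (Finset S)),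
      v ∈ F := fun v => hle ((eventually_ge_atTop ({v} : Finset S)).mono fun F hF =>
        hF (Finset.mem_singleton_self v))
  have hVN : V ∈ N := hV.mem (Eventually.of_forall fun F => sum_mem fun v _ => hF.mem v v.2)
  have a1 : ∀ v : S, star (v : H →L[ℂ] H) * V = star (v : H →L[ℂ] H) * v := fun v =>
    (hV.mul_left _).unique ((WLim.const _).congr' ((hev v).mono fun F hv => (hl v F hv).symm))
  have a2 : ∀ v : S, V * star (v : H →L[ℂ] H) = v * star (v : H →L[ℂ] H) := fun v =>
    (hV.mul_right _).unique ((WLim.const _).congr' ((hev v).mono fun F hv => (hr' v F hv).symm))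
  have a3 : ∀ v : S, (v : H →L[ℂ] H) * star V * V = v := by
    intro v
    have := congrArg star (a2 v)
    simp only [star_mul, star_star] at this
    rw [this, mul_assoc, a1, ← mul_assoc, hF.iso v v.2]
  have a4 : ∀ v : S, V * star V * (v : H →L[ℂ] H) = v := by
    intro v
    have := congrArg star (a1 v)
    simp only [star_mul, star_star] at this
    rw [mul_assoc, this, ← mul_assoc, a2, hF.iso v v.2]
  have hViso : V * star V * V = V := by
    rw [mul_assoc]
    refine (hV.mul_right _).unique (hV.congr' (Eventually.of_forall fun F => ?_))
    simp only [hf, Finset.sum_mul]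
    exact Finset.sum_congr rfl fun v _ => by rw [← mul_assoc, a3]
  have hpV : p * V = V := by
    refine (hV.mul_left _).unique (hV.congr' (Eventually.of_forall fun F => ?_))
    simp only [hf, Finset.mul_sum]
    exact Finset.sum_congr rfl fun v _ => (hF.left v v.2).symm
  have hVr : V * r = V := by
    refine (hV.mul_right _).unique (hV.congr' (Eventually.of_forall fun F => ?_))
    simp only [hf, Finset.sum_mul]
    exact Finset.sum_congr rfl fun v _ => (hF.right v v.2).symm
  refine ⟨V, hVN, hViso, hpV, hVr, ?_⟩
  by_contra! hcon
  have hVp : star V * p = star V := by simpa [hpp.isSelfAdjoint.star_eq] using congrArg star hpV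
  have hrV : r * star V = star V := by simpa [hrp.isSelfAdjoint.star_eq] using congrArg star hVr
  have hVs : star V * (V * star V) = star V := by simpa [mul_assoc] using congrArg star hViso
  set e := r - star V * V with he
  set g := p - V * star V with hg
  have hee : e * e = e := by
    rw [he, sub_mul, mul_sub, mul_sub, hrp.isIdempotentElem.eq, ← mul_assoc r, hrV, mul_assoc _ V r,
      hVr, mul_assoc (star V) V, ← mul_assoc V, hViso]
    abel
  have hesa : IsSelfAdjoint e := hrp.isSelfAdjoint.sub (IsSelfAdjoint.star_mul_self V)
  have hgsa : IsSelfAdjoint g := hpp.isSelfAdjoint.sub (IsSelfAdjoint.mul_star_self V)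
  have hgg : g * g = g := by
    rw [hg, sub_mul, mul_sub, mul_sub, hpp.isIdempotentElem.eq, ← mul_assoc p, hpV,
      mul_assoc V (star V) p, hVp, mul_assoc V (star V) (V * star V), hVs]
    abel
  obtain ⟨x, hx, hx0⟩ := exists_mul_mul_ne_zero hN (p := g) (q := e)
    (sub_mem hr (mul_mem (star_mem hVN) hVN)) (sub_ne_zero.2 fun h => hcon.1 h.symm)
    (sub_ne_zero.2 fun h => hcon.2 h.symm)
  have hgN : g ∈ N := sub_mem hp (mul_mem hVN (star_mem hVN))
  have heN : e ∈ N := sub_mem hr (mul_mem (star_mem hVN) hVN)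
  obtain ⟨w, hw, hw0, hwi, hwl, hwr⟩ :=
    exists_partialIsometry (mul_mem (mul_mem hgN hx) heN) hx0
  have hgw : g * w = w := hwl g (by rw [← mul_assoc, ← mul_assoc, hgg])
  have hwe : w * e = w := hwr e hesa (by rw [mul_assoc, hee])
  have hpw : p * w = w := by
    rw [← hgw, ← mul_assoc, hg, mul_sub, hpp.isIdempotentElem.eq, ← mul_assoc, hpV]
  have hwr' : w * r = w := by
    rw [← hwe, mul_assoc, he, sub_mul, hrp.isIdempotentElem.eq, mul_assoc, hVr]
  have b1 : w * star V = 0 := by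
    rw [← hwe, mul_assoc, he, sub_mul, hrV, mul_assoc, hVs, sub_self, mul_zero]
  have b2 : star V * w = 0 := by
    rw [← hgw, ← mul_assoc, hg, mul_sub, hVp, hVs, sub_self, zero_mul]
  have c1 : ∀ v ∈ S, w * star v = 0 := by
    intro v hv
    have := congrArg star (a3 ⟨v, hv⟩)
    simp only [star_mul, star_star] at this
    rw [← this, ← mul_assoc, b1, zero_mul]
  have c2 : ∀ v ∈ S, star v * w = 0 := by
    intro v hv
    have := congrArg star (a4 ⟨v, hv⟩)
    simp only [star_mul, star_star] at this
    rw [← this, mul_assoc, mul_assoc, b2, mul_zero, mul_zero]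
  have hins : IsIsoFamily N p r (insert w S) := by
    refine ⟨?_, ?_, ?_, ?_, ?_⟩
    · rintro v (rfl | hv)
      exacts [hw, hF.mem v hv]
    · rintro v (rfl | hv)
      exacts [hwi, hF.iso v hv]
    · rintro v (rfl | hv)
      exacts [hpw, hF.left v hv]
    · rintro v (rfl | hv)
      exacts [hwr', hF.right v hv]
    · rintro v (rfl | hv) v' (rfl | hv') hne
      · exact absurd rfl hne
      · refine ⟨c1 v' hv', ?_⟩
        simpa using congrArg star (c2 v' hv')
      · refine ⟨?_, c2 v hv⟩
        simpa using congrArg star (c1 v hv)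
      · exact hF.orth v hv v' hv' hne
  have hwS : w ∈ S := hS.le_of_ge hins (Set.subset_insert w S) (Set.mem_insert w S)
  exact hw0 (by rw [← hwi, c1 w hwS, zero_mul])

end Factor

universe u

section RadonNikodym

theorem exists_hilbert_completion {E : Type u} [AddCommGroup E] [Module ℂ E]
    (c : PreInnerProductSpace.Core ℂ E) :
    ∃ (G : Type u) (_ : NormedAddCommGroup G) (_ : InnerProductSpace ℂ G) (_ : CompleteSpace G)
      (g : E →ₗ[ℂ] G), ∀ x y, ⟪g x, g y⟫_ℂ = c.inner x y := by
  let _ : SeminormedAddCommGroup E := InnerProductSpace.Core.toSeminormedAddCommGroup (c := c)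
  let _ : InnerProductSpace ℂ E := InnerProductSpace.ofCore c
  refine ⟨UniformSpace.Completion E, inferInstance, inferInstance, inferInstance,
    (UniformSpace.Completion.toComplL (𝕜 := ℂ) (E := E) : E →L[ℂ] _), fun x y => ?_⟩
  exact UniformSpace.Completion.inner_coe x y

variable {H : Type*} [NormedAddCommGroup H] [InnerProductSpace ℂ H] [CompleteSpace H]

theorem exists_radonNikodym_operator {E : Type u} [AddCommGroup E] [Module ℂ E]
    (c : PreInnerProductSpace.Core ℂ E) (e : E →ₗ[ℂ] H) (C : ℝ)
    (hC : ∀ x, (c.inner x x).re ≤ C ^ 2 * ‖e x‖ ^ 2) (hC0 : 0 ≤ C) :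
    ∃ h : H →L[ℂ] H, 0 ≤ h ∧ (∀ x y, ⟪e x, h (e y)⟫_ℂ = c.inner x y) ∧
      h * (LinearMap.range e).topologicalClosure.starProjection = h ∧
      (LinearMap.range e).topologicalClosure.starProjection * h = h := by
  obtain ⟨G, _, _, _, g, hg⟩ := exists_hilbert_completion c
  set K := (LinearMap.range e).topologicalClosure with hK
  let e' : E →ₗ[ℂ] K := e.codRestrict K fun x =>
    Submodule.le_topologicalClosure _ (LinearMap.mem_range_self e x)
  have hdense : DenseRange e' := by
    intro z
    rw [Metric.mem_closure_iff]
    intro ε hε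
    have hz : (z : H) ∈ closure (LinearMap.range e : Set H) := z.2
    obtain ⟨_, ⟨x, rfl⟩, hx⟩ := Metric.mem_closure_iff.1 hz ε hε
    exact ⟨e' x, ⟨x, rfl⟩, hx⟩
  have hnorm : ∃ C, ∀ x, ‖g x‖ ≤ C * ‖e' x‖ := by
    refine ⟨C, fun x => ?_⟩
    refine le_of_sq_le_sq ?_ (by positivity)
    have h1 : ‖g x‖ ^ 2 = (c.inner x x).re := by
      rw [← hg]
      exact (inner_self_eq_norm_sq (𝕜 := ℂ) (g x)).symm
    rw [h1, mul_pow]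
    exact hC x
  let T : H →L[ℂ] G := (g.extendOfNorm e').comp K.orthogonalProjectionOnto
  have hTP : T.comp K.starProjection = T := by
    ext ζ
    simp only [T, ContinuousLinearMap.comp_apply]
    congr 1
    exact Submodule.orthogonalProjectionOnto_mem_subspace_eq_self (K.orthogonalProjectionOnto ζ)
  have hTe : ∀ x, T (e x) = g x := by
    intro x
    have : K.orthogonalProjectionOnto (e x) = e' x :=
      Submodule.orthogonalProjectionOnto_mem_subspace_eq_self (e' x)
    simp only [T, ContinuousLinearMap.comp_apply, this]
    exact LinearMap.extendOfNorm_eq hdense hnorm x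
  have hP : star K.starProjection = K.starProjection :=
    (isStarProjection_starProjection (U := K)).isSelfAdjoint.star_eq
  have h2 : (adjoint T).comp T * K.starProjection = (adjoint T).comp T := by
    conv_rhs => rw [← hTP]
    conv_lhs => rw [← hTP]
    ext ζ
    simp only [mul_apply_eq_comp, ContinuousLinearMap.comp_apply]
    rw [Submodule.starProjection_eq_self_iff.2 (Submodule.starProjection_apply_mem _ _)]
  have h0 : 0 ≤ (adjoint T).comp T := by
    rw [nonneg_iff_isPositive]
    exact isPositive_adjoint_comp_self T
  refine ⟨(adjoint T).comp T, h0, fun x y => ?_, h2, ?_⟩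
  · rw [ContinuousLinearMap.comp_apply, adjoint_inner_right, hTe, hTe, hg]
  · simpa [hP, h0.isSelfAdjoint.star_eq] using congrArg star h2

end RadonNikodym

section Normal

variable {H : Type*} [NormedAddCommGroup H] [InnerProductSpace ℂ H] [CompleteSpace H]
variable {N : VonNeumannAlgebra H} {τ : (H →L[ℂ] H) → ℂ}

theorem exists_star_mul_self {x : H →L[ℂ] H} (hx : x ∈ N) (h0 : 0 ≤ x) :
    ∃ y ∈ N, star y = y ∧ star y * y = x := by
  have h1 : IsSelfAdjoint (CFC.sqrt x) := (CFC.sqrt_nonneg x).isSelfAdjoint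
  refine ⟨CFC.sqrt x, ?_, h1.star_eq, ?_⟩
  · rw [CFC.sqrt_eq_real_sqrt x h0, cfcₙ_eq_cfc]
    exact cfc_mem hx h0.isSelfAdjoint _
  · rw [h1.star_eq, CFC.sqrt_mul_sqrt_self x h0]

theorem conj_eq_zero {c d : H →L[ℂ] H} (h0 : 0 ≤ c) (h : star d * c * d = 0) : c * d = 0 := by
  have h1 : IsSelfAdjoint (CFC.sqrt c) := (CFC.sqrt_nonneg c).isSelfAdjoint
  have h2 : CFC.sqrt c * CFC.sqrt c = c := CFC.sqrt_mul_sqrt_self c h0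
  have h3 : star (CFC.sqrt c * d) * (CFC.sqrt c * d) = 0 := by
    rw [star_mul, h1.star_eq, mul_assoc, ← mul_assoc (CFC.sqrt c), h2, ← mul_assoc, h]
  rw [CStarRing.star_mul_self_eq_zero_iff] at h3
  rw [← h2, mul_assoc, h3, mul_zero]

namespace FTS

variable (hτ : IsFaithfulTracialState (N : Set (H →L[ℂ] H)) τ) {x y : H →L[ℂ] H}
include hτ

theorem map_zero : τ 0 = 0 := by
  have := hτ.map_smul 0 1 (one_mem N)
  simpa using this

theorem map_sub (hx : x ∈ N) (hy : y ∈ N) : τ (x - y) = τ x - τ y := by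
  have h1 := hτ.map_add x hx ((-1 : ℂ) • y) (smul_mem' _ hy)
  rw [hτ.map_smul (-1) y hy] at h1
  simpa [sub_eq_add_neg] using h1

theorem map_rsmul (c : ℝ) (hx : x ∈ N) : τ (c • x) = c * τ x := by
  rw [← hτ.map_smul (c : ℂ) x hx, Complex.coe_smul]

theorem map_sum {ι : Type*} (s : Finset ι) (f : ι → H →L[ℂ] H) (hf : ∀ i, f i ∈ N) :
    τ (∑ i ∈ s, f i) = ∑ i ∈ s, τ (f i) := by
  classical
  induction s using Finset.induction_on with
  | empty => simpa using map_zero hτ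
  | insert a s ha ih =>
    rw [Finset.sum_insert ha, Finset.sum_insert ha,
      hτ.map_add _ (hf a) _ (sum_mem fun i _ => hf i), ih]

theorem nonneg (hx : x ∈ N) (h0 : 0 ≤ x) : 0 ≤ τ x := by
  obtain ⟨y, hy, -, rfl⟩ := exists_star_mul_self hx h0
  exact hτ.nonneg y hy

theorem re_nonneg (hx : x ∈ N) (h0 : 0 ≤ x) : 0 ≤ (τ x).re :=
  (Complex.le_def.1 (nonneg hτ hx h0)).1

theorem re_mono (hx : x ∈ N) (hy : y ∈ N) (h : x ≤ y) : (τ x).re ≤ (τ y).re := by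
  have := re_nonneg hτ (sub_mem hy hx) (sub_nonneg.2 h)
  rw [map_sub hτ hy hx, Complex.sub_re] at this
  linarith

theorem map_star (hx : x ∈ N) : τ (star x) = starRingEnd ℂ (τ x) := by
  refine induction_contraction (N := N) (P := fun x => τ (star x) = starRingEnd ℂ (τ x))
    ?_ ?_ ?_ hx
  · intro x hx y hy h1 h2
    rw [star_add, hτ.map_add _ (star_mem hx) _ (star_mem hy), hτ.map_add _ hx _ hy, h1, h2,
      RingHom.map_add]
  · intro c x hx h1
    rw [star_smul, hτ.map_smul _ _ (star_mem hx), hτ.map_smul _ _ hx, h1, map_mul]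
    rfl
  · intro x hx h0 _
    have h1 := Complex.le_def.1 (nonneg hτ hx h0)
    rw [h0.isSelfAdjoint.star_eq]
    refine (Complex.conj_eq_iff_im.2 ?_).symm
    exact h1.2.symm

theorem pos_of_projection (hx : x ∈ N) (hp : IsStarProjection x) (h : x ≠ 0) : 0 < (τ x).re := by
  have e : star x * x = x := by rw [hp.isSelfAdjoint.star_eq, hp.isIdempotentElem.eq]
  have h1 := Complex.le_def.1 (hτ.nonneg x hx)
  rw [e] at h1
  refine lt_of_le_of_ne h1.1 fun h2 => h ?_
  refine hτ.faithful x hx ?_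
  rw [e]
  exact Complex.ext h2.symm h1.2.symm

theorem exists_decomposition
    (hN : ∀ x ∈ N, (∀ y ∈ N, x * y = y * x) → ∃ c : ℂ, x = c • (1 : H →L[ℂ] H))
    {p : H →L[ℂ] H} (hp : p ∈ N) (hpp : IsStarProjection p) (hp0 : p ≠ 0) :
    ∃ (n : ℕ) (v : Fin n → H →L[ℂ] H), (∀ i, v i ∈ N ∧ p * v i = v i) ∧
      ∑ i, star (v i) * v i = 1 := by
  have hpos := pos_of_projection hτ hp hpp hp0
  have key : ∀ (m : ℕ) (r : H →L[ℂ] H), r ∈ N → IsStarProjection r → (τ r).re < m * (τ p).re →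
      ∃ (n : ℕ) (v : Fin n → H →L[ℂ] H), (∀ i, v i ∈ N ∧ p * v i = v i) ∧
        ∑ i, star (v i) * v i = r := by
    intro m
    induction m with
    | zero =>
      intro r hr hrp h
      have := re_nonneg hτ hr (TensorMasa.IsStarProjection.nonneg' hrp)
      simp only [Nat.cast_zero, zero_mul] at h
      exact absurd h (not_lt.2 this)
    | succ m ih =>
      intro r hr hrp h
      obtain ⟨v, hv, hvi, hpv, hvr, hor⟩ := exists_comparison hN hp hr hpp hrp
      rcases hor with hor | hor
      · have hrv : r * star v = star v := by
          simpa [hrp.isSelfAdjoint.star_eq] using congrArg star hvr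
        have hvp := isStarProjection_star_mul hvi
        have hsub : IsStarProjection (r - star v * v) := by
          refine ⟨?_, hrp.isSelfAdjoint.sub hvp.isSelfAdjoint⟩
          rw [IsIdempotentElem, sub_mul, mul_sub, mul_sub, hrp.isIdempotentElem.eq, ← mul_assoc r,
            hrv, mul_assoc _ v r, hvr, hvp.isIdempotentElem.eq]
          abel
        have hvv : star v * v ∈ N := mul_mem (star_mem hv) hv
        have ht : τ (star v * v) = τ p := by
          rw [← hor, hτ.tracial _ (star_mem hv) _ hv]
        obtain ⟨n, w, hw, hsum⟩ := ih (r - star v * v) (sub_mem hr hvv) hsub (by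
          rw [map_sub hτ hr hvv, ht, Complex.sub_re]
          push_cast at h
          linarith)
        refine ⟨n + 1, Fin.cons v w, ?_, ?_⟩
        · intro i
          refine Fin.cases ⟨hv, hpv⟩ (fun j => ?_) i
          simpa using hw j
        · rw [Fin.sum_univ_succ]
          simp [hsum]
      · exact ⟨1, fun _ => v, fun _ => ⟨hv, hpv⟩, by simpa using hor⟩
  obtain ⟨m, hm⟩ := exists_nat_gt ((τ 1).re / (τ p).re)
  exact key m 1 (one_mem N) (.one _) ((div_lt_iff₀ hpos).1 hm)

theorem exists_dominated_projection {ξ : H} (hξ : ‖ξ‖ = 1) :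
    ∃ p ∈ N, IsStarProjection p ∧ p ≠ 0 ∧ ∀ q ∈ N, IsStarProjection q → q * p = q →
      (τ q).re ≤ 2 * (⟪ξ, q ξ⟫_ℂ).re := by
  by_contra! hcon
  let Q : Set (H →L[ℂ] H) → Prop := fun S =>
    (∀ q ∈ S, q ∈ N ∧ IsStarProjection q ∧ 2 * (⟪ξ, q ξ⟫_ℂ).re < (τ q).re) ∧
      ∀ q ∈ S, ∀ q' ∈ S, q ≠ q' → q * q' = 0
  obtain ⟨S, hS⟩ : ∃ S, Maximal Q S := by
    refine zorn_subset {S | Q S} fun c hc hchain => ?_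
    refine ⟨⋃₀ c, ⟨?_, ?_⟩, fun s hs => Set.subset_sUnion_of_mem hs⟩
    · rintro v ⟨s, hs, hv⟩
      exact (hc hs).1 v hv
    · rintro v ⟨s, hs, hv⟩ v' ⟨s', hs', hv'⟩ hne
      rcases hchain.total hs hs' with h | h
      · exact (hc hs').2 v (h hv) v' hv' hne
      · exact (hc hs).2 v hv v' (h hv') hne
  obtain ⟨hS1, hS2⟩ := hS.prop
  set f : Finset S → H →L[ℂ] H := fun F => ∑ v ∈ F, (v : H →L[ℂ] H) with hf
  have hl : ∀ (v : S) (F : Finset S), v ∈ F → (v : H →L[ℂ] H) * f F = v := by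
    intro v F hv
    rw [hf, Finset.mul_sum, Finset.sum_eq_single v]
    · exact (hS1 v v.2).2.1.isIdempotentElem.eq
    · intro b _ hb
      exact hS2 v v.2 b b.2 fun h => hb (Subtype.ext h.symm)
    · exact fun h => absurd hv h
  have hfp : ∀ F, IsStarProjection (f F) := by
    intro F
    refine ⟨?_, ?_⟩
    · rw [IsIdempotentElem]
      conv_lhs => enter [1]; rw [hf]
      rw [Finset.sum_mul]
      exact Finset.sum_congr rfl fun v hv => hl v F hv
    · rw [isSelfAdjoint_iff, hf, star_sum]
      exact Finset.sum_congr rfl fun v _ => (hS1 v v.2).2.1.isSelfAdjoint.star_eq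
  have hfN : ∀ F, f F ∈ N := fun F => sum_mem fun v _ => (hS1 v v.2).1
  obtain ⟨P, hP⟩ := WLim.exists_of_bounded (𝒰 := Ultrafilter.of (atTop : Filter (Finset S)))
    (f := f) fun F => (hfp F).norm_le
  have hle : (Ultrafilter.of (atTop : Filter (Finset S)) : Filter (Finset S)) ≤ atTop :=
    Ultrafilter.of_le _
  have hPN : P ∈ N := hP.mem (Eventually.of_forall hfN)
  have a1 : ∀ v : S, (v : H →L[ℂ] H) * P = v := fun v =>
    (hP.mul_left _).unique ((WLim.const _).congr'
      ((Eventually.filter_mono hle (eventually_ge_atTop ({v} : Finset S))).mono fun F hF =>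
        (hl v F (hF (Finset.mem_singleton_self v))).symm))
  have hP1 : P = 1 := by
    by_contra hne
    have hd : 1 - P ≠ 0 := sub_ne_zero.2 fun h => hne h.symm
    have hs := supp_isStarProjection (1 - P)
    obtain ⟨q, hq, hqp, hqs, hlt⟩ := hcon (supp (1 - P)) (supp_mem (sub_mem (one_mem N) hPN)) hs
      fun h => hd (supp_eq_zero_iff.1 h)
    have h1 : ∀ v ∈ S, v * q = 0 := by
      intro v hv
      have h2 : v * supp (1 - P) = 0 :=
        mul_supp_eq_zero (by rw [mul_sub, mul_one, a1 ⟨v, hv⟩, sub_self])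
      have h3 : supp (1 - P) * q = q := by
        simpa [hqp.isSelfAdjoint.star_eq, hs.isSelfAdjoint.star_eq] using congrArg star hqs
      rw [← h3, ← mul_assoc, h2, zero_mul]
    have hins : Q (insert q S) := by
      refine ⟨?_, ?_⟩
      · rintro v (rfl | hv)
        exacts [⟨hq, hqp, hlt⟩, hS1 v hv]
      · rintro v (rfl | hv) v' (rfl | hv') hne
        · exact absurd rfl hne
        · exact mul_eq_zero_comm (hS1 v' hv').2.1.isSelfAdjoint hqp.isSelfAdjoint (h1 v' hv')
        · exact h1 v hv
        · exact hS2 v hv v' hv' hne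
    have hqS : q ∈ S := hS.le_of_ge hins (Set.subset_insert q S) (Set.mem_insert q S)
    have hq0 : q = 0 := by rw [← hqp.isIdempotentElem.eq, h1 q hqS]
    rw [hq0, map_zero hτ] at hlt
    simp at hlt
  have hbound : ∀ F, (⟪ξ, f F ξ⟫_ℂ).re ≤ 2⁻¹ := by
    intro F
    have h1 : (τ (f F)).re ≤ 1 := by
      have := re_mono hτ (hfN F) (one_mem N) (hfp F).le_one
      rwa [hτ.map_one, Complex.one_re] at this
    have h2 : τ (f F) = ∑ v ∈ F, τ (v : H →L[ℂ] H) := map_sum hτ F _ fun v => (hS1 v v.2).1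
    have h3 : ⟪ξ, f F ξ⟫_ℂ = ∑ v ∈ F, ⟪ξ, (v : H →L[ℂ] H) ξ⟫_ℂ := by
      rw [hf, sum_apply, inner_sum]
    have h4 : 2 * (⟪ξ, f F ξ⟫_ℂ).re ≤ (τ (f F)).re := by
      rw [h2, h3, Complex.re_sum, Complex.re_sum, Finset.mul_sum]
      exact Finset.sum_le_sum fun v _ => (hS1 v v.2).2.2.le
    linarith
  have hlim : Tendsto (fun F => (⟪ξ, f F ξ⟫_ℂ).re)
      (Ultrafilter.of (atTop : Filter (Finset S)) : Filter (Finset S)) (𝓝 (⟪ξ, P ξ⟫_ℂ).re) :=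
    (Complex.continuous_re.tendsto _).comp (hP ξ ξ)
  have := le_of_tendsto' hlim hbound
  rw [hP1, one_apply_eq_self, inner_self_eq_norm_sq_to_K, hξ] at this
  norm_num at this

theorem dominated_of_projection {ξ : H} {p : H →L[ℂ] H} (hpp : IsStarProjection p)
    (h : ∀ q ∈ N, IsStarProjection q → q * p = q → (τ q).re ≤ 2 * (⟪ξ, q ξ⟫_ℂ).re)
    (hx : x ∈ N) (h0 : 0 ≤ x) (hxp : x * p = x) : (τ x).re ≤ 2 * (⟪ξ, x ξ⟫_ℂ).re := by
  classical
  let g : (H →L[ℂ] H) → ℝ := fun a =>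
    if a * p = a then max 0 ((τ a).re - 2 * (⟪ξ, a ξ⟫_ℂ).re) else 0
  have hφ : ∀ a : H →L[ℂ] H, 0 ≤ a → 0 ≤ (⟪ξ, a ξ⟫_ℂ).re := fun a ha =>
    (Complex.le_def.1 (((nonneg_iff_isPositive _).1 ha).inner_nonneg_right ξ)).1
  have key : ∀ a ∈ N, 0 ≤ a → a ≤ 1 → g a ≤ 0 := by
    intro a ha h0 h1
    refine le_zero_of_dyadic (N := N) g 1 ?_ ?_ ha h0 h1
    · intro a ha h0 h1
      have h2 := re_mono hτ ha (one_mem N) h1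
      rw [hτ.map_one, Complex.one_re] at h2
      have h3 := hφ a h0
      simp only [g]
      split_ifs
      · exact max_le zero_le_one (by linarith)
      · exact zero_le_one
    · intro s hs hsp a ha h0 _
      have hg0 : 0 ≤ g a := by
        simp only [g]
        split_ifs
        exacts [le_max_left _ _, le_rfl]
      by_cases hcond : ((2⁻¹ : ℝ) • s + (2⁻¹ : ℝ) • a) * p = (2⁻¹ : ℝ) • s + (2⁻¹ : ℝ) • a
      · have hd : (s + a) * (1 - p) = 0 := by
          rw [← smul_add, smul_mul_assoc] at hcond
          have := smul_right_injective (H →L[ℂ] H) (r := (2⁻¹ : ℝ)) (by norm_num) hcond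
          rw [mul_sub, mul_one, this, sub_self]
        have hst : star (1 - p) = 1 - p := by rw [star_sub, star_one, hpp.isSelfAdjoint.star_eq]
        have n1 : 0 ≤ star (1 - p) * s * (1 - p) := star_left_conjugate_nonneg (TensorMasa.IsStarProjection.nonneg' hsp) _
        have n2 : 0 ≤ star (1 - p) * a * (1 - p) := star_left_conjugate_nonneg h0 _
        have n3 : star (1 - p) * s * (1 - p) + star (1 - p) * a * (1 - p) = 0 := by
          rw [← add_mul, ← mul_add, mul_assoc, hd, mul_zero]
        have z1 := conj_eq_zero (TensorMasa.IsStarProjection.nonneg' hsp) ((add_eq_zero_iff_of_nonneg n1 n2).1 n3).1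
        have z2 := conj_eq_zero h0 ((add_eq_zero_iff_of_nonneg n1 n2).1 n3).2
        rw [mul_sub, mul_one, sub_eq_zero] at z1 z2
        have hsb := h s hs hsp z1.symm
        simp only [g]
        rw [if_pos hcond, if_pos z2.symm, hτ.map_add _ (rsmul_mem _ hs) _ (rsmul_mem _ ha),
          map_rsmul hτ _ hs, map_rsmul hτ _ ha]
        have e : (⟪ξ, ((2⁻¹ : ℝ) • s + (2⁻¹ : ℝ) • a) ξ⟫_ℂ).re =
            2⁻¹ * (⟪ξ, s ξ⟫_ℂ).re + 2⁻¹ * (⟪ξ, a ξ⟫_ℂ).re := by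
          rw [← Complex.coe_smul, ← Complex.coe_smul, add_apply,
            smul_apply, smul_apply, inner_add_right,
            inner_smul_right, inner_smul_right, Complex.add_re, Complex.re_ofReal_mul,
            Complex.re_ofReal_mul]
        rw [e, Complex.add_re, Complex.re_ofReal_mul, Complex.re_ofReal_mul]
        have hm := le_max_right 0 ((τ a).re - 2 * (⟪ξ, a ξ⟫_ℂ).re)
        have hm' := le_max_left 0 ((τ a).re - 2 * (⟪ξ, a ξ⟫_ℂ).re)
        refine max_le (by positivity) ?_
        linarith
      · have : g ((2⁻¹ : ℝ) • s + (2⁻¹ : ℝ) • a) = 0 := if_neg hcond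
        rw [this]
        positivity
  by_cases hx0 : x = 0
  · rw [hx0, map_zero hτ]; simp
  have hn : 0 < ‖x‖ := norm_pos_iff.2 hx0
  have h1 : 0 ≤ (‖x‖⁻¹ : ℝ) • x := smul_nonneg (by positivity) h0
  have h2 : (‖x‖⁻¹ : ℝ) • x ≤ 1 := by
    rw [← CStarAlgebra.norm_le_one_iff_of_nonneg _ h1, norm_smul]
    simp [hn.ne']
  have h3 := key _ (rsmul_mem _ hx) h1 h2
  simp only [g] at h3
  rw [if_pos (by rw [smul_mul_assoc, hxp]), map_rsmul hτ _ hx, ← Complex.coe_smul,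
    smul_apply, inner_smul_right, Complex.re_ofReal_mul,
    Complex.re_ofReal_mul] at h3
  have h4 := (le_max_right _ _).trans h3
  have h5 : ‖x‖⁻¹ * ((τ x).re - 2 * (⟪ξ, x ξ⟫_ℂ).re) ≤ 0 := by linarith
  have h6 := nonpos_of_mul_nonpos_right h5 (by positivity)
  linarith

end FTS

end Normal

section Normal

variable {H : Type*} [NormedAddCommGroup H] [InnerProductSpace ℂ H] [CompleteSpace H]
variable {N : VonNeumannAlgebra H} {τ : (H →L[ℂ] H) → ℂ}

namespace FTS

variable (hτ : IsFaithfulTracialState (N : Set (H →L[ℂ] H)) τ) {x y : H →L[ℂ] H}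
include hτ

/-- A trace dominated by a vector state on a corner is a vector state there. -/
theorem exists_vector {ξ : H} {p : H →L[ℂ] H} (hp : p ∈ N) (hpp : IsStarProjection p)
    (h : ∀ x ∈ N, 0 ≤ x → x * p = x → (τ x).re ≤ 2 * (⟪ξ, x ξ⟫_ℂ).re) :
    ∃ η : H, ∀ x ∈ N, τ (p * x * p) = ⟪η, x η⟫_ℂ := by
  have hps := hpp.isSelfAdjoint.star_eq
  let c : PreInnerProductSpace.Core ℂ N.toStarSubalgebra :=
    { inner := fun a b => τ (p * (star (a : H →L[ℂ] H) * b) * p)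
      conj_inner_symm := fun a b => by
        rw [← map_star hτ (mul_mem (mul_mem hp (mul_mem (star_mem b.2) a.2)) hp)]
        simp only [star_mul, star_star, hps, mul_assoc]
      re_inner_nonneg := fun a => by
        have h1 := (Complex.le_def.1 (hτ.nonneg _ (mul_mem a.2 hp))).1
        simp only [star_mul, hps, mul_assoc] at h1 ⊢
        exact h1
      add_left := fun a b d => by
        rw [← hτ.map_add _ (mul_mem (mul_mem hp (mul_mem (star_mem a.2) d.2)) hp) _
          (mul_mem (mul_mem hp (mul_mem (star_mem b.2) d.2)) hp)]
        congr 1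
        change p * (star ((a : H →L[ℂ] H) + b) * d) * p = _
        rw [star_add]
        noncomm_ring
      smul_left := fun a b r => by
        rw [← hτ.map_smul _ _ (mul_mem (mul_mem hp (mul_mem (star_mem a.2) b.2)) hp)]
        congr 1
        change p * (star (r • (a : H →L[ℂ] H)) * b) * p = _
        rw [star_smul]
        simp }
  let e : N.toStarSubalgebra →ₗ[ℂ] H :=
    { toFun := fun a => (a : H →L[ℂ] H) (p ξ)
      map_add' := fun a b => rfl
      map_smul' := fun r a => rfl }
  have hcore : ∀ a b, c.inner a b = τ (p * (star (a : H →L[ℂ] H) * b) * p) := fun a b => rfl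
  have hC : ∀ a, (c.inner a a).re ≤ (Real.sqrt 2) ^ 2 * ‖e a‖ ^ 2 := by
    intro a
    have h1 := h (star ((a : H →L[ℂ] H) * p) * (a * p))
      (mul_mem (star_mem (mul_mem a.2 hp)) (mul_mem a.2 hp)) (star_mul_self_nonneg _)
      (by rw [mul_assoc, mul_assoc, hpp.isIdempotentElem.eq])
    rw [mul_apply_eq_comp, star_eq_adjoint, adjoint_inner_right] at h1
    have h2 : (⟪((a : H →L[ℂ] H) * p) ξ, ((a : H →L[ℂ] H) * p) ξ⟫_ℂ).re = ‖e a‖ ^ 2 :=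
      inner_self_eq_norm_sq (𝕜 := ℂ) _
    rw [h2, ← star_eq_adjoint] at h1
    rw [Real.sq_sqrt (by norm_num), hcore]
    simpa only [star_mul, hps, mul_assoc] using h1
  obtain ⟨k, hk0, hk, hkP, hPk⟩ := exists_radonNikodym_operator c e _ hC (Real.sqrt_nonneg _)
  set K := (LinearMap.range e).topologicalClosure with hK
  have hPN : K.starProjection ∈ N.commutant := by
    refine starProjection_mem fun y hy => ?_
    rw [VonNeumannAlgebra.commutant_commutant] at hy
    have h1 : LinearMap.range e ≤ K.comap (y : H →ₗ[ℂ] H) := by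
      rintro _ ⟨a, rfl⟩
      exact Submodule.le_topologicalClosure _ ⟨⟨y * a, mul_mem hy a.2⟩, rfl⟩
    have h2 : IsClosed ((K.comap (y : H →ₗ[ℂ] H) : Submodule ℂ H) : Set H) :=
      (Submodule.isClosed_topologicalClosure _).preimage y.continuous
    exact fun ξ hξ => Submodule.topologicalClosure_minimal _ h1 h2 hξ
  have hkN : k ∈ N.commutant := by
    refine VonNeumannAlgebra.mem_commutant_iff.2 fun z hz => ?_
    have hzP : z * K.starProjection = K.starProjection * z := commute_of_mem hz hPN
    have hcl : ∀ ζ ∈ K, ∀ ζ' ∈ K, ⟪ζ, (z * k) ζ'⟫_ℂ = ⟪ζ, (k * z) ζ'⟫_ℂ := by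
      have h1 : ∀ a b, ⟪e a, (z * k) (e b)⟫_ℂ = ⟪e a, (k * z) (e b)⟫_ℂ := by
        intro a b
        rw [mul_apply_eq_comp, mul_apply_eq_comp, ← adjoint_inner_left]
        have e1 : adjoint z (e a) = e ⟨star z * a, mul_mem (star_mem hz) a.2⟩ := rfl
        have e2 : z (e b) = e ⟨z * b, mul_mem hz b.2⟩ := rfl
        rw [e1, e2, hk, hk, hcore, hcore]
        simp only [star_mul, star_star, mul_assoc]
      have h2 : ∀ a, ∀ ζ' ∈ K, ⟪e a, (z * k) ζ'⟫_ℂ = ⟪e a, (k * z) ζ'⟫_ℂ := by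
        intro a ζ' hζ'
        have : closure (LinearMap.range e : Set H) ⊆
            {ζ' | ⟪e a, (z * k) ζ'⟫_ℂ = ⟪e a, (k * z) ζ'⟫_ℂ} := by
          refine closure_minimal ?_ (isClosed_eq (by fun_prop) (by fun_prop))
          rintro _ ⟨b, rfl⟩
          exact h1 a b
        exact this hζ'
      intro ζ hζ ζ' hζ'
      have : closure (LinearMap.range e : Set H) ⊆
          {ζ | ⟪ζ, (z * k) ζ'⟫_ℂ = ⟪ζ, (k * z) ζ'⟫_ℂ} := by
        refine closure_minimal ?_ (isClosed_eq (by fun_prop) (by fun_prop))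
        rintro _ ⟨b, rfl⟩
        exact h2 b ζ' hζ'
      exact this hζ
    have hPs : star K.starProjection = K.starProjection :=
      (isStarProjection_starProjection (U := K)).isSelfAdjoint.star_eq
    have hP : K.starProjection * (z * k) * K.starProjection =
        K.starProjection * (k * z) * K.starProjection := by
      ext ζ'
      refine ext_inner_left ℂ fun ζ => ?_
      have := hcl (K.starProjection ζ) (Submodule.starProjection_apply_mem _ _)
        (K.starProjection ζ') (Submodule.starProjection_apply_mem _ _)
      have hin : ∀ w : H, ⟪K.starProjection ζ, w⟫_ℂ = ⟪ζ, K.starProjection w⟫_ℂ := by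
        intro w
        conv_lhs => rw [← hPs, star_eq_adjoint, adjoint_inner_left]
      rw [hin, hin] at this
      exact this
    rw [← mul_assoc, ← hzP, mul_assoc z, hPk, mul_assoc, hkP, ← mul_assoc, hPk, mul_assoc, hzP,
      ← mul_assoc, hkP] at hP
    exact hP
  obtain ⟨s, hs, hss, hsk⟩ := exists_star_mul_self hkN hk0
  refine ⟨s (p ξ), fun x hx => ?_⟩
  have h1 := hk ⟨1, one_mem N⟩ ⟨x, hx⟩
  rw [hcore] at h1
  simp only [star_one, one_mul] at h1
  rw [← h1, ← hsk]
  have h2 : s (x (p ξ)) = x (s (p ξ)) :=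
    congrArg (fun T : H →L[ℂ] H => T (p ξ)) (commute_of_mem hx hs).symm
  change ⟪p ξ, adjoint s (s (x (p ξ)))⟫_ℂ = _
  rw [adjoint_inner_right, h2]

/-- A faithful tracial state on a factor is a finite sum of vector functionals. -/
theorem exists_tr_eq
    (hN : ∀ x ∈ N, (∀ y ∈ N, x * y = y * x) → ∃ c : ℂ, x = c • (1 : H →L[ℂ] H)) :
    ∃ (n : ℕ) (η : Fin n → H), IsTrace N η ∧ ∀ x ∈ N, τ x = tr η x := by
  obtain ⟨ξ, hξ⟩ : ∃ ξ : H, ‖ξ‖ = 1 := by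
    have h1 : (1 : H →L[ℂ] H) ≠ 0 := by
      intro h
      have := hτ.map_one
      rw [h, map_zero hτ] at this
      exact zero_ne_one this
    obtain ⟨ζ, hζ⟩ : ∃ ζ : H, ζ ≠ 0 := by
      by_contra! h
      exact h1 (by ext ζ; simp [h ζ])
    exact ⟨((‖ζ‖⁻¹ : ℝ) : ℂ) • ζ, by simp [norm_smul, norm_ne_zero_iff.2 hζ]⟩
  obtain ⟨p, hp, hpp, hp0, hdom⟩ := exists_dominated_projection hτ hξ
  obtain ⟨η₀, hη⟩ := exists_vector hτ hp hpp fun x hx h0 hxp =>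
    dominated_of_projection hτ hpp hdom hx h0 hxp
  obtain ⟨n, v, hv, hsum⟩ := exists_decomposition hτ hN hp hpp hp0
  have heq : ∀ x ∈ N, τ x = tr (fun i => star (v i) η₀) x := by
    intro x hx
    rw [tr_apply]
    conv_lhs => rw [← one_mul x, ← hsum, Finset.sum_mul]
    rw [map_sum hτ _ _ fun i => mul_mem (mul_mem (star_mem (hv i).1) (hv i).1) hx]
    refine Finset.sum_congr rfl fun i _ => ?_
    have h1 : p * (v i * x * star (v i)) * p = v i * (x * star (v i)) := by
      have h2 : star (v i) * p = star (v i) := by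
        simpa [hpp.isSelfAdjoint.star_eq] using congrArg star (hv i).2
      rw [mul_assoc, mul_assoc, mul_assoc, h2, ← mul_assoc, (hv i).2]
    rw [mul_assoc, hτ.tracial _ (star_mem (hv i).1) _ (mul_mem (hv i).1 hx), mul_assoc, ← h1,
      hη _ (mul_mem (mul_mem (hv i).1 hx) (star_mem (hv i).1))]
    change ⟪η₀, v i (x (star (v i) η₀))⟫_ℂ = _
    rw [← adjoint_inner_left, ← star_eq_adjoint]
  refine ⟨n, _, ⟨fun x hx y hy => ?_, fun x hx h => ?_, ?_⟩, heq⟩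
  · rw [← heq _ (mul_mem hx hy), ← heq _ (mul_mem hy hx), hτ.tracial x hx y hy]
  · refine hτ.faithful x hx ?_
    rw [heq _ (mul_mem (star_mem hx) hx), tr_star_mul_self, h]
    simp
  · rw [← heq _ (one_mem N), hτ.map_one]

end FTS

end Normal

section Density

variable {H : Type*} [NormedAddCommGroup H] [InnerProductSpace ℂ H] [CompleteSpace H]
variable {N A : VonNeumannAlgebra H} {n : ℕ} {η : Fin n → H} {x : H →L[ℂ] H}

theorem commute_starProjection {V : Type*} [NormedAddCommGroup V] [InnerProductSpace ℂ V]
    [CompleteSpace V] {G : Submodule ℂ V} [G.HasOrthogonalProjection] {T : V →L[ℂ] V}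
    (h : ∀ v ∈ G, T v ∈ G) (h' : ∀ v ∈ G, star T v ∈ G) :
    T * G.starProjection = G.starProjection * T := by
  have key : ∀ T : V →L[ℂ] V, (∀ v ∈ G, T v ∈ G) →
      G.starProjection * T * G.starProjection = T * G.starProjection := fun T h => by
    ext v
    exact Submodule.starProjection_eq_self_iff.2 (h _ (Submodule.starProjection_apply_mem G v))
  have h1 := key T h
  have h2 := congrArg star (key _ h')
  have hs : star G.starProjection = G.starProjection :=
    (isStarProjection_starProjection (U := G)).isSelfAdjoint.star_eq
  simp only [star_mul, star_star, hs, ← mul_assoc] at h2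
  exact h1.symm.trans h2

/-- The diagonal amplification of an operator. -/
def amp (n : ℕ) (T : H →L[ℂ] H) :
    PiLp 2 (fun _ : Fin n => H) →L[ℂ] PiLp 2 (fun _ : Fin n => H) :=
  ∑ i, ((PiLp.continuousLinearEquiv 2 ℂ (fun _ : Fin n => H)).symm.toContinuousLinearMap ∘L
    ContinuousLinearMap.single ℂ (fun _ : Fin n => H) i) ∘L T ∘L
      PiLp.proj 2 (fun _ : Fin n => H) i

theorem amp_apply (T : H →L[ℂ] H) (v : PiLp 2 (fun _ : Fin n => H)) (i : Fin n) :
    amp n T v i = T (v i) := by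
  simp [amp, Finset.sum_apply, Pi.single_apply]

theorem amp_vec (T x : H →L[ℂ] H) : amp n T (vec η x) = vec η (T * x) := by
  ext i
  rw [amp_apply]
  rfl

theorem star_amp (T : H →L[ℂ] H) : star (amp n T) = amp n (star T) := by
  rw [star_eq_adjoint]
  symm
  rw [eq_adjoint_iff]
  intro v w
  simp [PiLp.inner_apply, amp_apply, star_eq_adjoint, adjoint_inner_left]

theorem commute_amp_of_mem_gen {S : Set (H →L[ℂ] H)} (hx : x ∈ gen S)
    {P : PiLp 2 (fun _ : Fin n => H) →L[ℂ] PiLp 2 (fun _ : Fin n => H)}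
    (h : ∀ s ∈ S, amp n s * P = P * amp n s) (h' : ∀ s ∈ S, amp n (star s) * P = P * amp n (star s)) :
    amp n x * P = P * amp n x := by
  classical
  let σ : Fin n → H →L[ℂ] PiLp 2 (fun _ : Fin n => H) := fun i =>
    (PiLp.continuousLinearEquiv 2 ℂ (fun _ : Fin n => H)).symm.toContinuousLinearMap ∘L
    ContinuousLinearMap.single ℂ (fun _ : Fin n => H) i
  let π : Fin n → PiLp 2 (fun _ : Fin n => H) →L[ℂ] H := fun i =>
    PiLp.proj 2 (fun _ : Fin n => H) i
  have hσ : ∀ (T : H →L[ℂ] H) i ζ, amp n T (σ i ζ) = σ i (T ζ) := fun T i ζ => by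
    ext j
    rw [amp_apply]
    by_cases hij : i = j <;> simp [σ, hij, eq_comm]
  have hsum : ∀ v, v = ∑ i, σ i (v i) := fun v => by
    ext j
    simp [σ, Finset.sum_apply, Pi.single_apply]
  have key : ∀ (T : H →L[ℂ] H), amp n T * P = P * amp n T ↔
      ∀ i j, T * (π i ∘L P ∘L σ j) = (π i ∘L P ∘L σ j) * T := by
    intro T
    constructor
    · intro hT i j
      ext ζ
      have : amp n T (P (σ j ζ)) i = P (amp n T (σ j ζ)) i := congrArg (fun Q => Q (σ j ζ) i) hT
      rwa [amp_apply, hσ] at this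
    · intro hT
      ext v : 1
      rw [hsum v, map_sum, map_sum]
      refine Finset.sum_congr rfl fun j _ => ?_
      ext i
      change amp n T (P (σ j (v j))) i = P (amp n T (σ j (v j))) i
      rw [amp_apply, hσ]
      exact congrArg (fun Q => Q (v j)) (hT i j)
  rw [key]
  intro i j
  refine (mem_gen_iff.1 hx _ fun s hs => ⟨(key s).1 (h s hs) i j, (key _).1 (h' s hs) i j⟩).symm

/-- A subspace containing `1` and stable under left multiplication by the generators is dense
in the 2-norm. -/
theorem exists_approx {S : Set (H →L[ℂ] H)} {K : Submodule ℂ (H →L[ℂ] H)} (h1 : 1 ∈ K)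
    (h : ∀ s ∈ S, ∀ k ∈ K, s * k ∈ K) (h' : ∀ s ∈ S, ∀ k ∈ K, star s * k ∈ K)
    (hx : x ∈ gen S) {ε : ℝ} (hε : 0 < ε) : ∃ k ∈ K, nrm η (x - k) < ε := by
  let G := (K.map (vec η)).topologicalClosure
  have hG : ∀ T : H →L[ℂ] H, (∀ k ∈ K, T * k ∈ K) → ∀ v ∈ G, amp n T v ∈ G := by
    intro T hT v hv
    refine map_mem_closure (amp n T).continuous hv ?_
    rintro _ ⟨k, hk, rfl⟩
    exact ⟨T * k, hT k hk, (amp_vec T k).symm⟩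
  have hGc : IsClosed (G : Set (PiLp 2 (fun _ : Fin n => H))) :=
    Submodule.isClosed_topologicalClosure _
  have : CompleteSpace G := hGc.completeSpace_coe
  have hc := commute_amp_of_mem_gen (n := n) (P := G.starProjection) hx
    (fun s hs => commute_starProjection (hG s (h s hs))
      (by rw [star_amp]; exact hG _ (h' s hs)))
    (fun s hs => commute_starProjection (hG _ (h' s hs))
      (by rw [star_amp, star_star]; exact hG s (h s hs)))
  have h2 : vec η x ∈ G := by
    have h3 : amp n x (G.starProjection (vec η 1)) = G.starProjection (amp n x (vec η 1)) :=
      congrArg (fun Q => Q (vec η 1)) hc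
    have h4 : G.starProjection (vec η 1) = vec η 1 :=
      Submodule.starProjection_eq_self_iff.2
        (Submodule.le_topologicalClosure _ ⟨1, h1, rfl⟩)
    rw [h4, amp_vec, mul_one] at h3
    exact Submodule.starProjection_eq_self_iff.1 h3.symm
  obtain ⟨_, ⟨k, hk, rfl⟩, hk'⟩ := Metric.mem_closure_iff.1 h2 ε hε
  exact ⟨k, hk, by rwa [dist_eq_norm, ← map_sub] at hk'⟩

/-- A von Neumann subalgebra is closed in the 2-norm. -/
theorem mem_of_approx (hT : IsTrace N η) (hAN : A ≤ N) (hx : x ∈ N)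
    (h : ∀ ε > 0, ∃ a ∈ A, nrm η (x - a) < ε) : x ∈ A := by
  let L : Submodule ℂ H := Submodule.span ℂ
    {ζ | ∃ y ∈ N.commutant, ∃ i, ζ = y (η i)}
  have hL : L.topologicalClosure = ⊤ := by
    have hc : IsClosed (L.topologicalClosure : Set H) := Submodule.isClosed_topologicalClosure _
    have : CompleteSpace L.topologicalClosure := hc.completeSpace_coe
    have hP : L.topologicalClosure.starProjection ∈ N := starProjection_mem fun y hy ξ hξ => by
      refine map_mem_closure y.continuous hξ fun ζ hζ => ?_
      induction hζ using Submodule.span_induction with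
      | mem ζ hζ =>
        obtain ⟨z, hz, i, rfl⟩ := hζ
        exact Submodule.subset_span ⟨y * z, mul_mem hy hz, i, rfl⟩
      | zero => simp
      | add a b _ _ ha hb => rw [map_add]; exact add_mem ha hb
      | smul c a _ ha => rw [map_smul]; exact Submodule.smul_mem _ c ha
    have h0 : 1 - L.topologicalClosure.starProjection = 0 := by
      refine hT.faithful _ (sub_mem (one_mem N) hP) ?_
      rw [nrm, norm_eq_zero]
      ext i
      have : L.topologicalClosure.starProjection (η i) = η i :=
        Submodule.starProjection_eq_self_iff.2 (Submodule.le_topologicalClosure _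
          (Submodule.subset_span ⟨1, one_mem _, i, rfl⟩))
      simp [vec, this]
    rw [eq_top_iff]
    intro ζ _
    have : ζ = L.topologicalClosure.starProjection ζ := congrArg (fun Q => Q ζ) (sub_eq_zero.1 h0)
    rw [this]
    exact Submodule.starProjection_apply_mem _ _
  obtain ⟨a, haA, ha⟩ : ∃ a : ℕ → H →L[ℂ] H, (∀ k, a k ∈ A) ∧
      Tendsto (fun k => nrm η (x - a k)) atTop (𝓝 0) := by
    choose a ha ha' using fun k : ℕ => h (1 / ((k : ℝ) + 1)) (by positivity)
    exact ⟨a, ha, squeeze_zero (fun k => nrm_nonneg _ _) (fun k => (ha' k).le)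
      tendsto_one_div_add_atTop_nhds_zero_nat⟩
  have hconv : ∀ i, Tendsto (fun k => a k (η i)) atTop (𝓝 (x (η i))) := fun i => by
    rw [tendsto_iff_norm_sub_tendsto_zero]
    refine squeeze_zero (fun k => norm_nonneg _) (fun k => ?_) ha
    rw [nrm, norm_sub_rev]
    exact PiLp.norm_apply_le (vec η (x - a k)) i
  have hconv' : ∀ i, Tendsto (fun k => star (a k) (η i)) atTop (𝓝 (star x (η i))) := fun i => by
    rw [tendsto_iff_norm_sub_tendsto_zero]
    refine squeeze_zero (fun k => norm_nonneg _) (fun k => ?_) ha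
    rw [← hT.nrm_star (sub_mem hx (hAN (haA k))), nrm, norm_sub_rev, star_sub]
    exact PiLp.norm_apply_le (vec η (star x - star (a k))) i
  have hcl : ∀ {T : H →L[ℂ] H}, (∀ ζ ∈ L, ∀ ξ ∈ L, ⟪ξ, T ζ⟫_ℂ = 0) → T = 0 := by
    intro T hT
    have hd : Dense (L : Set H) := by
      rwa [← Submodule.dense_iff_topologicalClosure_eq_top] at hL
    ext ζ
    refine hd.induction (P := fun ζ => T ζ = 0) (fun ζ hζ => ?_)
      (isClosed_eq T.continuous continuous_const) ζ
    have : ∀ ξ, ⟪ξ, T ζ⟫_ℂ = 0 := fun ξ =>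
      hd.induction (P := fun ξ => ⟪ξ, T ζ⟫_ℂ = 0) (fun ξ hξ => hT ζ hζ ξ hξ)
        (isClosed_eq (by fun_prop) continuous_const) ξ
    exact inner_self_eq_zero.1 (this _)
  refine mem_of_commute fun y hy => sub_eq_zero.1 (hcl ?_)
  have key : ∀ z ∈ N.commutant, ∀ i, ∀ w ∈ N.commutant, ∀ j,
      ⟪w (η j), (x * y - y * x) (z (η i))⟫_ℂ = 0 := by
    intro z hz i w hw j
    have h1 : ∀ t : H →L[ℂ] H, t ∈ N → ⟪w (η j), (t * y - y * t) (z (η i))⟫_ℂ =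
        ⟪w (star t (η j)), y (z (η i))⟫_ℂ - ⟪w (η j), y (z (t (η i)))⟫_ℂ := by
      intro t ht
      have e1 : z (t (η i)) = t (z (η i)) :=
        congrArg (fun Q => Q (η i)) (commute_of_mem ht hz).symm
      have e2 : w (star t (η j)) = star t (w (η j)) :=
        congrArg (fun Q => Q (η j)) (commute_of_mem (star_mem ht) hw).symm
      rw [e1, e2, sub_apply, inner_sub_right, star_eq_adjoint, adjoint_inner_left]
      rfl
    rw [h1 x hx]
    have h2 : Tendsto (fun k => ⟪w (star (a k) (η j)), y (z (η i))⟫_ℂ -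
        ⟪w (η j), y (z (a k (η i)))⟫_ℂ) atTop (𝓝 (⟪w (star x (η j)), y (z (η i))⟫_ℂ -
        ⟪w (η j), y (z (x (η i)))⟫_ℂ)) := by
      refine Tendsto.sub (Tendsto.inner ((w.continuous.tendsto _).comp (hconv' j))
        tendsto_const_nhds) (Tendsto.inner tendsto_const_nhds
        (((y * z).continuous.tendsto _).comp (hconv i)))
    refine tendsto_nhds_unique h2 (tendsto_const_nhds.congr fun k => ?_)
    rw [← h1 _ (hAN (haA k)), commute_of_mem (haA k) hy, sub_self, zero_apply, inner_zero_right]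
  intro ζ hζ ξ hξ
  induction hζ using Submodule.span_induction with
  | mem ζ hζ =>
    obtain ⟨z, hz, i, rfl⟩ := hζ
    induction hξ using Submodule.span_induction with
    | mem ξ hξ =>
      obtain ⟨w, hw, j, rfl⟩ := hξ
      exact key z hz i w hw j
    | zero => simp
    | add a b _ _ ha hb => rw [inner_add_left, ha, hb, add_zero]
    | smul c a _ ha => rw [inner_smul_left, ha, mul_zero]
  | zero => simp
  | add a b _ _ ha hb => rw [map_add, inner_add_right, ha, hb, add_zero]
  | smul c a _ ha => rw [map_smul, inner_smul_right, ha, mul_zero]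

end Density

section Mixing

variable {H : Type*} [NormedAddCommGroup H] [InnerProductSpace ℂ H] [CompleteSpace H]
variable {N A : VonNeumannAlgebra H} {n : ℕ} {η : Fin n → H}
variable {E : (H →L[ℂ] H) →ₗ[ℂ] (H →L[ℂ] H)} {x y a b c : H →L[ℂ] H}

theorem nrm_apply_le (hE : IsPinching A E) (hAN : A ≤ N) (hT : IsTrace N η) (hx : x ∈ N) :
    nrm η (E x) ≤ nrm η x := by
  have h1 : tr η (star (E x) * E x) = tr η (star (E x) * x) := by
    rw [← hE.left _ (star_mem (hE.mem_commutant x)),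
      hE.tr N n η hAN hT _ (mul_mem (star_mem (hE.mem N hAN x hx)) hx)]
  have h2 := norm_tr_le η (E x) x
  rw [← h1, tr_star_mul_self, Complex.norm_real, Real.norm_of_nonneg (by positivity)] at h2
  have h3 := nrm_nonneg η (E x)
  have h4 := nrm_nonneg η x
  by_contra h
  push Not at h
  nlinarith

theorem sum_nrm_sq_mul {ι : Type*} [Fintype ι] {p : ι → H →L[ℂ] H} (hp : OrthProj p)
    (h1 : ∑ i, p i = 1) (c : H →L[ℂ] H) : ∑ i, nrm η (p i * c) ^ 2 = nrm η c ^ 2 := by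
  have : ∀ i, nrm η (p i * c) ^ 2 = (tr η (star c * p i * c)).re := fun i => by
    rw [← tr_star_mul_self_re, star_mul, (hp.proj i).isSelfAdjoint.star_eq, mul_assoc,
      ← mul_assoc (p i), (hp.proj i).isIdempotentElem.eq, mul_assoc]
  simp only [this]
  rw [← Complex.re_sum, ← map_sum, ← Finset.sum_mul, ← Finset.mul_sum, h1, mul_one,
    tr_star_mul_self_re]

variable (hM : IsMasaIn N A) (hE : IsPinching A E) (hT : IsTrace N η)
include hM hE hT

theorem sum_nrm_le (ha : a ∈ N) (hc : c ∈ N) (F : Part A) :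
    ∑ k, nrm η (E (a * F.p k * c)) ^ 2 ≤ ‖a‖ ^ 2 * nrm η c ^ 2 := by
  rw [← sum_nrm_sq_mul F.orth F.sum c, Finset.mul_sum]
  refine Finset.sum_le_sum fun k _ => ?_
  rw [← mul_pow]
  refine pow_le_pow_left₀ (nrm_nonneg _ _) ?_ 2
  refine (hM.nrm_E_le hE hT (mul_mem (mul_mem ha (hM.le (F.mem k))) hc)).trans ?_
  rw [mul_assoc]
  exact nrm_mul_le η _ _

variable (hS : IsSingularIn N A) {𝒰 : Filter (Part A)} (h𝒰 : ∀ F, ∀ᶠ G in 𝒰, F ≤ G)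
include hS h𝒰

theorem tendsto_sum_mu (hx : x ∈ N) (hEx : E x = 0) :
    Tendsto (fun F : Part A => ∑ k, nrm η (E (star x * F.p k * x)) ^ 2) 𝒰 (𝓝 0) := by
  refine tendsto_order.2 ⟨fun r hr => Eventually.of_forall fun F =>
    hr.trans_le (Finset.sum_nonneg fun k _ => by positivity), fun r hr => ?_⟩
  obtain ⟨F, hF⟩ := IsSingularIn.exists_sum_lt hM hS hE hT hx hEx hr
  filter_upwards [h𝒰 F] with G hG
  refine lt_of_le_of_lt ?_ hF
  have := tr_mono η (sqSum_anti hM hE hx hG)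
  rwa [tr_sqSum hE, tr_sqSum hE] at this

theorem tendsto_sum_polar (hx : x ∈ N) (hEx : E x = 0) (hy : y ∈ N) (hEy : E y = 0) :
    Tendsto (fun F : Part A => ∑ k, nrm η (E (star x * F.p k * y)) ^ 2) 𝒰 (𝓝 0) := by
  have h : ∀ c : ℂ, Tendsto (fun F : Part A => ∑ k, nrm η (E (star (x + c • y) * F.p k *
      (x + c • y))) ^ 2) 𝒰 (𝓝 0) := fun c =>
    tendsto_sum_mu hM hE hT hS h𝒰 (add_mem hx (smul_mem' c hy)) (by simp [hEx, hEy])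
  have h0 := ((h 1).add (h (-1))).add ((h Complex.I).add (h (-Complex.I)))
  simp only [add_zero] at h0
  refine squeeze_zero (fun F => Finset.sum_nonneg fun k _ => by positivity) (fun F => ?_) h0
  simp only [← Finset.sum_add_distrib]
  refine Finset.sum_le_sum fun k _ => ?_
  set f : ℂ → H →L[ℂ] H := fun c => E (star (x + c • y) * F.p k * (x + c • y)) with hf
  have e : (4 : ℂ) • E (star x * F.p k * y) =
      (f 1 - f (-1)) - Complex.I • (f Complex.I - f (-Complex.I)) := by
    simp only [hf, ← map_sub, ← map_smul]
    congr 1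
    simp only [star_add, star_smul, add_mul, mul_add, smul_mul_assoc, mul_smul_comm, smul_sub,
      smul_add, smul_smul]
    simp only [RCLike.star_def, Complex.conj_I, map_neg, map_one]
    simp only [mul_neg, neg_mul, Complex.I_mul_I, neg_neg, mul_one]
    module
  have h4 : 4 * nrm η (E (star x * F.p k * y)) ≤
      nrm η (f 1) + nrm η (f (-1)) + (nrm η (f Complex.I) + nrm η (f (-Complex.I))) := by
    have e1 := congrArg (nrm η) e
    rw [nrm_smul] at e1
    have e2 := nrm_sub_le η (f 1 - f (-1)) (Complex.I • (f Complex.I - f (-Complex.I)))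
    rw [nrm_smul, Complex.norm_I, one_mul] at e2
    have e3 := nrm_sub_le η (f 1) (f (-1))
    have e4 := nrm_sub_le η (f Complex.I) (f (-Complex.I))
    norm_num at e1
    linarith
  have g0 := nrm_nonneg η (E (star x * F.p k * y))
  have := nrm_nonneg η (f 1)
  have := nrm_nonneg η (f (-1))
  have := nrm_nonneg η (f Complex.I)
  have := nrm_nonneg η (f (-Complex.I))
  change nrm η (E (star x * F.p k * y)) ^ 2 ≤ nrm η (f 1) ^ 2 + nrm η (f (-1)) ^ 2 +
    (nrm η (f Complex.I) ^ 2 + nrm η (f (-Complex.I)) ^ 2)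
  generalize nrm η (f 1) = r₁ at *
  generalize nrm η (f (-1)) = r₂ at *
  generalize nrm η (f Complex.I) = r₃ at *
  generalize nrm η (f (-Complex.I)) = r₄ at *
  generalize nrm η (E (star x * F.p k * y)) = r at *
  nlinarith [sq_nonneg (r₁ - r₂), sq_nonneg (r₃ - r₄), sq_nonneg (r₁ + r₂ - r₃ - r₄),
    sq_nonneg (r₁ - r₃), sq_nonneg (r₁ - r₄), sq_nonneg (r₂ - r₃), sq_nonneg (r₂ - r₄)]

theorem tendsto_sum_nrm (ha : a ∈ N) (hEa : E a = 0) (hc : c ∈ N) :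
    Tendsto (fun F : Part A => ∑ k, nrm η (E (a * F.p k * c)) ^ 2) 𝒰 (𝓝 0) := by
  have hEc := hM.E_mem hE hc
  have h := tendsto_sum_polar hM hE hT hS h𝒰 (star_mem ha) (by rw [hE.star, hEa, star_zero])
    (sub_mem hc (hM.le hEc)) (by rw [map_sub, hM.E_self hE hEc, sub_self])
  refine h.congr fun F => Finset.sum_congr rfl fun k _ => ?_
  rw [star_star, mul_sub, map_sub, hM.E_right hE hEc, hM.E_right hE (F.mem k), hEa, zero_mul,
    zero_mul, sub_zero]

end Mixing

section Tensor

variable {H : Type*} [NormedAddCommGroup H] [InnerProductSpace ℂ H] [CompleteSpace H]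
variable {N M₁ M₂ A₁ A₂ : VonNeumannAlgebra H} {n : ℕ} {η : Fin n → H}
variable {E E₁ E₂ : (H →L[ℂ] H) →ₗ[ℂ] (H →L[ℂ] H)} {x y a b c d w : H →L[ℂ] H}

/-- The span of the elementary tensors. -/
def elem (M₁ M₂ : VonNeumannAlgebra H) : Submodule ℂ (H →L[ℂ] H) :=
  Submodule.span ℂ {x | ∃ a ∈ M₁, ∃ b ∈ M₂, x = a * b}

theorem exists_elem_approx (hc : ∀ x ∈ M₁, ∀ y ∈ M₂, x * y = y * x)
    (hx : x ∈ gen ((M₁ : Set (H →L[ℂ] H)) ∪ M₂)) {ε : ℝ} (hε : 0 < ε) :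
    ∃ k ∈ elem M₁ M₂, nrm η (x - k) < ε := by
  have key : ∀ s, (s ∈ M₁ ∨ s ∈ M₂) → ∀ k ∈ elem M₁ M₂, s * k ∈ elem M₁ M₂ := by
    intro s hs k hk
    induction hk using Submodule.span_induction with
    | mem k hk =>
      obtain ⟨a, ha, b, hb, rfl⟩ := hk
      rcases hs with hs | hs
      · exact Submodule.subset_span ⟨s * a, mul_mem hs ha, b, hb, (mul_assoc _ _ _).symm⟩
      · refine Submodule.subset_span ⟨a, ha, s * b, mul_mem hs hb, ?_⟩
        rw [← mul_assoc, ← hc a ha s hs, mul_assoc]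
    | zero => rw [mul_zero]; exact zero_mem _
    | add u v _ _ hu hv => rw [mul_add]; exact add_mem hu hv
    | smul r u _ hu => rw [mul_smul_comm]; exact Submodule.smul_mem _ r hu
  refine exists_approx (K := elem M₁ M₂) (Submodule.subset_span ⟨1, one_mem _, 1, one_mem _, by simp⟩)
    (fun s hs => key s hs) (fun s hs => key _ ?_) hx hε
  exact hs.imp star_mem star_mem

/-- `N` is generated by commuting subalgebras on which the trace factorizes. -/
structure IsTensor (N M₁ M₂ : VonNeumannAlgebra H) (η : Fin n → H) : Prop where
  le₁ : M₁ ≤ N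
  le₂ : M₂ ≤ N
  comm : ∀ x ∈ M₁, ∀ y ∈ M₂, x * y = y * x
  tens : ∀ x ∈ M₁, ∀ y ∈ M₂, tr η (x * y) = tr η x * tr η y
  gen : N ≤ gen ((M₁ : Set (H →L[ℂ] H)) ∪ M₂)

/-- The algebra generated by two masas. -/
abbrev join (A₁ A₂ : VonNeumannAlgebra H) : VonNeumannAlgebra H :=
  gen ((A₁ : Set (H →L[ℂ] H)) ∪ A₂)

theorem left_le_join : A₁ ≤ join A₁ A₂ := fun _ hx => subset_gen (Or.inl hx)

theorem right_le_join : A₂ ≤ join A₁ A₂ := fun _ hx => subset_gen (Or.inr hx)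

namespace IsTensor

variable (hN : IsTensor N M₁ M₂ η)
include hN

theorem elem_mem (hx : x ∈ elem M₁ M₂) : x ∈ N := by
  induction hx using Submodule.span_induction with
  | mem k hk =>
    obtain ⟨a, ha, b, hb, rfl⟩ := hk
    exact mul_mem (hN.le₁ ha) (hN.le₂ hb)
  | zero => exact zero_mem _
  | add u v _ _ hu hv => exact add_mem hu hv
  | smul r u _ hu => exact smul_mem' r hu

theorem nrm_mul_sq (ha : a ∈ M₁) (hb : b ∈ M₂) :
    nrm η (a * b) ^ 2 = nrm η a ^ 2 * nrm η b ^ 2 := by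
  have h : star (a * b) * (a * b) = star a * a * (star b * b) := by
    rw [star_mul, mul_assoc, ← mul_assoc (star a), ← mul_assoc (star b),
      ← hN.comm _ (mul_mem (star_mem ha) ha) _ (star_mem hb), mul_assoc]
  rw [← tr_star_mul_self_re, h, hN.tens _ (mul_mem (star_mem ha) ha) _ (mul_mem (star_mem hb) hb),
    tr_star_mul_self, tr_star_mul_self, ← Complex.ofReal_mul, Complex.ofReal_re]

variable (h₁ : IsMasaIn M₁ A₁) (h₂ : IsMasaIn M₂ A₂) (hE₁ : IsPinching A₁ E₁)
  (hE₂ : IsPinching A₂ E₂) (hT : IsTrace N η)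
include h₁ h₂

theorem join_le : join A₁ A₂ ≤ N :=
  gen_le fun _ hx => hx.elim (fun h => hN.le₁ (h₁.le h)) fun h => hN.le₂ (h₂.le h)

theorem join_comm : ∀ x ∈ join A₁ A₂, ∀ y ∈ join A₁ A₂, x * y = y * x := by
  have key : ∀ x, (x ∈ A₁ ∨ x ∈ A₂) → ∀ y, (y ∈ A₁ ∨ y ∈ A₂) → x * y = y * x := by
    rintro x (hx | hx) y (hy | hy)
    · exact h₁.comm x hx y hy
    · exact hN.comm x (h₁.le hx) y (h₂.le hy)
    · exact (hN.comm y (h₁.le hy) x (h₂.le hx)).symm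
    · exact h₂.comm x hx y hy
  exact gen_comm fun x hx y hy => ⟨key x hx y hy, key _ (hx.imp star_mem star_mem) y hy⟩

theorem isMasaIn (hT : IsTrace N η) : IsMasaIn N (join A₁ A₂) := by
  obtain ⟨E₁, hE₁⟩ := exists_isPinching h₁.comm
  obtain ⟨E₂, hE₂⟩ := exists_isPinching h₂.comm
  have l₁ : A₁ ≤ N := h₁.le.trans hN.le₁
  have l₂ : A₂ ≤ N := h₂.le.trans hN.le₂
  refine ⟨hN.join_le h₁ h₂, hN.join_comm h₁ h₂, fun x hx hxA => ?_⟩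
  have fix : ∀ {B : VonNeumannAlgebra H} {F : (H →L[ℂ] H) →ₗ[ℂ] (H →L[ℂ] H)}, IsPinching B F →
      B ≤ join A₁ A₂ → F x = x := by
    intro B F hF hB
    have := hF.left x (VonNeumannAlgebra.mem_commutant_iff.2 fun g hg => (hxA g (hB hg)).symm) 1
    rwa [hF.one, mul_one] at this
  refine mem_of_approx hT (hN.join_le h₁ h₂) hx fun ε hε => ?_
  obtain ⟨k, hk, hk'⟩ := exists_elem_approx (η := η) hN.comm (hN.gen hx) hε
  refine ⟨E₂ (E₁ k), ?_, ?_⟩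
  · clear hk'
    induction hk using Submodule.span_induction with
    | mem k hk =>
      obtain ⟨a, ha, b, hb, rfl⟩ := hk
      have ea := h₁.E_mem hE₁ ha
      rw [hE₁.right b (VonNeumannAlgebra.mem_commutant_iff.2 fun g hg => hN.comm g (h₁.le hg) b hb),
        hE₂.left _ (VonNeumannAlgebra.mem_commutant_iff.2 fun g hg =>
          (hN.comm _ (h₁.le ea) g (h₂.le hg)).symm)]
      exact mul_mem (left_le_join ea) (right_le_join (h₂.E_mem hE₂ hb))
    | zero => simp
    | add u v _ _ hu hv => rw [map_add, map_add]; exact add_mem hu hv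
    | smul r u _ hu => rw [map_smul, map_smul]; exact smul_mem' r hu
  · have hs : x - k ∈ N := sub_mem hx (hN.elem_mem hk)
    have e : x - E₂ (E₁ k) = E₂ (E₁ (x - k)) := by
      rw [map_sub, map_sub, fix hE₁ left_le_join, fix hE₂ right_le_join]
    rw [e]
    exact ((nrm_apply_le hE₂ l₂ hT (hE₁.mem N l₁ _ hs)).trans (nrm_apply_le hE₁ l₁ hT hs)).trans_lt hk'

include hE₁ hE₂ hT

theorem E_mul (hE : IsPinching (join A₁ A₂) E) (ha : a ∈ M₁) (hb : b ∈ M₂) :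
    E (a * b) = E₁ a * E₂ b := by
  have hM := hN.isMasaIn h₁ h₂ hT
  have ea := h₁.E_mem hE₁ ha
  have eb := h₂.E_mem hE₂ hb
  have hab : E₁ a * E₂ b ∈ join A₁ A₂ := mul_mem (left_le_join ea) (right_le_join eb)
  have hz : a * b - E₁ a * E₂ b ∈ N := sub_mem (mul_mem (hN.le₁ ha) (hN.le₂ hb)) (hM.le hab)
  have hT₁ := hT.mono hN.le₁
  have hT₂ := hT.mono hN.le₂
  have key : ∀ k ∈ elem A₁ A₂, tr η (k * (a * b - E₁ a * E₂ b)) = 0 := by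
    intro k hk
    induction hk using Submodule.span_induction with
    | mem k hk =>
      obtain ⟨c, hc, d, hd, rfl⟩ := hk
      have h : ∀ u ∈ M₁, ∀ v ∈ M₂, tr η (c * d * (u * v)) = tr η (c * u) * tr η (d * v) := by
        intro u hu v hv
        rw [← hN.tens _ (mul_mem (h₁.le hc) hu) _ (mul_mem (h₂.le hd) hv), mul_assoc,
          ← mul_assoc d, ← hN.comm u hu d (h₂.le hd), mul_assoc, mul_assoc]
      rw [mul_sub, map_sub, h a ha b hb, h _ (h₁.le ea) _ (h₂.le eb), ← h₁.E_left hE₁ hc,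
        ← h₂.E_left hE₂ hd, hE₁.tr M₁ n η h₁.le hT₁ _ (mul_mem (h₁.le hc) ha),
        hE₂.tr M₂ n η h₂.le hT₂ _ (mul_mem (h₂.le hd) hb), sub_self]
    | zero => simp
    | add u v _ _ hu hv => rw [add_mul, map_add, hu, hv, add_zero]
    | smul r u _ hu => rw [smul_mul_assoc, map_smul, hu, smul_zero]
  have h0 := hM.eq_zero_of_tr_mul hE hT hz fun g hg => by
    rw [← norm_le_zero_iff]
    refine le_of_forall_pos_le_add fun ε hε => ?_
    set r := nrm η (a * b - E₁ a * E₂ b) with hr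
    have hr0 : 0 ≤ r := nrm_nonneg _ _
    obtain ⟨k, hk, hk'⟩ := exists_elem_approx (η := η) (M₁ := A₁) (M₂ := A₂)
      (fun u hu v hv => hN.comm u (h₁.le hu) v (h₂.le hv)) hg (ε := ε / (r + 1)) (by positivity)
    have hkN : k ∈ N := by
      refine (IsTensor.elem_mem (N := N) hN) (Submodule.span_mono ?_ hk)
      rintro _ ⟨u, hu, v, hv, rfl⟩
      exact ⟨u, h₁.le hu, v, h₂.le hv, rfl⟩
    have e : tr η (g * (a * b - E₁ a * E₂ b)) = tr η ((g - k) * (a * b - E₁ a * E₂ b)) := by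
      rw [sub_mul, map_sub, key k hk, sub_zero]
    have := norm_tr_le η (star (g - k)) (a * b - E₁ a * E₂ b)
    rw [star_star, hT.nrm_star (sub_mem (hM.le hg) hkN), ← e, ← hr] at this
    calc _ ≤ _ := this
      _ ≤ ε / (r + 1) * r := by gcongr
      _ ≤ 0 + ε := by
        rw [div_mul_eq_mul_div, div_le_iff₀ (by positivity)]
        nlinarith
  rwa [map_sub, hM.E_self hE hab, sub_eq_zero] at h0

end IsTensor

end Tensor

section TensorMixing

variable {H : Type*} [NormedAddCommGroup H] [InnerProductSpace ℂ H] [CompleteSpace H]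
variable {N M₁ M₂ A₁ A₂ : VonNeumannAlgebra H} {n : ℕ} {η : Fin n → H}
variable {E E₁ E₂ : (H →L[ℂ] H) →ₗ[ℂ] (H →L[ℂ] H)} {x y a b c d w : H →L[ℂ] H}

/-- The quantity `∑ ‖E (x (pₖ ⊗ rₗ) y)‖₂²`. -/
def mixSum (η : Fin n → H) (E : (H →L[ℂ] H) →ₗ[ℂ] (H →L[ℂ] H)) (x y : H →L[ℂ] H)
    (F : Part A₁ × Part A₂) : ℝ :=
  ∑ k : F.1.ι × F.2.ι, nrm η (E (x * (F.1.p k.1 * F.2.p k.2) * y)) ^ 2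

theorem mixSum_nonneg (F : Part A₁ × Part A₂) : 0 ≤ mixSum η E x y F :=
  Finset.sum_nonneg fun _ _ => sq_nonneg _

theorem nrm_add_sq_le (x y : H →L[ℂ] H) :
    nrm η (x + y) ^ 2 ≤ 2 * nrm η x ^ 2 + 2 * nrm η y ^ 2 := by
  have h := pow_le_pow_left₀ (nrm_nonneg η (x + y)) (nrm_add_le η x y) 2
  nlinarith [sq_nonneg (nrm η x - nrm η y)]

theorem mixSum_add_left_le (x x' y : H →L[ℂ] H) (F : Part A₁ × Part A₂) :
    mixSum η E (x + x') y F ≤ 2 * mixSum η E x y F + 2 * mixSum η E x' y F := by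
  simp only [mixSum, Finset.mul_sum, ← Finset.sum_add_distrib]
  refine Finset.sum_le_sum fun k _ => ?_
  rw [add_mul, add_mul, map_add]
  exact nrm_add_sq_le _ _

theorem mixSum_add_right_le (x y y' : H →L[ℂ] H) (F : Part A₁ × Part A₂) :
    mixSum η E x (y + y') F ≤ 2 * mixSum η E x y F + 2 * mixSum η E x y' F := by
  simp only [mixSum, Finset.mul_sum, ← Finset.sum_add_distrib]
  refine Finset.sum_le_sum fun k _ => ?_
  rw [mul_add, map_add]
  exact nrm_add_sq_le _ _

theorem mixSum_smul_left (r : ℂ) (x y : H →L[ℂ] H) (F : Part A₁ × Part A₂) :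
    mixSum η E (r • x) y F = ‖r‖ ^ 2 * mixSum η E x y F := by
  simp only [mixSum, Finset.mul_sum]
  refine Finset.sum_congr rfl fun k _ => ?_
  rw [smul_mul_assoc, smul_mul_assoc, map_smul, nrm_smul, mul_pow]

theorem mixSum_smul_right (r : ℂ) (x y : H →L[ℂ] H) (F : Part A₁ × Part A₂) :
    mixSum η E x (r • y) F = ‖r‖ ^ 2 * mixSum η E x y F := by
  simp only [mixSum, Finset.mul_sum]
  refine Finset.sum_congr rfl fun k _ => ?_
  rw [mul_smul_comm, map_smul, nrm_smul, mul_pow]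

/-- The span of the elementary tensors with a centered leg. -/
def centered (M₁ M₂ : VonNeumannAlgebra H) (E₁ E₂ : (H →L[ℂ] H) →ₗ[ℂ] (H →L[ℂ] H)) :
    Submodule ℂ (H →L[ℂ] H) :=
  Submodule.span ℂ {x | ∃ a ∈ M₁, ∃ b ∈ M₂, (E₁ a = 0 ∨ E₂ b = 0) ∧ x = a * b}

theorem centered_le : centered M₁ M₂ E₁ E₂ ≤ elem M₁ M₂ :=
  Submodule.span_mono fun _ ⟨a, ha, b, hb, _, h⟩ => ⟨a, ha, b, hb, h⟩

namespace IsTensor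

variable (hN : IsTensor N M₁ M₂ η)
  (h₁ : IsMasaIn M₁ A₁) (h₂ : IsMasaIn M₂ A₂) (hE₁ : IsPinching A₁ E₁)
  (hE₂ : IsPinching A₂ E₂) (hE : IsPinching (join A₁ A₂) E) (hT : IsTrace N η)
include hN h₁ h₂ hE₁ hE₂ hE hT

theorem mixSum_mul (ha : a ∈ M₁) (hb : b ∈ M₂) (hc : c ∈ M₁) (hd : d ∈ M₂)
    (F : Part A₁ × Part A₂) : mixSum η E (a * b) (c * d) F =
      (∑ k, nrm η (E₁ (a * F.1.p k * c)) ^ 2) * ∑ l, nrm η (E₂ (b * F.2.p l * d)) ^ 2 := by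
  rw [mixSum, Fintype.sum_prod_type, Finset.sum_mul_sum]
  refine Finset.sum_congr rfl fun k _ => Finset.sum_congr rfl fun l _ => ?_
  have hp := h₁.le (F.1.mem k)
  have hr := h₂.le (F.2.mem l)
  have e : a * b * (F.1.p k * F.2.p l) * (c * d) = a * F.1.p k * c * (b * F.2.p l * d) := by
    calc a * b * (F.1.p k * F.2.p l) * (c * d)
        = a * (b * F.1.p k) * (F.2.p l * c) * d := by simp only [mul_assoc]
      _ = a * (F.1.p k * b) * (c * F.2.p l) * d := by
        rw [hN.comm _ hp _ hb, hN.comm _ hc _ hr]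
      _ = a * F.1.p k * (b * c) * F.2.p l * d := by simp only [mul_assoc]
      _ = a * F.1.p k * (c * b) * F.2.p l * d := by rw [hN.comm _ hc _ hb]
      _ = _ := by simp only [mul_assoc]
  have m₁ := mul_mem (mul_mem ha hp) hc
  have m₂ := mul_mem (mul_mem hb hr) hd
  rw [e, hN.E_mul h₁ h₂ hE₁ hE₂ hT hE m₁ m₂,
    hN.nrm_mul_sq (h₁.le (h₁.E_mem hE₁ m₁)) (h₂.le (h₂.E_mem hE₂ m₂))]

theorem exists_centered_approx (hx : x ∈ N) (hEx : E x = 0) {ε : ℝ} (hε : 0 < ε) :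
    ∃ k ∈ centered M₁ M₂ E₁ E₂, nrm η (x - k) < ε := by
  obtain ⟨k, hk, hk'⟩ := exists_elem_approx (η := η) hN.comm (hN.gen hx) (half_pos hε)
  have hkN := hN.elem_mem hk
  refine ⟨k - E k, ?_, ?_⟩
  · clear hk' hkN
    induction hk using Submodule.span_induction with
    | mem k hk =>
      obtain ⟨a, ha, b, hb, rfl⟩ := hk
      have ea := h₁.E_mem hE₁ ha
      have eb := h₂.E_mem hE₂ hb
      rw [hN.E_mul h₁ h₂ hE₁ hE₂ hT hE ha hb]
      have e : a * b - E₁ a * E₂ b = (a - E₁ a) * b + E₁ a * (b - E₂ b) := by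
        rw [sub_mul, mul_sub]; abel
      rw [e]
      refine add_mem (Submodule.subset_span ⟨_, sub_mem ha (h₁.le ea), b, hb, Or.inl ?_, rfl⟩)
        (Submodule.subset_span ⟨_, h₁.le ea, _, sub_mem hb (h₂.le eb), Or.inr ?_, rfl⟩)
      · rw [map_sub, h₁.E_self hE₁ ea, sub_self]
      · rw [map_sub, h₂.E_self hE₂ eb, sub_self]
    | zero => simp
    | add u v _ _ hu hv =>
      rw [map_add, add_sub_add_comm]; exact add_mem hu hv
    | smul r u _ hu => rw [map_smul, ← smul_sub]; exact Submodule.smul_mem _ r hu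
  · have e : x - (k - E k) = (x - k) - E (x - k) := by rw [map_sub, hEx]; abel
    have h1 := (hN.isMasaIn h₁ h₂ hT).nrm_E_le hE hT (sub_mem hx hkN)
    have h2 := nrm_sub_le η (x - k) (E (x - k))
    rw [e]
    linarith

variable (hS₁ : IsSingularIn M₁ A₁) (hS₂ : IsSingularIn M₂ A₂)
  {𝒰₁ : Filter (Part A₁)} (h𝒰₁ : ∀ F, ∀ᶠ G in 𝒰₁, F ≤ G)
  {𝒰₂ : Filter (Part A₂)} (h𝒰₂ : ∀ F, ∀ᶠ G in 𝒰₂, F ≤ G)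
include hS₁ hS₂ h𝒰₁ h𝒰₂

theorem tendsto_mixSum (hx : x ∈ centered M₁ M₂ E₁ E₂) (hy : y ∈ elem M₁ M₂) :
    Tendsto (fun F : Part A₁ × Part A₂ => mixSum η E x y F) (𝒰₁ ×ˢ 𝒰₂) (𝓝 0) := by
  have hT₁ := hT.mono hN.le₁
  have hT₂ := hT.mono hN.le₂
  induction hx using Submodule.span_induction with
  | mem x hx =>
    obtain ⟨a, ha, b, hb, hab, rfl⟩ := hx
    induction hy using Submodule.span_induction with
    | mem y hy =>
      obtain ⟨c, hc, d, hd, rfl⟩ := hy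
      simp only [hN.mixSum_mul h₁ h₂ hE₁ hE₂ hE hT ha hb hc hd]
      rcases hab with h0 | h0
      · have h := ((tendsto_sum_nrm h₁ hE₁ hT₁ hS₁ h𝒰₁ ha h0 hc).comp
          (tendsto_fst (f := 𝒰₁) (g := 𝒰₂))).mul_const (‖b‖ ^ 2 * nrm η d ^ 2)
        rw [zero_mul] at h
        refine squeeze_zero (fun F => by positivity) (fun F => ?_) h
        exact mul_le_mul_of_nonneg_left (sum_nrm_le h₂ hE₂ hT₂ hb hd F.2) (by positivity)
      · have h := ((tendsto_sum_nrm h₂ hE₂ hT₂ hS₂ h𝒰₂ hb h0 hd).comp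
          (tendsto_snd (f := 𝒰₁) (g := 𝒰₂))).const_mul (‖a‖ ^ 2 * nrm η c ^ 2)
        rw [mul_zero] at h
        refine squeeze_zero (fun F => by positivity) (fun F => ?_) h
        exact mul_le_mul_of_nonneg_right (sum_nrm_le h₁ hE₁ hT₁ ha hc F.1) (by positivity)
    | zero => simpa [mixSum, nrm_zero] using tendsto_const_nhds
    | add u v _ _ hu hv =>
      have h := (hu.const_mul 2).add (hv.const_mul 2)
      simp only [mul_zero, add_zero] at h
      exact squeeze_zero (fun F => mixSum_nonneg F) (fun F => mixSum_add_right_le _ _ _ F) h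
    | smul r u _ hu =>
      simp only [mixSum_smul_right]
      simpa using hu.const_mul (‖r‖ ^ 2)
  | zero => simpa [mixSum, nrm_zero] using tendsto_const_nhds
  | add u v _ _ hu hv =>
    have h := (hu.const_mul 2).add (hv.const_mul 2)
    simp only [mul_zero, add_zero] at h
    exact squeeze_zero (fun F => mixSum_nonneg F) (fun F => mixSum_add_left_le _ _ _ F) h
  | smul r u _ hu =>
    simp only [mixSum_smul_left]
    simpa using hu.const_mul (‖r‖ ^ 2)

omit hE₁ hE₂ hE h𝒰₁ h𝒰₂ in
/-- Normalizing unitaries of a tensor product of singular masas belong to it. -/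
theorem mem_of_normalizes (hw : w ∈ N) (hw1 : star w * w = 1) (hw2 : w * star w = 1)
    (hwA : ∀ p ∈ join A₁ A₂, w * p * star w ∈ join A₁ A₂) : w ∈ join A₁ A₂ := by
  have hM := hN.isMasaIn h₁ h₂ hT
  obtain ⟨E₁, hE₁⟩ := exists_isPinching h₁.comm
  obtain ⟨E₂, hE₂⟩ := exists_isPinching h₂.comm
  obtain ⟨E, hE⟩ := exists_isPinching hM.comm
  obtain ⟨𝒰₁, h𝒰₁⟩ := Part.exists_ultrafilter h₁.comm
  obtain ⟨𝒰₂, h𝒰₂⟩ := Part.exists_ultrafilter h₂.comm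
  have hEw := hM.E_mem hE hw
  have hx : w - E w ∈ N := sub_mem hw (hM.le hEw)
  have hEx : E (w - E w) = 0 := by rw [map_sub, hM.E_self hE hEw, sub_self]
  have hsw : star w ∈ N := star_mem hw
  have hnw : nrm η w = 1 := by
    have := tr_star_mul_self_re η w
    rw [hw1, hT.one, Complex.one_re] at this
    nlinarith [nrm_nonneg η w]
  have hx2 : tr η (star (w - E w) * (w - E w)) = tr η ((w - E w) * star w) := by
    rw [star_sub, sub_mul, map_sub, ← hE.tr N n η hM.le hT (star (E w) * (w - E w))
      (mul_mem (star_mem (hM.le hEw)) hx), hM.E_left hE (star_mem hEw), hEx, mul_zero, map_zero,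
      sub_zero, hT.tracial _ hsw _ hx]
  have key : nrm η (w - E w) ^ 2 ≤ 0 := by
    rw [← tr_star_mul_self_re, hx2]
    generalize hxw : w - E w = x at *
    refine (Complex.re_le_norm _).trans (le_of_forall_pos_le_add fun ε hε => ?_)
    rw [zero_add]
    obtain ⟨x', hx', hxx'⟩ := hN.exists_centered_approx h₁ h₂ hE₁ hE₂ hE hT hx hEx
      (show 0 < ε / 3 by positivity)
    have hx'N := hN.elem_mem (centered_le hx')
    obtain ⟨y, hy, hwy⟩ := exists_elem_approx (η := η) hN.comm (hN.gen hsw)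
      (show 0 < ε / 3 / (‖x'‖ + 1) by positivity)
    have hyN := hN.elem_mem hy
    obtain ⟨F, hF⟩ := (((hN.tendsto_mixSum h₁ h₂ hE₁ hE₂ hE hT hS₁ hS₂ h𝒰₁ h𝒰₂ hx' hy).eventually
      (gt_mem_nhds (show (0 : ℝ) < (ε / 3) ^ 2 by positivity)))).exists
    let p : F.1.ι × F.2.ι → H →L[ℂ] H := fun k => F.1.p k.1 * F.2.p k.2
    have hpA : ∀ k, p k ∈ join A₁ A₂ := fun k =>
      mul_mem (left_le_join (F.1.mem _)) (right_le_join (F.2.mem _))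
    have hp1 : ∑ k, p k = 1 := by
      simp only [p, Fintype.sum_prod_type, ← Finset.mul_sum, F.2.sum, mul_one, F.1.sum]
    have hc := hN.join_comm h₁ h₂
    have hp : OrthProj p := by
      constructor
      · exact fun k => (F.1.orth.proj _).mul (F.2.orth.proj _)
          (hc _ (left_le_join (F.1.mem _)) _ (right_le_join (F.2.mem _)))
      · rintro ⟨i, j⟩ ⟨k, l⟩ h
        have e : p (i, j) * p (k, l) = F.1.p i * F.1.p k * (F.2.p j * F.2.p l) := by
          simp only [p]
          rw [mul_assoc, ← mul_assoc (F.2.p j), ← hc _ (left_le_join (F.1.mem k)) _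
            (right_le_join (F.2.mem j))]
          simp only [mul_assoc]
        rw [e]
        by_cases hik : i = k
        · rw [F.2.orth.orth j l (fun hjl => h (by rw [hik, hjl])), mul_zero]
        · rw [F.1.orth.orth i k hik, zero_mul]
    let q : F.1.ι × F.2.ι → H →L[ℂ] H := fun k => w * p k * star w
    have hqA : ∀ k, q k ∈ join A₁ A₂ := fun k => hwA _ (hpA k)
    have hqq : ∀ k l, q k * q l = w * (p k * p l) * star w := fun k l => by
      calc q k * q l = w * p k * (star w * w) * p l * star w := by simp only [q, mul_assoc]
        _ = _ := by rw [hw1, mul_one, mul_assoc w]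
    have hq : OrthProj q := by
      constructor
      · intro k
        refine ⟨?_, ?_⟩
        · rw [IsIdempotentElem, hqq, (hp.proj k).isIdempotentElem.eq]
        · rw [isSelfAdjoint_iff]
          simp only [q, star_mul, star_star, (hp.proj k).isSelfAdjoint.star_eq, mul_assoc]
      · intro k l hkl
        rw [hqq, hp.orth k l hkl, mul_zero, zero_mul]
    have hq1 : ∑ k, q k = 1 := by
      simp only [q]
      rw [← Finset.sum_mul, ← Finset.mul_sum, hp1, mul_one, hw2]
    have hNp := fun k => hM.le (hpA k)
    have hNq := fun k => hM.le (hqA k)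
    set T := ∑ k, q k * x' * p k with hTdef
    have hTN : T ∈ N := sum_mem fun k _ => mul_mem (mul_mem (hNq k) hx'N) (hNp k)
    have e1 : tr η (x' * star w) = tr η (T * star w) := by
      have h1 : ∀ k, tr η (q k * x' * p k * star w) = tr η (x' * p k * star w) := fun k => by
        have h2 : p k * star w * q k = p k * star w := by
          calc p k * star w * q k = p k * (star w * w) * p k * star w := by
                simp only [q, mul_assoc]
            _ = _ := by rw [hw1, mul_one, (hp.proj k).isIdempotentElem.eq]
        rw [mul_assoc, mul_assoc, hT.tracial _ (hNq k) _
          (mul_mem hx'N (mul_mem (hNp k) hsw)), mul_assoc x', h2, ← mul_assoc]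
      rw [hTdef, Finset.sum_mul, map_sum]
      simp only [h1]
      rw [← map_sum, ← Finset.sum_mul, ← Finset.mul_sum, hp1, mul_one]
    have b1 : ‖tr η ((x - x') * star w)‖ ≤ ε / 3 := by
      have := norm_tr_le η w (x - x')
      rw [hnw, one_mul, ← hT.tracial _ (sub_mem hx hx'N) _ hsw] at this
      exact this.trans hxx'.le
    have b2 : ‖tr η (T * (star w - y))‖ ≤ ε / 3 := by
      have h1 := norm_tr_le η (star T) (star w - y)
      rw [star_star, hT.nrm_star hTN] at h1
      have h2 : nrm η T ≤ ‖x'‖ := (hT.nrm_le T).trans (hq.norm_sum_le hp x')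
      calc _ ≤ _ := h1
        _ ≤ ‖x'‖ * (ε / 3 / (‖x'‖ + 1)) :=
          mul_le_mul h2 hwy.le (nrm_nonneg _ _) (norm_nonneg _)
        _ ≤ ε / 3 := by
          rw [mul_div_assoc', div_le_iff₀ (by positivity)]
          nlinarith [norm_nonneg x']
    have b3 : ‖tr η (T * y)‖ ≤ ε / 3 := by
      have h1 : ∀ k, ‖tr η (q k * x' * p k * y)‖ ≤
          nrm η (q k * 1) * nrm η (E (x' * p k * y)) := fun k => by
        have h2 := norm_tr_le η (q k) (E (x' * p k * y))
        rw [(hq.proj k).isSelfAdjoint.star_eq, ← hM.E_left hE (hqA k), hE.tr N n η hM.le hT _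
          (mul_mem (hNq k) (mul_mem (mul_mem hx'N (hNp k)) hyN))] at h2
        rw [mul_one]
        simpa only [mul_assoc] using h2
      have h3 : ‖tr η (T * y)‖ ≤ ∑ k, nrm η (q k * 1) * nrm η (E (x' * p k * y)) := by
        rw [hTdef, Finset.sum_mul, map_sum]
        exact (norm_sum_le _ _).trans (Finset.sum_le_sum fun k _ => h1 k)
      have h4 := Finset.sum_mul_sq_le_sq_mul_sq Finset.univ (fun k => nrm η (q k * 1))
        (fun k => nrm η (E (x' * p k * y)))
      rw [sum_nrm_sq_mul hq hq1, hT.nrm_one, one_pow, one_mul] at h4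
      exact h3.trans (le_of_sq_le_sq (h4.trans hF.le) (by positivity))
    have e2 : tr η (x * star w) = tr η ((x - x') * star w) + (tr η (T * (star w - y)) +
        tr η (T * y)) := by
      rw [← map_add, ← mul_add, sub_add_cancel, ← e1, ← map_add, ← add_mul, sub_add_cancel]
    rw [e2]
    have := norm_add_le (tr η ((x - x') * star w)) (tr η (T * (star w - y)) + tr η (T * y))
    have := norm_add_le (tr η (T * (star w - y))) (tr η (T * y))
    linarith
  have h0 : w - E w = 0 := hT.faithful _ hx
    (pow_eq_zero_iff two_ne_zero |>.1 (le_antisymm key (sq_nonneg _)))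
  rw [sub_eq_zero.1 h0]
  exact hEw

end IsTensor

end TensorMixing

section Bundling

variable {H : Type*} [NormedAddCommGroup H] [InnerProductSpace ℂ H] [CompleteSpace H]
variable {M A : Set (H →L[ℂ] H)} {N B : VonNeumannAlgebra H}

theorem exists_coe_eq (hM : IsVonNeumannAlgebra M) :
    ∃ N : VonNeumannAlgebra H, (N : Set (H →L[ℂ] H)) = M := by
  refine ⟨{ carrier := M
            mul_mem' := fun ha hb => hM.mul_mem _ ha _ hb
            one_mem' := hM.one_mem
            add_mem' := fun ha hb => hM.add_mem _ ha _ hb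
            zero_mem' := ?_
            algebraMap_mem' := fun r => ?_
            star_mem' := fun ha => hM.star_mem _ ha
            centralizer_centralizer' := hM.double_commutant }, rfl⟩
  · simpa using hM.smul_mem 0 1 hM.one_mem
  · rw [Algebra.algebraMap_eq_smul_one]
    exact hM.smul_mem r 1 hM.one_mem

theorem mem_iff_of_isMasa (hA : IsMasa M A) {x : H →L[ℂ] H} :
    x ∈ A ↔ x ∈ M ∧ ∀ a ∈ A, x * a = a * x := by
  conv_lhs => rw [← hA.2.2]
  rfl

theorem isVonNeumannAlgebra_of_isMasa (hM : IsVonNeumannAlgebra M) (hA : IsMasa M A) :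
    IsVonNeumannAlgebra A := by
  have h := @mem_iff_of_isMasa _ _ _ _ _ _ hA
  refine ⟨?_, ?_, ?_, ?_, hA.2.1, ?_⟩
  · exact h.2 ⟨hM.one_mem, fun a _ => by rw [one_mul, mul_one]⟩
  · intro x hx y hy
    refine h.2 ⟨hM.add_mem _ (hA.1 hx) _ (hA.1 hy), fun a ha => ?_⟩
    rw [add_mul, mul_add, (h.1 hx).2 a ha, (h.1 hy).2 a ha]
  · intro x hx y hy
    refine h.2 ⟨hM.mul_mem _ (hA.1 hx) _ (hA.1 hy), fun a ha => ?_⟩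
    rw [mul_assoc, (h.1 hy).2 a ha, ← mul_assoc, (h.1 hx).2 a ha, mul_assoc]
  · intro c x hx
    refine h.2 ⟨hM.smul_mem _ _ (hA.1 hx), fun a ha => ?_⟩
    rw [smul_mul_assoc, mul_smul_comm, (h.1 hx).2 a ha]
  · refine Set.Subset.antisymm (fun x hx => h.2 ⟨?_, fun a ha => ?_⟩)
      Set.subset_centralizer_centralizer
    · rw [← hM.double_commutant]
      exact Set.centralizer_subset (Set.centralizer_subset hA.1) hx
    · exact (Set.mem_centralizer_iff.1 hx a
        (Set.mem_centralizer_iff.2 fun b hb => ((h.1 ha).2 b hb).symm)).symm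

theorem isMasaIn_of_isMasa (h : IsMasa (N : Set (H →L[ℂ] H)) B) : IsMasaIn N B :=
  ⟨h.1, fun _ hx y hy => ((mem_iff_of_isMasa h).1 hx).2 y hy, fun _ hx hx' => (mem_iff_of_isMasa h).2 ⟨hx, hx'⟩⟩

theorem IsMasaIn.isMasa (h : IsMasaIn N B) : IsMasa (N : Set (H →L[ℂ] H)) B :=
  ⟨h.le, fun _ ha => star_mem ha, Set.Subset.antisymm (fun x hx => h.max x hx.1 hx.2)
    fun x hx => ⟨h.le hx, fun a ha => h.comm x hx a ha⟩⟩

theorem isSingularIn_of_normAlg (h : normAlg (N : Set (H →L[ℂ] H)) B = B) :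
    IsSingularIn N B := by
  intro u hu hus huu huB
  rw [← SetLike.mem_coe, ← h, normAlg, ← coe_gen]
  refine subset_gen ⟨hu, ⟨by rw [hus, huu], by rw [hus, huu]⟩, ?_⟩
  refine Set.Subset.antisymm ?_ fun a ha => ⟨u * a * u, huB a ha, ?_⟩
  · rintro _ ⟨a, ha, rfl⟩
    simp only [hus]
    exact huB a ha
  · simp only [hus]
    calc u * (u * a * u) * u = (u * u) * a * (u * u) := by simp only [mul_assoc]
      _ = a := by rw [huu, one_mul, mul_one]

theorem IsMasaIn.normAlg_eq (h : IsMasaIn N B)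
    (hw : ∀ w ∈ N, star w * w = 1 → w * star w = 1 → (∀ p ∈ B, w * p * star w ∈ B) → w ∈ B) :
    normAlg (N : Set (H →L[ℂ] H)) B = B := by
  rw [normAlg, ← coe_gen]
  refine Set.Subset.antisymm (gen_le fun w hwn => ?_) fun a ha => ?_
  · refine hw w hwn.1 hwn.2.1.1 hwn.2.1.2 fun p hp => ?_
    have : w * p * star w ∈ (fun a => w * a * star w) '' (B : Set (H →L[ℂ] H)) := ⟨p, hp, rfl⟩
    rwa [hwn.2.2] at this
  · refine mem_gen_iff.2 fun y hy => commute_of_commute_projections (fun p hp hpp => ?_) ha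
    set u : H →L[ℂ] H := p + p - 1 with hu
    have huB : u ∈ B := sub_mem (add_mem hp hp) (one_mem _)
    have hus : star u = u := by
      simp only [hu, star_sub, star_add, star_one, hpp.isSelfAdjoint.star_eq]
    have huu : u * u = 1 := by
      simp only [hu, mul_sub, sub_mul, add_mul, mul_add, hpp.isIdempotentElem.eq, mul_one, one_mul]
      abel
    have e : ∀ a ∈ B, u * a * star u = a := fun a ha => by
      rw [hus, h.comm u huB a ha, mul_assoc, huu, mul_one]
    have h1 := (hy u ⟨h.le huB, ⟨by rw [hus, huu], by rw [hus, huu]⟩, by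
      refine Set.Subset.antisymm ?_ fun a ha => ⟨a, ha, e a ha⟩
      rintro _ ⟨a, ha, rfl⟩
      rw [SetLike.mem_coe] at ha ⊢
      simpa only [e a ha] using ha⟩).1
    rw [hu, sub_mul, mul_sub, one_mul, mul_one, sub_left_inj, add_mul, mul_add, ← two_smul ℂ,
      ← two_smul ℂ (y * p)] at h1
    exact (smul_right_injective _ (two_ne_zero (α := ℂ)) h1).symm

end Bundling

end TensorMasa

/-- If `Aᵢ` is a singular MASA in the II₁ factor `Mᵢ` (`i = 1, 2`) and
`M = M₁ ⊗̄ M₂`, then `A = A₁ ⊗̄ A₂` is a singular MASA in `M`. -/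
theorem tensor_product_of_singular_masas_is_singular
    {H : Type*} [NormedAddCommGroup H] [InnerProductSpace ℂ H] [CompleteSpace H]
    (M M₁ M₂ A₁ A₂ : Set (H →L[ℂ] H)) (τ : (H →L[ℂ] H) → ℂ)
    (hM : IsII1Factor M τ)
    (hM₁ : IsVonNeumannAlgebra M₁) (hM₁M : M₁ ⊆ M)
    (hM₁f : IsFactor M₁) (hM₁i : IsInfiniteDimensionalSet M₁)
    (hM₂ : IsVonNeumannAlgebra M₂) (hM₂M : M₂ ⊆ M)
    (hM₂f : IsFactor M₂) (hM₂i : IsInfiniteDimensionalSet M₂)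
    (hcomm : ∀ x ∈ M₁, ∀ y ∈ M₂, x * y = y * x)
    (htens : ∀ x ∈ M₁, ∀ y ∈ M₂, τ (x * y) = τ x * τ y)
    (hgen : M = vNgen (M₁ ∪ M₂))
    (hA₁ : IsMasa M₁ A₁) (hA₂ : IsMasa M₂ A₂)
    (hsing₁ : normAlg M₁ A₁ = A₁) (hsing₂ : normAlg M₂ A₂ = A₂) :
    IsMasa M (vNgen (A₁ ∪ A₂)) ∧ normAlg M (vNgen (A₁ ∪ A₂)) = vNgen (A₁ ∪ A₂) := by
  obtain ⟨B₁, rfl⟩ := TensorMasa.exists_coe_eq (TensorMasa.isVonNeumannAlgebra_of_isMasa hM₁ hA₁)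
  obtain ⟨B₂, rfl⟩ := TensorMasa.exists_coe_eq (TensorMasa.isVonNeumannAlgebra_of_isMasa hM₂ hA₂)
  obtain ⟨N, rfl⟩ := TensorMasa.exists_coe_eq hM.vna
  obtain ⟨N₁, rfl⟩ := TensorMasa.exists_coe_eq hM₁
  obtain ⟨N₂, rfl⟩ := TensorMasa.exists_coe_eq hM₂
  obtain ⟨n, η, hT, hτ⟩ := TensorMasa.FTS.exists_tr_eq hM.trace hM.factor
  have hN : TensorMasa.IsTensor N N₁ N₂ η := by
    refine ⟨hM₁M, hM₂M, hcomm, fun x hx y hy => ?_, fun x hx => ?_⟩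
    · rw [← hτ _ (mul_mem (hM₁M hx) (hM₂M hy)), ← hτ _ (hM₁M hx), ← hτ _ (hM₂M hy)]
      exact htens x hx y hy
    · rw [← SetLike.mem_coe, TensorMasa.coe_gen, ← hgen]
      exact hx
  have h₁ := TensorMasa.isMasaIn_of_isMasa hA₁
  have h₂ := TensorMasa.isMasaIn_of_isMasa hA₂
  have h := hN.isMasaIn h₁ h₂ hT
  rw [← TensorMasa.coe_gen]
  exact ⟨h.isMasa, h.normAlg_eq fun w hw hw1 hw2 hwA => hN.mem_of_normalizes h₁ h₂ hT
    (TensorMasa.isSingularIn_of_normAlg hsing₁) (TensorMasa.isSingularIn_of_normAlg hsing₂)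
    hw hw1 hw2 hwA⟩
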